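/- arXiv:1401.1516 — 2 statements merged into one kernel-verified Lean document; each statement's English description precedes it below -/
import Mathlib

section
/- There exist number fields K and K' that are not isomorphic as fields such that for every integer d ≥ 2 the following holds: there is an infinite family (A_i)_{i ∈ ℕ} of pairwise non-isomorphic central division algebras of degree d over K, and for each i a central division algebra A'_i of degree d over K', such that for every i and every finite-dimensional central simple ℚ-algebra B, B lies in the fiber (Res_{K/ℚ})⁻¹(A_i) if and only if B lies in the fiber (Res_{K'/ℚ})⁻¹(A'_i), and each of these fibers contains at least one finite-dimensional central simple ℚ-algebra. -/
open TensorProduct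

/-- A bundled finite-dimensional central simple algebra over the field `k`. -/
structure CSAlg (k : Type) [Field k] : Type 1 where
  carrier : Type
  [ring : Ring carrier]
  [alg : Algebra k carrier]
  finiteDimensional : FiniteDimensional k carrier
  isSimpleRing : IsSimpleRing carrier
  center_le_bot : Subalgebra.center k carrier ≤ ⊥

attribute [instance] CSAlg.ring CSAlg.alg

/-- `A` is a division algebra. -/
def CSAlg.IsDivision {k : Type} [Field k] (A : CSAlg k) : Prop :=
  ∀ x : A.carrier, x ≠ 0 → IsUnit x

/-- `A` has degree `d`, i.e. dimension `d ^ 2` over the base field. -/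
def CSAlg.DegreeEq {k : Type} [Field k] (A : CSAlg k) (d : ℕ) : Prop :=
  Module.finrank k A.carrier = d ^ 2

/-- Brauer equivalence of two `k`-algebras: some matrix algebras over them are
isomorphic as `k`-algebras. -/
def IsBrauerEquiv (k : Type) [Field k] (A : Type) [Ring A] [Algebra k A]
    (B : Type) [Ring B] [Algebra k B] : Prop :=
  ∃ n m : ℕ, 0 < n ∧ 0 < m ∧
    Nonempty (Matrix (Fin n) (Fin n) A ≃ₐ[k] Matrix (Fin m) (Fin m) B)

/-- A central simple `F`-algebra `B` lies in the fiber `(Res_{K/F})⁻¹(A)` if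
`B ⊗[F] K` is Brauer-equivalent to `A` over `K`. -/
def InFiber (F : Type) [Field F] (K : Type) [Field K] [Algebra F K]
    (A : CSAlg K) (B : CSAlg F) : Prop :=
  IsBrauerEquiv K (K ⊗[F] B.carrier) A.carrier

/-- A bundled number field. -/
structure NumField : Type 1 where
  carrier : Type
  [field : Field carrier]
  [numberField : NumberField carrier]

attribute [instance] NumField.field NumField.numberField

section TensorSimple

variable {k A B : Type*} [Field k] [Ring A] [Algebra k A] [Ring B] [Algebra k B]

theorem equivFinsuppOfBasisLeft_one_tmul_mul {ι : Type*} [DecidableEq ι] (b : Module.Basis ι k A)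
    (c : B) (x : A ⊗[k] B) (i : ι) :
    TensorProduct.equivFinsuppOfBasisLeft b ((1 ⊗ₜ c) * x) i =
      c * TensorProduct.equivFinsuppOfBasisLeft b x i := by
  induction x using TensorProduct.induction_on with
  | zero => simp
  | tmul a d => simp
  | add x y hx hy => simp [mul_add, hx, hy]

theorem equivFinsuppOfBasisLeft_mul_one_tmul {ι : Type*} [DecidableEq ι] (b : Module.Basis ι k A)
    (c : B) (x : A ⊗[k] B) (i : ι) :
    TensorProduct.equivFinsuppOfBasisLeft b (x * (1 ⊗ₜ c)) i =
      TensorProduct.equivFinsuppOfBasisLeft b x i * c := by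
  induction x using TensorProduct.induction_on with
  | zero => simp
  | tmul a d => simp
  | add x y hx hy => simp [add_mul, hx, hy]

/-- Over a field, the elements of `A ⊗ B` commuting with a central algebra `B` come from `A`. -/
theorem exists_tmul_one_of_forall_commute (hB : Subalgebra.center k B ≤ ⊥) (x : A ⊗[k] B)
    (hx : ∀ c : B, (1 ⊗ₜ c) * x = x * (1 ⊗ₜ c)) : ∃ a : A, x = a ⊗ₜ 1 := by
  have h1 : x ∈ Subalgebra.centralizer k
      (Algebra.TensorProduct.includeRight : B →ₐ[k] A ⊗[k] B).range := by
    rw [Subalgebra.mem_centralizer_iff]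
    rintro _ ⟨c, rfl⟩
    exact hx c
  rw [Subalgebra.centralizer_range_includeRight_eq_center_tensorProduct] at h1
  obtain ⟨y, rfl⟩ := h1
  induction y using TensorProduct.induction_on with
  | zero => exact ⟨0, by simp⟩
  | tmul a c =>
    obtain ⟨r, hr⟩ := Algebra.mem_bot.mp (hB c.2)
    refine ⟨r • a, ?_⟩
    simp only [AlgHom.toRingHom_eq_coe, RingHom.coe_coe, Algebra.TensorProduct.map_tmul,
      AlgHom.coe_id, id_eq, Subalgebra.coe_val]
    rw [← hr, Algebra.algebraMap_eq_smul_one, TensorProduct.smul_tmul]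
  | add y z hy hz =>
    have key : ∀ y : A ⊗[k] Subalgebra.center k B, ∀ c : B,
        (1 ⊗ₜ c) * (Algebra.TensorProduct.map (AlgHom.id k A) (Subalgebra.center k B).val) y =
        (Algebra.TensorProduct.map (AlgHom.id k A) (Subalgebra.center k B).val) y * (1 ⊗ₜ c) := by
      intro y c
      induction y using TensorProduct.induction_on with
      | zero => simp
      | tmul a d => simp [(Subalgebra.mem_center_iff.mp d.2) c]
      | add y z hy hz => simp [mul_add, add_mul, hy, hz]
    obtain ⟨a, ha⟩ := hy (key y)
    obtain ⟨a', ha'⟩ := hz (key z)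
    refine ⟨a + a', ?_⟩
    rw [TensorProduct.add_tmul, ← ha, ← ha']
    simp

/-- The tensor product of a simple algebra with a central simple algebra is simple. -/
theorem isSimpleRing_tensorProduct [IsSimpleRing A] [IsSimpleRing B]
    (hB : Subalgebra.center k B ≤ ⊥) : IsSimpleRing (A ⊗[k] B) := by
  classical
  let b := Module.Basis.ofVectorSpace k A
  let E := TensorProduct.equivFinsuppOfBasisLeft (N := B) b
  have : Nontrivial (A ⊗[k] B) := inferInstance
  refine IsSimpleRing.of_eq_bot_or_eq_top fun I => or_iff_not_imp_left.mpr fun hI => ?_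
  rw [← TwoSidedIdeal.one_mem_iff]
  have main : ∀ n : ℕ, ∀ x ∈ I, x ≠ 0 → (E x).support.card = n → 1 ∈ I := by
    intro n
    induction n using Nat.strong_induction_on with
    | _ n ih =>
    intro x hxI hx0 hn
    obtain ⟨i, hi⟩ : ∃ i, E x i ≠ 0 := by
      by_contra! h
      exact hx0 (E.injective (by ext i; simpa using h i))
    let J : TwoSidedIdeal B := TwoSidedIdeal.mk'
      {c | ∃ y ∈ I, (∀ j, E x j = 0 → E y j = 0) ∧ E y i = c}
      ⟨0, I.zero_mem, by simp, by simp⟩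
      (by
        rintro _ _ ⟨y, hy, hy', rfl⟩ ⟨z, hz, hz', rfl⟩
        exact ⟨y + z, I.add_mem hy hz, fun j hj => by simp [hy' j hj, hz' j hj], by simp⟩)
      (by
        rintro _ ⟨y, hy, hy', rfl⟩
        exact ⟨-y, I.neg_mem hy, fun j hj => by simp [hy' j hj], by simp⟩)
      (by
        rintro c _ ⟨y, hy, hy', rfl⟩
        exact ⟨(1 ⊗ₜ c) * y, I.mul_mem_left _ _ hy,
          fun j hj => (equivFinsuppOfBasisLeft_one_tmul_mul b c y j).trans
            (by rw [show TensorProduct.equivFinsuppOfBasisLeft b y j = 0 from hy' j hj, mul_zero]),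
          equivFinsuppOfBasisLeft_one_tmul_mul b c y i⟩)
      (by
        rintro _ c ⟨y, hy, hy', rfl⟩
        exact ⟨y * (1 ⊗ₜ c), I.mul_mem_right _ _ hy,
          fun j hj => (equivFinsuppOfBasisLeft_mul_one_tmul b c y j).trans
            (by rw [show TensorProduct.equivFinsuppOfBasisLeft b y j = 0 from hy' j hj, zero_mul]),
          equivFinsuppOfBasisLeft_mul_one_tmul b c y i⟩)
    have hJ : (1 : B) ∈ J := by
      refine IsSimpleRing.one_mem_of_ne_zero_mem J hi ?_
      rw [TwoSidedIdeal.mem_mk']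
      exact ⟨x, hxI, fun _ h => h, rfl⟩
    rw [TwoSidedIdeal.mem_mk'] at hJ
    obtain ⟨y, hyI, hyx, hy1⟩ := hJ
    by_cases hc : ∀ c : B, (1 ⊗ₜ c) * y = y * (1 ⊗ₜ c)
    · obtain ⟨a, rfl⟩ := exists_tmul_one_of_forall_commute hB y hc
      have ha : a ≠ 0 := by
        rintro rfl
        simp at hy1
      have h1 := IsSimpleRing.one_mem_of_ne_zero_mem
        (I.comap (Algebra.TensorProduct.includeLeft : A →ₐ[k] A ⊗[k] B)) ha
        (by rw [TwoSidedIdeal.mem_comap]; exact hyI)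
      rw [TwoSidedIdeal.mem_comap] at h1
      simpa [Algebra.TensorProduct.one_def] using h1
    · push Not at hc
      obtain ⟨c, hc⟩ := hc
      refine ih _ ?_ ((1 ⊗ₜ c) * y - y * (1 ⊗ₜ c))
        (I.sub_mem (I.mul_mem_left _ _ hyI) (I.mul_mem_right _ _ hyI)) (sub_ne_zero.mpr hc) rfl
      have hz : ∀ j, E ((1 ⊗ₜ c) * y - y * (1 ⊗ₜ c)) j = c * E y j - E y j * c := by
        intro j
        rw [map_sub, Finsupp.sub_apply]
        exact congrArg₂ _ (equivFinsuppOfBasisLeft_one_tmul_mul b c y j)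
          (equivFinsuppOfBasisLeft_mul_one_tmul b c y j)
      rw [← hn]
      refine Finset.card_lt_card (Finset.ssubset_iff_subset_ne.mpr ⟨fun j hj => ?_, fun h => ?_⟩)
      · rw [Finsupp.mem_support_iff, hz] at hj
        rw [Finsupp.mem_support_iff]
        intro h
        exact hj (by rw [hyx j h]; simp)
      · have : i ∈ (E x).support := by simpa using hi
        rw [← h, Finsupp.mem_support_iff, hz, hy1] at this
        simp at this
  obtain ⟨x, hx, hx0⟩ := SetLike.exists_of_lt (bot_lt_iff_ne_bot.mpr hI)
  exact main _ x hx (by simpa using hx0) rfl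

/-- Base change preserves being central. -/
theorem center_baseChange_le_bot {K : Type*} [Field K] [Algebra k K]
    (hB : Subalgebra.center k B ≤ ⊥) : Subalgebra.center K (K ⊗[k] B) ≤ ⊥ := by
  intro x hx
  rw [Subalgebra.mem_center_iff] at hx
  obtain ⟨a, rfl⟩ := exists_tmul_one_of_forall_commute hB x fun c => hx _
  exact Algebra.mem_bot.mpr ⟨a, by simp [Algebra.TensorProduct.algebraMap_apply]⟩

end TensorSimple

section Descent

/-- All finite modules over a finite-dimensional simple algebra are powers of a simple one. -/
theorem finrank_simple_ideal_dvd_finrank {K R V : Type*} [Field K] [Ring R] [Algebra K R]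
    [IsSimpleRing R] [FiniteDimensional K R] (S : Ideal R) [IsSimpleModule R S]
    [AddCommGroup V] [Module K V] [Module R V] [IsScalarTower K R V]
    [FiniteDimensional K V] : Module.finrank K S ∣ Module.finrank K V := by
  have : IsArtinianRing R := IsArtinianRing.of_finite K R
  have hV : IsIsotypicOfType R V S := fun m hm => by
    obtain ⟨I, ⟨e⟩⟩ := IsSemisimpleRing.exists_linearEquiv_ideal_of_isSimpleModule R m
    have := IsSimpleModule.congr e.symm
    exact ⟨e.trans (IsSimpleRing.isIsotypic R R S I).some⟩
  have : Module.Finite R V := Module.Finite.of_restrictScalars_finite K R V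
  obtain ⟨n, ⟨e⟩⟩ := hV.linearEquiv_fun
  exact ⟨n, by rw [(e.restrictScalars K).finrank_eq, Module.finrank_pi_fintype]; simp [mul_comm]⟩

theorem finrank_simple_ideal_dvd_of_algHom {K R V : Type*} [Field K] [Ring R] [Algebra K R]
    [IsSimpleRing R] [FiniteDimensional K R] (S : Ideal R) [IsSimpleModule R S]
    [AddCommGroup V] [Module K V] [FiniteDimensional K V] (f : R →ₐ[K] Module.End K V) :
    Module.finrank K S ∣ Module.finrank K V := by
  let : Module R V := Module.compHom V f.toRingHom
  have : IsScalarTower K R V := ⟨fun a r v => by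
    change f (a • r) v = a • f r v
    simp⟩
  exact finrank_simple_ideal_dvd_finrank S

/-- If a simple algebra acts on spaces of dimensions `a * N` and `b * N` with `a`, `b` coprime,
then it acts on a space of dimension `N`. -/
theorem nonempty_algHom_matrix_of_coprime {K R : Type*} [Field K] [Ring R] [Algebra K R]
    [IsSimpleRing R] [FiniteDimensional K R] {V W : Type*} [AddCommGroup V] [Module K V]
    [FiniteDimensional K V] [AddCommGroup W] [Module K W] [FiniteDimensional K W]
    (f : R →ₐ[K] Module.End K V) (g : R →ₐ[K] Module.End K W) {a b N : ℕ} (hab : a.Coprime b)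
    (hV : Module.finrank K V = a * N) (hW : Module.finrank K W = b * N) :
    Nonempty (R →ₐ[K] Matrix (Fin N) (Fin N) K) := by
  have : IsArtinianRing R := IsArtinianRing.of_finite K R
  obtain ⟨S, hS⟩ := IsAtomic.exists_atom (Ideal R)
  have hS : IsSimpleModule R S := isSimpleModule_iff_isAtom.mpr hS
  obtain ⟨n, hn⟩ : Module.finrank K S ∣ N := by
    have h1 := finrank_simple_ideal_dvd_of_algHom S f
    have h2 := finrank_simple_ideal_dvd_of_algHom S g
    rw [hV] at h1
    rw [hW] at h2
    have := Nat.dvd_gcd h1 h2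
    rwa [Nat.gcd_mul_right, hab, one_mul] at this
  have hN : Module.finrank K (Fin n → S) = N := by
    rw [Module.finrank_pi_fintype, hn]; simp [mul_comm]
  exact ⟨(algEquivMatrix (Module.finBasisOfFinrankEq K (Fin n → S) hN)).toAlgHom.comp
    (Algebra.lsmul K K (Fin n → S))⟩

/-- `N × N` matrices over a finite-dimensional algebra `Λ` act on `Λ ^ N`. -/
theorem exists_algHom_end_of_algHom_matrix {K R Λ : Type*} [Field K] [Ring R] [Algebra K R]
    [Ring Λ] [Algebra K Λ] {N : ℕ} (f : R →ₐ[K] Matrix (Fin N) (Fin N) Λ) :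
    Nonempty (R →ₐ[K] Module.End K (Fin N → Λ)) :=
  ⟨((endVecAlgEquivMatrixEnd (Fin N) K K Λ).symm.toAlgHom.comp
    (AlgHom.mapMatrix (Algebra.lmul K Λ))).comp f⟩

/-- Descent of matrix representations along two extensions of coprime degrees. -/
theorem nonempty_algHom_matrix_of_descent {F K K' C Λ₁ Λ₂ : Type*} [Field F] [Field K] [Algebra F K]
    [CommRing K'] [Algebra F K'] [Ring C] [Algebra F C] [FiniteDimensional F C]
    [IsSimpleRing (K ⊗[F] C)]
    [CommRing Λ₁] [Algebra F Λ₁] [Algebra K Λ₁] [IsScalarTower F K Λ₁] [FiniteDimensional K Λ₁]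
    [CommRing Λ₂] [Algebra F Λ₂] [Algebra K Λ₂] [IsScalarTower F K Λ₂] [FiniteDimensional K Λ₂]
    (f₁ : K' →ₐ[F] Λ₁) (f₂ : K' →ₐ[F] Λ₂)
    (hab : (Module.finrank K Λ₁).Coprime (Module.finrank K Λ₂)) {N : ℕ}
    (φ : C →ₐ[F] Matrix (Fin N) (Fin N) K') :
    Nonempty (C →ₐ[F] Matrix (Fin N) (Fin N) K) := by
  obtain ⟨g₁⟩ := exists_algHom_end_of_algHom_matrix (K := K)
    (AlgHom.liftEquiv F K C (Matrix (Fin N) (Fin N) Λ₁) (f₁.mapMatrix.comp φ))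
  obtain ⟨g₂⟩ := exists_algHom_end_of_algHom_matrix (K := K)
    (AlgHom.liftEquiv F K C (Matrix (Fin N) (Fin N) Λ₂) (f₂.mapMatrix.comp φ))
  obtain ⟨g⟩ := nonempty_algHom_matrix_of_coprime g₁ g₂ (N := N) hab
    (by rw [Module.finrank_pi_fintype]; simp [mul_comm])
    (by rw [Module.finrank_pi_fintype]; simp [mul_comm])
  exact ⟨(g.restrictScalars F).comp Algebra.TensorProduct.includeRight⟩

end Descent

section Fiber

/-- Modules over a division algebra are determined by their dimension. -/
theorem nonempty_linearEquiv_of_isUnit {K D X Y : Type*} [Field K] [Ring D] [Algebra K D]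
    [Nontrivial D] [FiniteDimensional K D] (hD : ∀ x : D, x ≠ 0 → IsUnit x)
    [AddCommGroup X] [Module K X] [Module D X] [IsScalarTower K D X] [FiniteDimensional K X]
    [AddCommGroup Y] [Module K Y] [Module D Y] [IsScalarTower K D Y] [FiniteDimensional K Y]
    (h : Module.finrank K X = Module.finrank K Y) : Nonempty (X ≃ₗ[D] Y) := by
  let : DivisionRing D := DivisionRing.ofIsUnitOrEqZero fun x => by
    by_cases hx : x = 0
    · exact Or.inr hx
    · exact Or.inl (hD x hx)
  have : Module.Finite D X := Module.Finite.of_restrictScalars_finite K D X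
  have : Module.Finite D Y := Module.Finite.of_restrictScalars_finite K D Y
  refine FiniteDimensional.nonempty_linearEquiv_of_finrank_eq ?_
  have hpos : 0 < Module.finrank K D := Module.finrank_pos
  rw [← Module.finrank_mul_finrank K D X, ← Module.finrank_mul_finrank K D Y] at h
  exact Nat.eq_of_mul_eq_mul_left hpos h

/-- An algebra of the right dimension acting on a right vector space over a division algebra `A`,
commuting with `A`, is a matrix algebra over `A`. -/
theorem nonempty_algEquiv_matrix_of_commute {K R A V : Type*} [Field K] [Ring R] [Algebra K R]
    [IsSimpleRing R] [FiniteDimensional K R] [Ring A] [Algebra K A] [Nontrivial A]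
    [FiniteDimensional K A] (hA : ∀ x : A, x ≠ 0 → IsUnit x)
    [AddCommGroup V] [Module K V] [FiniteDimensional K V] (f : R →ₐ[K] Module.End K V)
    (g : Aᵐᵒᵖ →ₐ[K] Module.End K V) (hfg : ∀ r a, f r * g a = g a * f r) {m : ℕ}
    (hV : Module.finrank K V = m * Module.finrank K A)
    (hR : Module.finrank K R = m * m * Module.finrank K A) :
    Nonempty (R ≃ₐ[K] Matrix (Fin m) (Fin m) A) := by
  let : Module Aᵐᵒᵖ V := Module.compHom V g.toRingHom
  have hsmul : ∀ (a : Aᵐᵒᵖ) (v : V), a • v = g a v := fun _ _ => rfl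
  have : IsScalarTower K Aᵐᵒᵖ V := ⟨fun c a v => by simp [hsmul]⟩
  have hu : ∀ x : Aᵐᵒᵖ, x ≠ 0 → IsUnit x := fun x hx => by
    have := hA x.unop (by simpa using hx)
    exact this.op
  have hrank : Module.finrank K V = Module.finrank K (Fin m → A) := by
    rw [Module.finrank_pi_fintype, hV]; simp
  obtain ⟨e⟩ := nonempty_linearEquiv_of_isUnit hu hrank
  let F : R →ₐ[K] Module.End Aᵐᵒᵖ (Fin m → A) := AlgHom.ofLinearMap
    { toFun := fun r =>
        { toFun := fun x => e (f r (e.symm x))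
          map_add' := fun x y => by simp
          map_smul' := fun a x => by
            have h : f r (g a (e.symm x)) = g a (f r (e.symm x)) := by
              have := congrArg (fun t => t (e.symm x)) (hfg r a)
              simpa using this
            rw [map_smul, hsmul, h, ← hsmul, map_smul, RingHom.id_apply] }
      map_add' := fun r s => by refine LinearMap.ext fun x => ?_; simp
      map_smul' := fun c r => by
        refine LinearMap.ext fun x => ?_
        change e (f (c • r) (e.symm x)) = c • e (f r (e.symm x))
        rw [map_smul]
        exact (e.restrictScalars K).map_smul c (f r (e.symm x)) }
    (by refine LinearMap.ext fun x => ?_; simp)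
    (fun r s => by refine LinearMap.ext fun x => ?_; simp)
  let G : Module.End Aᵐᵒᵖ (Fin m → A) ≃ₐ[K] Matrix (Fin m) (Fin m) A :=
    (endVecAlgEquivMatrixEnd (Fin m) K Aᵐᵒᵖ A).trans
      (AlgEquiv.mapMatrix (AlgEquiv.moduleEndSelfOp K).symm)
  let H : R →ₐ[K] Matrix (Fin m) (Fin m) A := G.toAlgHom.comp F
  have hinj : Function.Injective H := by
    by_cases hm : m = 0
    · subst hm
      have h0 : Module.finrank K R = 0 := by simpa using hR
      have : 0 < Module.finrank K R := Module.finrank_pos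
      omega
    · have : NeZero m := ⟨hm⟩
      exact RingHom.injective (H : R →+* Matrix (Fin m) (Fin m) A)
  refine ⟨AlgEquiv.ofBijective H ⟨hinj, ?_⟩⟩
  refine (LinearMap.injective_iff_surjective_of_finrank_eq_finrank (f := H.toLinearMap) ?_).mp hinj
  rw [hR, Module.finrank_matrix]; simp

theorem center_matrix_le_bot {F B : Type*} [Field F] [Ring B] [Algebra F B]
    (hB : Subalgebra.center F B ≤ ⊥) (n : ℕ) :
    Subalgebra.center F (Matrix (Fin n) (Fin n) B) ≤ ⊥ := by
  have : Algebra.IsCentral F B := ⟨hB⟩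
  exact Algebra.IsCentral.out

/-- Base change commutes with matrix algebras. -/
theorem nonempty_algEquiv_matrix_baseChange {F K B : Type*} [Field F] [Field K] [Algebra F K]
    [Ring B] [Algebra F B] [IsSimpleRing B] [FiniteDimensional F B]
    (hB : Subalgebra.center F B ≤ ⊥) {n : ℕ} (hn : 0 < n) :
    Nonempty ((K ⊗[F] Matrix (Fin n) (Fin n) B) ≃ₐ[K] Matrix (Fin n) (Fin n) (K ⊗[F] B)) := by
  have : NeZero n := ⟨hn.ne'⟩
  have : IsSimpleRing (K ⊗[F] Matrix (Fin n) (Fin n) B) :=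
    isSimpleRing_tensorProduct (center_matrix_le_bot hB n)
  let H := AlgHom.liftEquiv F K (Matrix (Fin n) (Fin n) B) (Matrix (Fin n) (Fin n) (K ⊗[F] B))
    (AlgHom.mapMatrix Algebra.TensorProduct.includeRight)
  have hinj : Function.Injective H :=
    RingHom.injective (H : (K ⊗[F] Matrix (Fin n) (Fin n) B) →+* Matrix (Fin n) (Fin n) (K ⊗[F] B))
  refine ⟨AlgEquiv.ofBijective H ⟨hinj, ?_⟩⟩
  refine (LinearMap.injective_iff_surjective_of_finrank_eq_finrank (f := H.toLinearMap) ?_).mp hinj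
  simp [Module.finrank_matrix]

variable {F K B B₀ : Type} [Field F] [Field K] [Algebra F K] [Ring B] [Algebra F B]
  [Ring B₀] [Algebra F B₀]

theorem nonempty_algHom_matrix_of_algHom {n m : ℕ} [FiniteDimensional F B₀]
    (φ : Matrix (Fin n) (Fin n) (K ⊗[F] B) →ₐ[K] Matrix (Fin m) (Fin m) (K ⊗[F] B₀)) :
    Nonempty ((Matrix (Fin n) (Fin n) B ⊗[F] B₀ᵐᵒᵖ) →ₐ[F]
      Matrix (Fin (m * Module.finrank F B₀)) (Fin (m * Module.finrank F B₀)) K) := by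
  let A := K ⊗[F] B₀
  let α : Matrix (Fin n) (Fin n) B →ₐ[F] Matrix (Fin m) (Fin m) (Module.End K A) :=
    (((Algebra.lmul K A).mapMatrix.comp φ).restrictScalars F).comp
      (AlgHom.mapMatrix Algebra.TensorProduct.includeRight)
  let β : B₀ᵐᵒᵖ →ₐ[F] Matrix (Fin m) (Fin m) (Module.End K A) :=
    (((Matrix.scalarAlgHom (Fin m) K).comp
      (Algebra.lsmul K K A : Aᵐᵒᵖ →ₐ[K] Module.End K A)).restrictScalars F).comp
      (AlgHom.op Algebra.TensorProduct.includeRight)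
  let γ : Matrix (Fin n) (Fin n) B ⊗[F] B₀ᵐᵒᵖ →ₐ[F] Matrix (Fin m) (Fin m) (Module.End K A) :=
    Algebra.TensorProduct.lift α β fun x y => by
      refine (Matrix.scalar_commute_iff.mpr ?_).symm
      refine Matrix.ext fun i j => LinearMap.ext fun z => ?_
      exact mul_assoc
        (φ (x.map (Algebra.TensorProduct.includeRight : B →ₐ[F] K ⊗[F] B)) i j) z
        (Algebra.TensorProduct.includeRight y.unop : K ⊗[F] B₀)
  have hd : Module.finrank K (Fin m → A) = m * Module.finrank F B₀ := by
    rw [Module.finrank_pi_fintype]; simp [A]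
  exact ⟨((algEquivMatrix (Module.finBasisOfFinrankEq K (Fin m → A) hd)).toAlgHom.comp
    (endVecAlgEquivMatrixEnd (Fin m) K K A).symm.toAlgHom |>.restrictScalars F).comp γ⟩

theorem nonempty_algEquiv_matrix_of_algHom {n m : ℕ} (hn : 0 < n)
    [IsSimpleRing B] [FiniteDimensional F B] (hB : Subalgebra.center F B ≤ ⊥)
    [FiniteDimensional F B₀] [Nontrivial B₀] (hA : ∀ x : K ⊗[F] B₀, x ≠ 0 → IsUnit x)
    (hd : n ^ 2 * Module.finrank F B = m ^ 2 * Module.finrank F B₀)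
    (ψ : (Matrix (Fin n) (Fin n) B ⊗[F] B₀ᵐᵒᵖ) →ₐ[F]
      Matrix (Fin (m * Module.finrank F B₀)) (Fin (m * Module.finrank F B₀)) K) :
    Nonempty (Matrix (Fin n) (Fin n) (K ⊗[F] B) ≃ₐ[K] Matrix (Fin m) (Fin m) (K ⊗[F] B₀)) := by
  have : NeZero n := ⟨hn.ne'⟩
  have : IsSimpleRing (K ⊗[F] Matrix (Fin n) (Fin n) B) :=
    isSimpleRing_tensorProduct (center_matrix_le_bot hB n)
  obtain ⟨e⟩ := nonempty_algEquiv_matrix_baseChange (K := K) hB hn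
  set N := m * Module.finrank F B₀
  let ψ' : (Matrix (Fin n) (Fin n) B ⊗[F] B₀ᵐᵒᵖ) →ₐ[F] Module.End K (Fin N → K) :=
    (Matrix.toLinAlgEquiv'.toAlgHom.restrictScalars F).comp ψ
  let f := AlgHom.liftEquiv F K _ _ (ψ'.comp Algebra.TensorProduct.includeLeft)
  let g' := AlgHom.liftEquiv F K _ _
    (AlgHom.opComm.symm (ψ'.comp Algebra.TensorProduct.includeRight))
  let g := AlgHom.opComm g'
  have hfg : ∀ r a, f r * g a = g a * f r := by
    intro r a
    obtain ⟨a, rfl⟩ := MulOpposite.op_surjective a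
    induction r using TensorProduct.induction_on with
    | zero => simp
    | add x y hx hy => simp [mul_add, add_mul, hx, hy]
    | tmul c M =>
      induction a using TensorProduct.induction_on with
      | zero => simp
      | add x y hx hy => simp [mul_add, add_mul, hx, hy]
      | tmul c' b =>
        have h1 : f (c ⊗ₜ M) = c • ψ' (M ⊗ₜ 1) := by simp [f]
        have h2 : g (MulOpposite.op (c' ⊗ₜ b)) = c' • ψ' (1 ⊗ₜ MulOpposite.op b) := by
          simp [g, g', AlgHom.opComm]
        rw [h1, h2, smul_mul_smul_comm, smul_mul_smul_comm, ← map_mul, ← map_mul, mul_comm c']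
        simp
  obtain ⟨e'⟩ := nonempty_algEquiv_matrix_of_commute (m := m) hA f g hfg
    (by simp [N])
    (by simp [Module.finrank_matrix]; linarith)
  exact ⟨e.symm.trans e'⟩

/-- The fiber of restriction over a division algebra defined over the base field is detected by
matrix representations. -/
theorem isBrauerEquiv_baseChange_iff [IsSimpleRing B] [FiniteDimensional F B]
    (hB : Subalgebra.center F B ≤ ⊥) [FiniteDimensional F B₀] [Nontrivial B₀]
    (hA : ∀ x : K ⊗[F] B₀, x ≠ 0 → IsUnit x) :
    IsBrauerEquiv K (K ⊗[F] B) (K ⊗[F] B₀) ↔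
      ∃ n m : ℕ, 0 < n ∧ 0 < m ∧ n ^ 2 * Module.finrank F B = m ^ 2 * Module.finrank F B₀ ∧
        Nonempty ((Matrix (Fin n) (Fin n) B ⊗[F] B₀ᵐᵒᵖ) →ₐ[F]
          Matrix (Fin (m * Module.finrank F B₀)) (Fin (m * Module.finrank F B₀)) K) := by
  constructor
  · rintro ⟨n, m, hn, hm, ⟨φ⟩⟩
    refine ⟨n, m, hn, hm, ?_, nonempty_algHom_matrix_of_algHom φ.toAlgHom⟩
    have := φ.toLinearEquiv.finrank_eq
    simp [Module.finrank_matrix] at this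
    linarith
  · rintro ⟨n, m, hn, hm, hd, ⟨ψ⟩⟩
    exact ⟨n, m, hn, hm, nonempty_algEquiv_matrix_of_algHom hn hB hA hd ψ⟩

theorem center_mulOpposite_le_bot (hB : Subalgebra.center F B ≤ ⊥) :
    Subalgebra.center F Bᵐᵒᵖ ≤ ⊥ := by
  have : Algebra.IsCentral F B := ⟨hB⟩
  exact Algebra.IsCentral.out

/-- Comparison of fibers over two fields linked by extensions of coprime degrees. -/
theorem isBrauerEquiv_baseChange_of_descent {K' : Type} [Field K'] [Algebra F K']
    [IsSimpleRing B] [FiniteDimensional F B]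
    (hB : Subalgebra.center F B ≤ ⊥) [FiniteDimensional F B₀] [IsSimpleRing B₀]
    (hB₀ : Subalgebra.center F B₀ ≤ ⊥)
    (hA : ∀ x : K ⊗[F] B₀, x ≠ 0 → IsUnit x) (hA' : ∀ x : K' ⊗[F] B₀, x ≠ 0 → IsUnit x)
    {Λ₁ Λ₂ : Type*}
    [CommRing Λ₁] [Algebra F Λ₁] [Algebra K Λ₁] [IsScalarTower F K Λ₁] [FiniteDimensional K Λ₁]
    [CommRing Λ₂] [Algebra F Λ₂] [Algebra K Λ₂] [IsScalarTower F K Λ₂] [FiniteDimensional K Λ₂]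
    (f₁ : K' →ₐ[F] Λ₁) (f₂ : K' →ₐ[F] Λ₂)
    (hab : (Module.finrank K Λ₁).Coprime (Module.finrank K Λ₂))
    (h : IsBrauerEquiv K' (K' ⊗[F] B) (K' ⊗[F] B₀)) :
    IsBrauerEquiv K (K ⊗[F] B) (K ⊗[F] B₀) := by
  rw [isBrauerEquiv_baseChange_iff hB hA'] at h
  rw [isBrauerEquiv_baseChange_iff hB hA]
  obtain ⟨n, m, hn, hm, hd, ⟨ψ⟩⟩ := h
  refine ⟨n, m, hn, hm, hd, ?_⟩
  have : NeZero n := ⟨hn.ne'⟩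
  have h1 : IsSimpleRing (K ⊗[F] Matrix (Fin n) (Fin n) B) :=
    isSimpleRing_tensorProduct (center_matrix_le_bot hB n)
  have h2 : IsSimpleRing ((K ⊗[F] Matrix (Fin n) (Fin n) B) ⊗[F] B₀ᵐᵒᵖ) :=
    isSimpleRing_tensorProduct (center_mulOpposite_le_bot hB₀)
  have h3 : IsSimpleRing (K ⊗[F] (Matrix (Fin n) (Fin n) B ⊗[F] B₀ᵐᵒᵖ)) :=
    IsSimpleRing.of_ringEquiv
      (Algebra.TensorProduct.assoc F F F K (Matrix (Fin n) (Fin n) B) B₀ᵐᵒᵖ).toRingEquiv h2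
  exact nonempty_algHom_matrix_of_descent f₁ f₂ hab ψ

end Fiber

section Cyclic

variable {k E : Type*} [Field k] [Field E] [Algebra k E]

/-- The twisted permutation matrix used in the matrix model of a cyclic algebra. -/
def cyclicShift (a : E) (d : ℕ) [NeZero d] : Matrix (Fin d) (Fin d) E :=
  Matrix.of fun i j => if j = i + 1 then (if i + 1 = 0 then a else 1) else 0

/-- The matrix model of the cyclic algebra attached to an endomorphism `σ` and an element `a`. -/
def cyclicAlgebra (σ : E →ₐ[k] E) (a : E) (d : ℕ) [NeZero d] :
    Subalgebra k (Matrix (Fin d) (Fin d) E) where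
  carrier := {M | cyclicShift a d * M = σ.mapMatrix M * cyclicShift a d}
  mul_mem' {M N} hM hN := by
    simp only [Set.mem_ofPred_eq] at *
    rw [← mul_assoc, hM, mul_assoc, hN, map_mul, mul_assoc]
  add_mem' {M N} hM hN := by
    simp only [Set.mem_ofPred_eq] at *
    rw [mul_add, hM, hN, map_add, add_mul]
  algebraMap_mem' r := by
    simp only [Set.mem_ofPred_eq, AlgHom.commutes]
    exact (Algebra.commutes r _).symm

theorem mem_cyclicAlgebra_iff {σ : E →ₐ[k] E} {a : E} {d : ℕ} [NeZero d]
    {M : Matrix (Fin d) (Fin d) E} : M ∈ cyclicAlgebra σ a d ↔ ∀ i j,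
      (if i + 1 = 0 then a else 1) * M (i + 1) (j + 1) =
        (if j + 1 = 0 then a else 1) * σ (M i j) := by
  have h1 : ∀ i j, (cyclicShift a d * M) i j = (if i + 1 = 0 then a else 1) * M (i + 1) j := by
    intro i j
    simp [cyclicShift, Matrix.mul_apply]
  have h2 : ∀ i j, (σ.mapMatrix M * cyclicShift a d) i (j + 1) =
      (if j + 1 = 0 then a else 1) * σ (M i j) := by
    intro i j
    rw [Matrix.mul_apply, Finset.sum_eq_single j]
    · simp [cyclicShift, mul_comm]
    · intro b _ hb
      have : ¬ (j + 1 = b + 1) := fun h => hb (add_right_cancel h).symm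
      simp [cyclicShift, this]
    · simp
  change cyclicShift a d * M = σ.mapMatrix M * cyclicShift a d ↔ _
  constructor
  · intro h i j
    rw [← h1, h, h2]
  · intro h
    refine Matrix.ext fun i j => ?_
    obtain ⟨j, rfl⟩ : ∃ j', j = j' + 1 := ⟨j - 1, by simp⟩
    rw [h1, h2, h]

/-- The element of the cyclic algebra with first row `y`. -/
def cyclicOfRow (σ : E →ₐ[k] E) (a : E) {d : ℕ} [NeZero d] (y : Fin d → E) :
    Matrix (Fin d) (Fin d) E :=
  Matrix.of fun i j => (σ ^ (i : ℕ)) (y (j - i)) * if j < i then a else 1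

theorem Fin.val_add_one_cases {d : ℕ} [NeZero d] (i : Fin d) :
    (i + 1 = 0 ∧ (i : ℕ) + 1 = d) ∨ (i + 1 ≠ 0 ∧ ((i + 1 : Fin d) : ℕ) = i + 1) := by
  have hd := NeZero.pos d
  rcases lt_or_ge ((i : ℕ) + 1) d with h | h
  · right
    have h1 : ((i + 1 : Fin d) : ℕ) = i + 1 := by
      rw [Fin.val_add, Fin.val_one', Nat.add_mod_mod, Nat.mod_eq_of_lt h]
    exact ⟨fun h0 => by rw [h0] at h1; simp at h1, h1⟩
  · left
    have h1 : (i : ℕ) + 1 = d := by omega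
    refine ⟨Fin.ext ?_, h1⟩
    rw [Fin.val_add, Fin.val_one', Nat.add_mod_mod, h1]
    simp

theorem AlgHom.pow_succ_apply' (σ : E →ₐ[k] E) (n : ℕ) (x : E) :
    (σ ^ (n + 1)) x = σ ((σ ^ n) x) := by
  rw [pow_succ']; rfl

theorem cyclicOfRow_mem {σ : E →ₐ[k] E} {a : E} {d : ℕ} [NeZero d] (ha : σ a = a)
    {y : Fin d → E} (hy : ∀ j, (σ ^ d) (y j) = y j) :
    cyclicOfRow σ a y ∈ cyclicAlgebra σ a d := by
  rw [mem_cyclicAlgebra_iff]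
  intro i j
  have hij : (j + 1) - (i + 1) = j - i := by simp
  have hi' := i.2
  have hj' := j.2
  simp only [cyclicOfRow, Matrix.of_apply, hij, map_mul, ← AlgHom.pow_succ_apply', Fin.lt_def]
  rcases Fin.val_add_one_cases i with ⟨hi, hid⟩ | ⟨hi, hid⟩ <;>
    rcases Fin.val_add_one_cases j with ⟨hj, hjd⟩ | ⟨hj, hjd⟩
  · have : i = j := Fin.ext (by omega)
    subst this
    simp [hi, hid, hy]
  · have : (j : ℕ) < i := by
      have := (j + 1 : Fin d).2
      rw [hjd] at this
      clear hj
      omega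
    simp [hi, hj, hid, hy, this, ha, mul_comm]
  · have : ¬ (j : ℕ) < i := by omega
    simp [hi, hj, hid, this, mul_comm]
  · simp only [hi, hj, hid, hjd, if_false]
    by_cases h : (j : ℕ) < i <;> simp [h, ha]

theorem eq_cyclicOfRow_of_mem {σ : E →ₐ[k] E} {a : E} {d : ℕ} [NeZero d] (ha : σ a = a)
    {M : Matrix (Fin d) (Fin d) E} (hM : M ∈ cyclicAlgebra σ a d) :
    M = cyclicOfRow σ a (M 0) := by
  rw [mem_cyclicAlgebra_iff] at hM
  have : ∀ n : ℕ, ∀ hn : n < d, ∀ j, M ⟨n, hn⟩ j = cyclicOfRow σ a (M 0) ⟨n, hn⟩ j := by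
    intro n
    induction n with
    | zero =>
      intro hn j
      have h0 : (⟨0, hn⟩ : Fin d) = 0 := rfl
      simp [cyclicOfRow, h0]
    | succ n ih =>
      intro hn j
      obtain ⟨j, rfl⟩ : ∃ j', j = j' + 1 := ⟨j - 1, by simp⟩
      have hn' : n < d := by omega
      have h1 := hM ⟨n, hn'⟩ j
      rcases Fin.val_add_one_cases (⟨n, hn'⟩ : Fin d) with ⟨-, h⟩ | ⟨h, h'⟩
      · simp at h; omega
      have h2 : (⟨n + 1, hn⟩ : Fin d) = ⟨n, hn'⟩ + 1 := Fin.ext (by rw [h'])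
      rw [h2]
      rw [if_neg h, one_mul, ih hn'] at h1
      rw [h1]
      have hij : (j + 1) - (⟨n, hn'⟩ + 1) = j - ⟨n, hn'⟩ := by simp
      simp only [cyclicOfRow, Matrix.of_apply, hij, map_mul, h', AlgHom.pow_succ_apply', Fin.lt_def]
      have hj' := j.2
      rcases Fin.val_add_one_cases j with ⟨hj, hjd⟩ | ⟨hj, hjd⟩
      · have : ¬ (j : ℕ) < n := by omega
        simp [hj, this, mul_comm]
      · by_cases h : (j : ℕ) < n <;> simp [hj, hjd, h, ha]
  exact Matrix.ext fun i j => this i.1 i.2 j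

theorem pow_apply_row_of_mem {σ : E →ₐ[k] E} {a : E} (ha0 : a ≠ 0) {d : ℕ} [NeZero d] (ha : σ a = a)
    {M : Matrix (Fin d) (Fin d) E} (hM : M ∈ cyclicAlgebra σ a d) (j : Fin d) :
    (σ ^ d) (M 0 j) = M 0 j := by
  have h0 := eq_cyclicOfRow_of_mem ha hM
  rw [mem_cyclicAlgebra_iff] at hM
  obtain ⟨j, rfl⟩ : ∃ j', j = j' + 1 := ⟨j - 1, by simp⟩
  have hd := NeZero.pos d
  let i : Fin d := ⟨d - 1, by omega⟩
  have hi : (i : ℕ) + 1 = d := by simp [i]; omega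
  have hi0 : i + 1 = 0 := by
    rcases Fin.val_add_one_cases i with h | h
    · exact h.1
    · have := (i + 1 : Fin d).2
      omega
  have h1 := hM i j
  have h2 : M i j = (σ ^ (i : ℕ)) (M 0 (j - i)) * if j < i then a else 1 := congrFun₂ h0 i j
  have h3 : j - i = j + 1 := by rw [eq_neg_of_add_eq_zero_left hi0]; simp
  rw [h2, hi0, if_pos rfl, map_mul, ← AlgHom.pow_succ_apply', hi, h3] at h1
  have hj' := j.2
  rcases Fin.val_add_one_cases j with ⟨hj, hjd⟩ | ⟨hj, hjd⟩
  · have : ¬ j < i := by rw [Fin.lt_def]; omega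
    rw [if_pos hj, if_neg this, map_one, mul_one] at h1
    exact (mul_left_cancel₀ ha0 h1).symm
  · have : j < i := by
      have := (j + 1 : Fin d).2
      rw [Fin.lt_def]; omega
    rw [if_neg hj, if_pos this, ha, one_mul, mul_comm] at h1
    exact (mul_right_cancel₀ ha0 h1).symm

/-- The dimension of a cyclic algebra. -/
theorem finrank_cyclicAlgebra [FiniteDimensional k E] {σ : E →ₐ[k] E} {a : E} (ha0 : a ≠ 0) {d : ℕ} [NeZero d]
    (ha : σ a = a) :
    Module.finrank k (cyclicAlgebra σ a d) =
      d * Module.finrank k (AlgHom.equalizer (σ ^ d) (AlgHom.id k E)) := by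
  let L := AlgHom.equalizer (σ ^ d) (AlgHom.id k E)
  let f : cyclicAlgebra σ a d →ₗ[k] (Fin d → L) :=
    { toFun := fun M j => ⟨M.1 0 j, pow_apply_row_of_mem ha0 ha M.2 j⟩
      map_add' := fun M N => rfl
      map_smul' := fun c M => rfl }
  have hf : Function.Bijective f := by
    constructor
    · intro M N h
      refine Subtype.ext ?_
      rw [eq_cyclicOfRow_of_mem ha M.2, eq_cyclicOfRow_of_mem ha N.2]
      congr 1
      funext j
      exact congrArg Subtype.val (congrFun h j)
    · intro y
      refine ⟨⟨cyclicOfRow σ a fun j => (y j : E), cyclicOfRow_mem ha fun j => (y j).2⟩, ?_⟩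
      funext j
      refine Subtype.ext ?_
      change cyclicOfRow σ a (fun j => (y j : E)) 0 j = y j
      simp [cyclicOfRow]
  rw [(LinearEquiv.ofBijective f hf).finrank_eq, Module.finrank_pi_fintype]
  simp [L]

/-- Cyclic algebras are central. -/
theorem center_cyclicAlgebra_le_bot {σ : E →ₐ[k] E} {a : E} {d : ℕ} [NeZero d]
    (hd : 2 ≤ d) (ha : σ a = a) (hfix : ∀ x, σ x = x → ∃ c : k, algebraMap k E c = x)
    (hL : ∀ n, 0 < n → n < d → ∃ y, (σ ^ d) y = y ∧ (σ ^ n) y ≠ y) :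
    Subalgebra.center k (cyclicAlgebra σ a d) ≤ ⊥ := by
  intro M hM
  rw [Subalgebra.mem_center_iff] at hM
  have hcomm : ∀ y : Fin d → E, (∀ j, (σ ^ d) (y j) = y j) →
      cyclicOfRow σ a y * M.1 = M.1 * cyclicOfRow σ a y := fun y hy =>
    congrArg Subtype.val (hM ⟨_, cyclicOfRow_mem ha hy⟩)
  have h1 : ∀ j : Fin d, j ≠ 0 → M.1 0 j = 0 := by
    intro j hj
    by_contra h0
    obtain ⟨y, hy, hy'⟩ := hL j (Nat.pos_of_ne_zero fun h => hj (Fin.ext h)) j.2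
    have := congrFun₂ (hcomm (Pi.single 0 y) fun i => by
      by_cases hi : i = 0
      · subst hi; simpa using hy
      · simp [hi]) 0 j
    rw [Matrix.mul_apply, Matrix.mul_apply, Finset.sum_eq_single 0, Finset.sum_eq_single j] at this
    · have h2 : y * M.1 0 j = M.1 0 j * (σ ^ (j : ℕ)) y := by simpa [cyclicOfRow] using this
      rw [mul_comm] at h2
      exact hy' (mul_left_cancel₀ h0 h2).symm
    · intro b _ hb
      simp [cyclicOfRow, Pi.single_apply, sub_eq_zero, hb.symm]
    · simp
    · intro b _ hb
      simp [cyclicOfRow, Pi.single_apply, hb]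
    · simp
  have hone : ((1 : Fin d) : ℕ) = 1 := by
    rw [Fin.val_one', Nat.mod_eq_of_lt (by omega)]
  have h10 : (1 : Fin d) ≠ 0 := fun h => by rw [h] at hone; simp at hone
  have hMrow : M.1 = cyclicOfRow σ a (Pi.single 0 (M.1 0 0)) := by
    refine (eq_cyclicOfRow_of_mem ha M.2).trans ?_
    congr 1
    funext j
    by_cases hj : j = 0
    · subst hj; simp
    · simp [hj, h1 j hj]
  have hdiag : ∀ i j, M.1 i j = if i = j then (σ ^ (i : ℕ)) (M.1 0 0) else 0 := by
    intro i j
    refine (congrFun₂ hMrow i j).trans ?_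
    by_cases h : i = j
    · subst h; simp [cyclicOfRow]
    · simp [cyclicOfRow, Pi.single_apply, sub_eq_zero, h, Ne.symm h]
  have h2 : σ (M.1 0 0) = M.1 0 0 := by
    have := congrFun₂ (hcomm (Pi.single 1 1) fun i => by
      by_cases hi : i = 1
      · subst hi; simp
      · simp [hi]) 0 1
    rw [Matrix.mul_apply, Matrix.mul_apply, Finset.sum_eq_single 1, Finset.sum_eq_single 0] at this
    · rw [hdiag 1 1, hone] at this
      simpa [cyclicOfRow] using this
    · intro b _ hb
      rw [hdiag]
      simp [hb.symm]
    · simp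
    · intro b _ hb
      rw [hdiag]
      simp [hb]
    · simp
  obtain ⟨c, hc⟩ := hfix _ h2
  refine Algebra.mem_bot.mpr ⟨c, Subtype.ext (Matrix.ext fun i j => ?_)⟩
  rw [hdiag, ← hc, AlgHom.commutes]
  simp [Matrix.algebraMap_matrix_apply]

end Cyclic

section NoZeroDivisors

open WithZero

variable {k W : Type*} [Field k] [Field W] [Algebra k W]

/-- A common refinement of a valuation and the grading by diagonals. -/
noncomputable def diagonalWeight {d : ℕ} (v : Valuation W ℤᵐ⁰) (M : Matrix (Fin d) (Fin d) W)
    (i j : Fin d) : ℤ :=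
  d * log (v (M i j)) + i - j

theorem diagonalWeight_add_one {φ : W →ₐ[k] W} {a : W} {d : ℕ} [NeZero d] {v : Valuation W ℤᵐ⁰}
    (hva : v a = exp (-1)) (hφ : ∀ x, v (φ x) = v x) {M : Matrix (Fin d) (Fin d) W}
    (hM : M ∈ cyclicAlgebra φ a d) {i j : Fin d} (h0 : M i j ≠ 0) :
    M (i + 1) (j + 1) ≠ 0 ∧
      diagonalWeight v M (i + 1) (j + 1) = diagonalWeight v M i j := by
  have ha0 : a ≠ 0 := by
    rintro rfl
    rw [map_zero] at hva
    exact exp_ne_zero hva.symm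
  have h1 := mem_cyclicAlgebra_iff.mp hM i j
  have hφ0 : φ (M i j) ≠ 0 := (map_ne_zero φ).mpr h0
  have hc : ∀ i : Fin d, (if i + 1 = 0 then a else 1) ≠ 0 := fun i => by
    split_ifs
    · exact ha0
    · exact one_ne_zero
  have hM1 : M (i + 1) (j + 1) ≠ 0 := by
    intro h
    rw [h, mul_zero] at h1
    exact mul_ne_zero (hc j) hφ0 h1.symm
  refine ⟨hM1, ?_⟩
  have h2 := congrArg (fun x => log (v x)) h1
  simp only [map_mul] at h2
  rw [log_mul (by simpa using hc i) (by simpa using hM1),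
    log_mul (by simpa using hc j) (by simpa using hφ0), hφ] at h2
  have hl : ∀ i : Fin d,
      ((i + 1 : Fin d) : ℤ) = i + 1 + d * log (v (if i + 1 = 0 then a else 1)) := by
    intro i
    rcases Fin.val_add_one_cases i with ⟨hi, hid⟩ | ⟨hi, hid⟩
    · have hid' : (d : ℤ) = i + 1 := by exact_mod_cast hid.symm
      rw [if_pos hi, hva, hi, log_exp, hid']
      simp
    · rw [if_neg hi, hid]; simp
  simp only [diagonalWeight, hl]
  linear_combination (d : ℤ) * h2

theorem diagonalWeight_add {φ : W →ₐ[k] W} {a : W} {d : ℕ} [NeZero d] {v : Valuation W ℤᵐ⁰}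
    (hva : v a = exp (-1)) (hφ : ∀ x, v (φ x) = v x) {M : Matrix (Fin d) (Fin d) W}
    (hM : M ∈ cyclicAlgebra φ a d) {i j : Fin d} (h0 : M i j ≠ 0) (t : Fin d) :
    M (i + t) (j + t) ≠ 0 ∧
      diagonalWeight v M (i + t) (j + t) = diagonalWeight v M i j := by
  have : ∀ n : ℕ, M (i + (Fin.ofNat d n)) (j + Fin.ofNat d n) ≠ 0 ∧
      diagonalWeight v M (i + Fin.ofNat d n) (j + Fin.ofNat d n) = diagonalWeight v M i j := by
    intro n
    induction n with
    | zero => simpa using h0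
    | succ n ih =>
      have h := diagonalWeight_add_one hva hφ hM ih.1
      have h1 : Fin.ofNat d (n + 1) = Fin.ofNat d n + 1 := by
        refine Fin.ext ?_
        simp [Fin.ofNat, Fin.val_add]
      rw [h1, ← add_assoc, ← add_assoc]
      exact ⟨h.1, h.2.trans ih.2⟩
  simpa using this t

/-- Every row of a nonzero element has an entry of maximal weight. -/
theorem exists_row_diagonalWeight_max {φ : W →ₐ[k] W} {a : W} {d : ℕ} [NeZero d]
    {v : Valuation W ℤᵐ⁰} (hva : v a = exp (-1)) (hφ : ∀ x, v (φ x) = v x)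
    {M : Matrix (Fin d) (Fin d) W} (hM : M ∈ cyclicAlgebra φ a d) (h0 : M ≠ 0) (r : Fin d) :
    ∃ s, M r s ≠ 0 ∧ ∀ i j, M i j ≠ 0 → diagonalWeight v M i j ≤ diagonalWeight v M r s := by
  classical
  obtain ⟨i, j, hij⟩ : ∃ i j, M i j ≠ 0 := by
    by_contra! h
    exact h0 (Matrix.ext h)
  obtain ⟨⟨i, j⟩, hp, hmax⟩ := Finset.exists_max_image
    (Finset.univ.filter fun p : Fin d × Fin d => M p.1 p.2 ≠ 0)
    (fun p => diagonalWeight v M p.1 p.2) ⟨(i, j), by simpa using hij⟩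
  have h := diagonalWeight_add hva hφ hM (i := i) (j := j) (by simpa using hp) (r - i)
  rw [add_sub_cancel] at h
  exact ⟨_, h.1, fun i' j' h' => h.2 ▸ hmax (i', j') (by simpa using h')⟩

/-- If `a` is a uniformizer then the cyclic algebra has no zero divisors. -/
theorem mul_ne_zero_of_mem_cyclicAlgebra {φ : W →ₐ[k] W} {a : W} {d : ℕ} [NeZero d]
    {v : Valuation W ℤᵐ⁰} (hva : v a = exp (-1)) (hφ : ∀ x, v (φ x) = v x)
    {M N : Matrix (Fin d) (Fin d) W} (hM : M ∈ cyclicAlgebra φ a d) (hM0 : M ≠ 0)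
    (hN : N ∈ cyclicAlgebra φ a d) (hN0 : N ≠ 0) : M * N ≠ 0 := by
  classical
  obtain ⟨s, hs, hsmax⟩ := exists_row_diagonalWeight_max hva hφ hM hM0 0
  obtain ⟨t, ht, htmax⟩ := exists_row_diagonalWeight_max hva hφ hN hN0 s
  intro h
  have h1 := congrFun₂ h 0 t
  rw [Matrix.mul_apply, Matrix.zero_apply, ← Finset.add_sum_erase _ _ (Finset.mem_univ s)] at h1
  have h2 : v (∑ x ∈ Finset.univ.erase s, M 0 x * N x t) < v (M 0 s * N s t) := by
    refine Valuation.map_sum_lt v (by simp [hs, ht]) fun j hj => ?_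
    have hjs : j ≠ s := Finset.ne_of_mem_erase hj
    by_cases hj1 : M 0 j = 0
    · simp [hj1, zero_lt_iff, hs, ht]
    by_cases hj2 : N j t = 0
    · simp [hj2, zero_lt_iff, hs, ht]
    have e1 := hsmax 0 j hj1
    have e2 := htmax j t hj2
    rw [← log_lt_log (by simp [hj1, hj2]) (by simp [hs, ht]), map_mul, map_mul,
      log_mul (by simpa using hj1) (by simpa using hj2), log_mul (by simpa using hs)
      (by simpa using ht)]
    simp only [diagonalWeight] at e1 e2
    set x := log (v (M 0 j))
    set y := log (v (N j t))
    set x' := log (v (M 0 s))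
    set y' := log (v (N s t))
    have hjs' : (j : ℤ) ≠ s := fun h => hjs (Fin.ext (by exact_mod_cast h))
    have hj' : (j : ℤ) < d := by exact_mod_cast j.2
    have hs' : (s : ℤ) < d := by exact_mod_cast s.2
    have hj0 : (0 : ℤ) ≤ j := by positivity
    have hs0 : (0 : ℤ) ≤ s := by positivity
    have hd : (0 : ℤ) < d := by exact_mod_cast NeZero.pos d
    have e3 : d * (x - x') ≤ (j : ℤ) - s := by linarith
    have e4 : d * (y - y') ≤ (s : ℤ) - j := by linarith
    have e5 : x - x' < 1 := by
      by_contra! h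
      nlinarith
    have e6 : y - y' < 1 := by
      by_contra! h
      nlinarith
    rcases lt_or_gt_of_ne hjs' with h | h
    · have : x - x' < 0 := by
        by_contra! h
        nlinarith
      linarith [Int.le_of_lt_add_one (show y - y' < 0 + 1 by linarith)]
    · have : y - y' < 0 := by
        by_contra! h
        nlinarith
      linarith [Int.le_of_lt_add_one (show x - x' < 0 + 1 by linarith)]
  rw [eq_neg_of_add_eq_zero_left h1, Valuation.map_neg] at h2
  exact lt_irrefl _ h2

theorem mapMatrix_mem_cyclicAlgebra {E : Type*} [Field E] [Algebra k E] {σ : E →ₐ[k] E} {b : E}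
    {φ : W →ₐ[k] W} {a : W} {d : ℕ} [NeZero d] {f : E →ₐ[k] W} (hf : ∀ x, f (σ x) = φ (f x))
    (hfb : f b = a) {M : Matrix (Fin d) (Fin d) E} (hM : M ∈ cyclicAlgebra σ b d) :
    f.mapMatrix M ∈ cyclicAlgebra φ a d := by
  rw [mem_cyclicAlgebra_iff] at *
  intro i j
  have := congrArg f (hM i j)
  simpa [apply_ite f, hfb, hf] using this

end NoZeroDivisors

section Witt

open WithZero

/-- There is a field of characteristic zero carrying a discrete valuation with uniformizer `q`, all
roots of unity of order prime to `q`, and a Frobenius lift. -/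
theorem exists_field_frobenius_valuation (q : ℕ) [hq : Fact q.Prime] :
    ∃ (W : Type) (_ : Field W) (_ : CharZero W) (φ : W →+* W) (v : Valuation W ℤᵐ⁰)
      (g : ℚ_[q] →+* W), v q = exp (-1) ∧ (∀ x, v (φ x) = v x) ∧ (∀ x, φ (g x) = g x) ∧
      ∀ n : ℕ, ¬ q ∣ n → ∃ ζ : W, IsPrimitiveRoot ζ n ∧ φ ζ = ζ ^ q := by
  let k := AlgebraicClosure (ZMod q)
  let R := WittVector q k
  have : IsDiscreteValuationRing R := WittVector.isDiscreteValuationRing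
  let W := FractionRing R
  let g₀ : ℤ_[q] →+* R :=
    (WittVector.map (algebraMap (ZMod q) k)).comp (WittVector.equiv q).symm.toRingHom
  have hg₀ : Function.Injective g₀ :=
    (WittVector.map_injective _ (algebraMap (ZMod q) k).injective).comp
      (WittVector.equiv q).symm.injective
  let g : ℤ_[q] →+* W := (algebraMap R W).comp g₀
  have hg : Function.Injective g := (IsFractionRing.injective R W).comp hg₀
  have hW : CharZero W := charZero_of_injective_ringHom hg
  let F : R ≃+* R := WittVector.frobeniusEquiv q k
  have hF : ∀ x, F x = WittVector.frobenius x := fun _ => rfl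
  let φ : W →+* W := IsFractionRing.map (A := R) (B := R) (j := F.toRingHom) F.injective
  have hφ : ∀ x : R, φ (algebraMap R W x) = algebraMap R W (F x) := fun x => by
    simp [φ, IsFractionRing.map, IsLocalization.map_eq]
  let P := IsDiscreteValuationRing.maximalIdeal R
  let v : Valuation W ℤᵐ⁰ := P.valuation W
  have hirr : Irreducible (q : R) := WittVector.irreducible q
  have hvq : v (algebraMap R W q) = exp (-1) := by
    rw [show v (algebraMap R W q) = P.intValuation q from P.valuation_of_algebraMap _]
    exact P.intValuation_singleton hirr.ne_zero hirr.maximalIdeal_eq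
  have hvu : ∀ u : R, IsUnit u → v (algebraMap R W u) = 1 := by
    intro u hu
    rw [show v (algebraMap R W u) = P.intValuation u from P.valuation_of_algebraMap _]
    rw [IsDedekindDomain.HeightOneSpectrum.intValuation_eq_one_iff]
    intro h
    exact P.isPrime.ne_top (Ideal.eq_top_of_isUnit_mem _ h hu)
  have hvR : ∀ x : R, v (algebraMap R W (F x)) = v (algebraMap R W x) := by
    intro x
    by_cases hx : x = 0
    · simp [hx]
    obtain ⟨n, hn⟩ := IsDiscreteValuationRing.associated_pow_irreducible hx hirr
    obtain ⟨u, rfl⟩ := hn.symm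
    rw [map_mul, map_mul, map_mul, map_mul, map_mul, map_pow, map_natCast F, hvu _ u.isUnit,
      hvu _ (u.isUnit.map F)]
  refine ⟨W, inferInstance, hW, φ, v, IsFractionRing.lift hg, by simpa using hvq, fun x => ?_, fun x => ?_,
    fun n hn => ?_⟩
  · obtain ⟨a, b, hb, rfl⟩ := IsFractionRing.div_surjective (A := R) x
    rw [map_div₀, map_div₀, map_div₀, hφ, hφ, hvR, hvR]
  · refine RingHom.congr_fun (f := φ.comp (IsFractionRing.lift hg))
      (IsLocalization.ringHom_ext (nonZeroDivisors ℤ_[q]) (RingHom.ext fun x => ?_)) x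
    simp only [RingHom.comp_apply, IsFractionRing.lift_algebraMap]
    change φ (algebraMap R W (g₀ x)) = algebraMap R W (g₀ x)
    rw [hφ, hF, WittVector.frobenius_eq_map_frobenius]
    congr 1
    generalize hy : (WittVector.equiv q).symm x = y
    have h : g₀ x = WittVector.map (algebraMap (ZMod q) k) y := by rw [← hy]; rfl
    rw [h]
    ext i
    rw [WittVector.map_coeff, WittVector.map_coeff, frobenius_def, ← map_pow, ZMod.pow_card]
  · have hn0 : (n : k) ≠ 0 := by
      rwa [Ne, CharP.cast_eq_zero_iff k q]
    have : NeZero (n : k) := ⟨hn0⟩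
    obtain ⟨ζ, hζ⟩ := HasEnoughRootsOfUnity.exists_primitiveRoot k n
    let T : k →* W := (algebraMap R W : R →* W).comp (WittVector.teichmuller q)
    have hT : Function.Injective T := (IsFractionRing.injective R W).comp fun x y h => by
      have h0 : (WittVector.teichmuller q x).coeff 0 = (WittVector.teichmuller q y).coeff 0 :=
        congrArg (fun z : WittVector q k => z.coeff 0) h
      rwa [WittVector.teichmuller_coeff_zero, WittVector.teichmuller_coeff_zero] at h0
    refine ⟨T ζ, hζ.map_of_injective hT, ?_⟩
    change φ (algebraMap R W (WittVector.teichmuller q ζ)) =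
      algebraMap R W (WittVector.teichmuller q ζ) ^ q
    rw [hφ, hF, WittVector.frobenius_eq_map_frobenius, WittVector.map_teichmuller, frobenius_def,
      map_pow, map_pow]

end Witt

section CyclicGalois

variable {k E : Type*} [Field k] [Field E] [Algebra k E]

theorem AlgEquiv.toAlgHom_pow_apply (σ : E ≃ₐ[k] E) (n : ℕ) (x : E) :
    ((σ : E →ₐ[k] E) ^ n) x = (σ ^ n) x := by
  induction n with
  | zero => rfl
  | succ n ih => rw [AlgHom.pow_succ_apply', ih, pow_succ']; rfl

theorem mem_fixedField_zpowers_iff (σ : E ≃ₐ[k] E) (x : E) :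
    x ∈ IntermediateField.fixedField (Subgroup.zpowers σ) ↔ σ x = x := by
  constructor
  · intro h
    exact h ⟨σ, Subgroup.mem_zpowers σ⟩
  · rintro h ⟨τ, hτ⟩
    have h : Subgroup.zpowers σ ≤ MulAction.stabilizer (E ≃ₐ[k] E) x := by
      rw [Subgroup.zpowers_le]
      exact h
    exact h hτ

variable [FiniteDimensional k E] [IsGalois k E]

theorem exists_algebraMap_eq_of_generator {σ : E ≃ₐ[k] E}
    (hσ : ∀ τ, τ ∈ Subgroup.zpowers σ) (x : E) (hx : σ x = x) : ∃ c : k, algebraMap k E c = x := by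
  refine IntermediateField.mem_bot.mp ((IsGalois.mem_bot_iff_fixed x).mpr fun τ => ?_)
  have h : Subgroup.zpowers σ ≤ MulAction.stabilizer (E ≃ₐ[k] E) x := by
    rw [Subgroup.zpowers_le]
    exact hx
  exact h (hσ τ)

theorem orderOf_eq_finrank_of_generator {σ : E ≃ₐ[k] E}
    (hσ : ∀ τ, τ ∈ Subgroup.zpowers σ) : orderOf σ = Module.finrank k E := by
  rw [← IsGalois.card_aut_eq_finrank, orderOf_eq_card_of_forall_mem_zpowers hσ]

theorem finrank_equalizer_pow {σ : E ≃ₐ[k] E} (hσ : ∀ τ, τ ∈ Subgroup.zpowers σ) {d : ℕ}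
    (hd : d ∣ Module.finrank k E) :
    Module.finrank k (AlgHom.equalizer ((σ : E →ₐ[k] E) ^ d) (AlgHom.id k E)) = d := by
  have hpos : 0 < Module.finrank k E := Module.finrank_pos
  have hd0 : d ≠ 0 := by
    rintro rfl
    simp at hd
    omega
  have h1 : AlgHom.equalizer ((σ : E →ₐ[k] E) ^ d) (AlgHom.id k E) =
      (IntermediateField.fixedField (Subgroup.zpowers (σ ^ d))).toSubalgebra := by
    ext x
    rw [AlgHom.mem_equalizer, AlgEquiv.toAlgHom_pow_apply]
    exact (mem_fixedField_zpowers_iff _ _).symm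
  rw [h1]
  change Module.finrank k (IntermediateField.fixedField (Subgroup.zpowers (σ ^ d))) = d
  have h2 := Module.finrank_mul_finrank k (IntermediateField.fixedField (Subgroup.zpowers (σ ^ d))) E
  rw [IntermediateField.finrank_fixedField_eq_card, Nat.card_zpowers,
    orderOf_pow_of_dvd hd0 (by rwa [orderOf_eq_finrank_of_generator hσ]),
    orderOf_eq_finrank_of_generator hσ] at h2
  obtain ⟨c, hc⟩ := hd
  rw [hc, Nat.mul_div_cancel_left _ (Nat.pos_of_ne_zero hd0)] at h2
  have hc0 : 0 < c := Nat.pos_of_ne_zero fun h => by simp [h] at hc; omega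
  exact Nat.eq_of_mul_eq_mul_right hc0 h2

theorem exists_pow_ne_of_lt {σ : E ≃ₐ[k] E} (hσ : ∀ τ, τ ∈ Subgroup.zpowers σ) {d : ℕ}
    (hd : d ∣ Module.finrank k E) {n : ℕ} (hn : 0 < n) (hnd : n < d) :
    ∃ y, ((σ : E →ₐ[k] E) ^ d) y = y ∧ ((σ : E →ₐ[k] E) ^ n) y ≠ y := by
  by_contra! h
  have h1 : σ ^ n ∈ (IntermediateField.fixedField (Subgroup.zpowers (σ ^ d))).fixingSubgroup := by
    rw [IntermediateField.mem_fixingSubgroup_iff]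
    intro x hx
    rw [mem_fixedField_zpowers_iff] at hx
    have := h x (by rw [AlgEquiv.toAlgHom_pow_apply, hx])
    rwa [AlgEquiv.toAlgHom_pow_apply] at this
  rw [IntermediateField.fixingSubgroup_fixedField] at h1
  obtain ⟨m, hm⟩ := h1
  have h2 : σ ^ ((d : ℤ) * m - n) = 1 := by
    have hm' : (σ ^ d) ^ m = σ ^ n := hm
    rw [zpow_sub, zpow_mul, zpow_natCast, zpow_natCast, hm', mul_inv_cancel]
  rw [← orderOf_dvd_iff_zpow_eq_one, orderOf_eq_finrank_of_generator hσ] at h2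
  have h3 : (d : ℤ) ∣ d * m - n := (Int.natCast_dvd_natCast.mpr hd).trans h2
  have h4 : (d : ℤ) ∣ n := by
    have := (Dvd.intro m rfl : (d : ℤ) ∣ d * m)
    have := dvd_sub this h3
    simpa using this
  exact absurd (Nat.le_of_dvd hn (Int.natCast_dvd_natCast.mp h4)) (by omega)

end CyclicGalois

section Cyclotomic

instance isCyclotomicExtension_cyclotomicField_rat (ℓ : ℕ) [NeZero ℓ] :
    IsCyclotomicExtension {ℓ} ℚ (CyclotomicField ℓ ℚ) :=
  CyclotomicField.isCyclotomicExtension ℓ ℚ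

/-- The Galois automorphism of a cyclotomic field raising roots of unity to the `u`-th power. -/
noncomputable def cyclotomicAut (ℓ : ℕ) [NeZero ℓ] (u : (ZMod ℓ)ˣ) :
    CyclotomicField ℓ ℚ ≃ₐ[ℚ] CyclotomicField ℓ ℚ :=
  (IsCyclotomicExtension.autEquivPow (CyclotomicField ℓ ℚ)
    (Polynomial.cyclotomic.irreducible_rat (NeZero.pos ℓ))).symm u

theorem cyclotomicAut_apply {ℓ : ℕ} [NeZero ℓ] {u : (ZMod ℓ)ˣ} {q : ℕ} (hu : (u : ZMod ℓ) = q)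
    {ζ : CyclotomicField ℓ ℚ} (hζ : IsPrimitiveRoot ζ ℓ) : cyclotomicAut ℓ u ζ = ζ ^ q := by
  have hz := IsCyclotomicExtension.zeta_spec ℓ ℚ (CyclotomicField ℓ ℚ)
  have h1 : cyclotomicAut ℓ u (IsCyclotomicExtension.zeta ℓ ℚ (CyclotomicField ℓ ℚ)) =
      IsCyclotomicExtension.zeta ℓ ℚ (CyclotomicField ℓ ℚ) ^ (u : ZMod ℓ).val := by
    have h := IsPrimitiveRoot.autToPow_spec ℚ hz (cyclotomicAut ℓ u)
    have h' : hz.autToPow ℚ (cyclotomicAut ℓ u) = u :=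
      (IsCyclotomicExtension.autEquivPow (CyclotomicField ℓ ℚ)
        (Polynomial.cyclotomic.irreducible_rat (NeZero.pos ℓ))).apply_symm_apply u
    rw [← h, h']
  obtain ⟨i, -, rfl⟩ := hz.eq_pow_of_pow_eq_one hζ.pow_eq_one
  rw [map_pow, h1, ← pow_mul, ← pow_mul, mul_comm, pow_mul, pow_mul _ i q,
    ← pow_mul, mul_comm, pow_mul]
  rw [hu, ZMod.val_natCast]
  have := pow_mod_orderOf (IsCyclotomicExtension.zeta ℓ ℚ (CyclotomicField ℓ ℚ)) q
  rw [← hz.eq_orderOf] at this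
  rw [this, ← pow_mul, ← pow_mul, mul_comm]

theorem cyclotomicAut_generator {ℓ : ℕ} [NeZero ℓ] {u : (ZMod ℓ)ˣ}
    (hu : ∀ x, x ∈ Subgroup.zpowers u) (τ : CyclotomicField ℓ ℚ ≃ₐ[ℚ] CyclotomicField ℓ ℚ) :
    τ ∈ Subgroup.zpowers (cyclotomicAut ℓ u) := by
  let e := IsCyclotomicExtension.autEquivPow (CyclotomicField ℓ ℚ)
    (Polynomial.cyclotomic.irreducible_rat (NeZero.pos ℓ))
  obtain ⟨m, hm⟩ := hu (e τ)
  refine ⟨m, ?_⟩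
  have hm' : u ^ m = e τ := hm
  change (e.symm u) ^ m = τ
  rw [← map_zpow, hm', e.symm_apply_apply]

/-- Embeddings of a cyclotomic field into a field containing roots of unity intertwine the
cyclotomic automorphisms with endomorphisms raising roots of unity to a power. -/
theorem exists_cyclotomic_embedding {W : Type*} [Field W] [CharZero W] {ℓ : ℕ} [NeZero ℓ]
    {ζ : W} (hζ : IsPrimitiveRoot ζ ℓ) :
    ∃ ι : CyclotomicField ℓ ℚ →ₐ[ℚ] W, ∀ (φ : W →ₐ[ℚ] W) (q : ℕ), φ ζ = ζ ^ q →
      ∀ u : (ZMod ℓ)ˣ, (u : ZMod ℓ) = q → ∀ x, ι (cyclotomicAut ℓ u x) = φ (ι x) := by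
  have hz := IsCyclotomicExtension.zeta_spec ℓ ℚ (CyclotomicField ℓ ℚ)
  let pb := hz.powerBasis ℚ
  have hgen : pb.gen = IsCyclotomicExtension.zeta ℓ ℚ (CyclotomicField ℓ ℚ) :=
    hz.powerBasis_gen ℚ
  have hroot : Polynomial.aeval ζ (minpoly ℚ pb.gen) = 0 := by
    rw [hgen, ← Polynomial.cyclotomic_eq_minpoly_rat hz (NeZero.pos ℓ),
      Polynomial.cyclotomic_eq_minpoly_rat hζ (NeZero.pos ℓ), minpoly.aeval]
  refine ⟨pb.lift ζ hroot, fun φ q hφ u hu x => ?_⟩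
  refine DFunLike.congr_fun (F := CyclotomicField ℓ ℚ →ₐ[ℚ] W)
    (f := (pb.lift ζ hroot).comp (cyclotomicAut ℓ u).toAlgHom) (g := φ.comp (pb.lift ζ hroot)) ?_ x
  refine pb.algHom_ext ?_
  change pb.lift ζ hroot (cyclotomicAut ℓ u pb.gen) = φ (pb.lift ζ hroot pb.gen)
  rw [cyclotomicAut_apply hu (by rw [hgen]; exact hz), map_pow, pb.lift_gen, hφ]

end Cyclotomic

section Division

theorem isUnit_of_forall_mul_ne_zero (k : Type*) {A : Type*} [Field k] [Ring A] [Algebra k A]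
    [FiniteDimensional k A] (h : ∀ x y : A, x ≠ 0 → y ≠ 0 → x * y ≠ 0) {x : A} (hx : x ≠ 0) :
    IsUnit x := by
  have : Nontrivial A := ⟨x, 0, hx⟩
  have : NoZeroDivisors A := ⟨fun {a b} hab => by
    by_contra! hne
    exact h a b hne.1 hne.2 hab⟩
  have : IsDomain A := NoZeroDivisors.to_isDomain A
  exact FiniteDimensional.isUnit k hx

theorem isSimpleRing_of_forall_isUnit {A : Type*} [Ring A] [Nontrivial A]
    (h : ∀ x : A, x ≠ 0 → IsUnit x) : IsSimpleRing A := by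
  let : DivisionRing A := DivisionRing.ofIsUnitOrEqZero fun a => by
    by_cases ha : a = 0
    · exact Or.inr ha
    · exact Or.inl (h a ha)
  infer_instance

variable {k W : Type*} [Field k] [Field W] [Algebra k W]

theorem exists_eq_scalar_of_aeval_prod_eq_zero {d : ℕ} (S : Subalgebra k (Matrix (Fin d) (Fin d) W))
    (hS : ∀ M ∈ S, ∀ N ∈ S, M ≠ 0 → N ≠ 0 → M * N ≠ 0) [Nontrivial (Matrix (Fin d) (Fin d) W)]
    {X : Matrix (Fin d) (Fin d) W} (hX : X ∈ S) (s : Multiset W)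
    (hs : ∀ r ∈ s, Matrix.scalar (Fin d) r ∈ S)
    (h0 : Polynomial.aeval X (s.map fun r => Polynomial.X - Polynomial.C r).prod = 0) :
    ∃ r ∈ s, X = Matrix.scalar (Fin d) r := by
  suffices h : Polynomial.aeval X (s.map fun r => Polynomial.X - Polynomial.C r).prod ∈ S ∧
      (Polynomial.aeval X (s.map fun r => Polynomial.X - Polynomial.C r).prod = 0 →
        ∃ r ∈ s, X = Matrix.scalar (Fin d) r) from h.2 h0
  clear h0
  induction s using Multiset.induction_on with
  | empty => simp [one_mem]
  | cons r s ih =>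
    obtain ⟨h1, h2⟩ := ih fun r hr => hs r (Multiset.mem_cons_of_mem hr)
    have h3 : Polynomial.aeval X (Polynomial.X - Polynomial.C r) = X - Matrix.scalar (Fin d) r := by
      rw [map_sub, Polynomial.aeval_X, Polynomial.aeval_C]
      rfl
    have h4 : X - Matrix.scalar (Fin d) r ∈ S := sub_mem hX (hs r (Multiset.mem_cons_self r s))
    rw [Multiset.map_cons, Multiset.prod_cons, map_mul, h3]
    refine ⟨mul_mem h4 h1, fun h => ?_⟩
    by_cases h5 : X - Matrix.scalar (Fin d) r = 0
    · exact ⟨r, Multiset.mem_cons_self r s, sub_eq_zero.mp h5⟩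
    · by_cases h6 : Polynomial.aeval X (s.map fun r => Polynomial.X - Polynomial.C r).prod = 0
      · obtain ⟨r', hr', h⟩ := h2 h6
        exact ⟨r', Multiset.mem_cons_of_mem hr', h⟩
      · exact absurd h (hS _ h4 _ h1 h5 h6)

theorem scalar_mem_cyclicAlgebra {φ : W →ₐ[k] W} {a w : W} {d : ℕ} [NeZero d] (hw : φ w = w) :
    Matrix.scalar (Fin d) w ∈ cyclicAlgebra φ a d := by
  rw [mem_cyclicAlgebra_iff]
  intro i j
  by_cases hij : i = j
  · subst hij
    simp [hw]
  · simp [hij]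

variable {E : Type*} [Field E] [Algebra k E]

theorem aeval_cyclicOfRow_single {σ : E →ₐ[k] E} {a : E} {d : ℕ} [NeZero d] (y : E)
    (p : Polynomial k) (hp : Polynomial.aeval y p = 0) :
    Polynomial.aeval (cyclicOfRow σ a (Pi.single 0 y : Fin d → E)) p = 0 := by
  let D : E →ₐ[k] Matrix (Fin d) (Fin d) E :=
    (Matrix.diagonalAlgHom k).comp (AlgHom.pi fun i : Fin d => σ ^ (i : ℕ))
  have h : cyclicOfRow σ a (Pi.single 0 y : Fin d → E) = D y := by
    ext i j
    change (σ ^ (i : ℕ)) ((Pi.single 0 y : Fin d → E) (j - i)) * (if j < i then a else 1) =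
      Matrix.diagonal (fun i : Fin d => (σ ^ (i : ℕ)) y) i j
    by_cases hij : i = j
    · subst hij
      simp
    · have : j - i ≠ 0 := fun h => hij (sub_eq_zero.mp h).symm
      simp [hij, this]
  rw [h, Polynomial.aeval_algHom_apply, hp, map_zero]

/-- A cyclic algebra over `E` has no embedding into a division algebra in which the maximal
subfield of the cyclic algebra is split by central elements. -/
theorem apply_eq_of_injective_cyclicAlgebra [FiniteDimensional k E] [Normal k E]
    {σ : E →ₐ[k] E} {a : E} {d : ℕ} [NeZero d] (ha : σ a = a)
    (hcenter : Subalgebra.center k (cyclicAlgebra σ a d) ≤ ⊥)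
    {φ : W →ₐ[k] W} {c : W}
    (hS : ∀ M ∈ cyclicAlgebra φ c d, ∀ N ∈ cyclicAlgebra φ c d, M ≠ 0 → N ≠ 0 → M * N ≠ 0)
    (ι : E →ₐ[k] W) (hι : ∀ x, φ (ι x) = ι x)
    (Ψ : cyclicAlgebra σ a d →ₐ[k] Matrix (Fin d) (Fin d) W) (hΨ : Function.Injective Ψ)
    (hΨS : ∀ x, Ψ x ∈ cyclicAlgebra φ c d) {y : E} (hy : (σ ^ d) y = y) : σ y = y := by
  let x : cyclicAlgebra σ a d := ⟨cyclicOfRow σ a (Pi.single 0 y), cyclicOfRow_mem ha fun j => by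
    by_cases hj : j = 0
    · subst hj; simpa using hy
    · simp [hj]⟩
  have hx : Polynomial.aeval x (minpoly k y) = 0 := by
    apply Subtype.ext
    have := Polynomial.aeval_algHom_apply (cyclicAlgebra σ a d).val x (minpoly k y)
    rw [ZeroMemClass.coe_zero]
    change (cyclicAlgebra σ a d).val _ = 0
    rw [← this]
    exact aeval_cyclicOfRow_single y _ (minpoly.aeval k y)
  have hΨx : Polynomial.aeval (Ψ x) (minpoly k y) = 0 := by
    rw [Polynomial.aeval_algHom_apply, hx, map_zero]
  have hsplit := Normal.splits (F := k) (K := E) inferInstance y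
  have hmap : (minpoly k y).map (algebraMap k W) =
      ((((minpoly k y).map (algebraMap k E)).roots.map ι).map
        fun r => Polynomial.X - Polynomial.C r).prod := by
    have h := hsplit.eq_prod_roots
    have h1 := congrArg (Polynomial.map (ι : E →+* W)) h
    rw [Polynomial.map_map, AlgHom.comp_algebraMap] at h1
    rw [h1]
    simp [minpoly.monic (Algebra.IsIntegral.isIntegral y), Polynomial.map_multiset_prod,
      Polynomial.Monic.leadingCoeff, Multiset.map_map]
  rw [← Polynomial.aeval_map_algebraMap W, hmap] at hΨx
  obtain ⟨r, hr, hxr⟩ := exists_eq_scalar_of_aeval_prod_eq_zero _ hS (hΨS x) _ (fun r hr => by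
    obtain ⟨e, -, rfl⟩ := Multiset.mem_map.mp hr
    exact scalar_mem_cyclicAlgebra (hι e)) hΨx
  have hxc : x ∈ Subalgebra.center k (cyclicAlgebra σ a d) := by
    rw [Subalgebra.mem_center_iff]
    intro z
    apply hΨ
    rw [map_mul, map_mul, hxr]
    exact ((Matrix.scalar_commute r (fun r' => Commute.all _ _) (Ψ z)).eq).symm
  obtain ⟨t, ht⟩ := Algebra.mem_bot.mp (hcenter hxc)
  have h00 := congrFun (congrFun (congrArg Subtype.val ht) 0) 0
  have : algebraMap k E t = y := by
    simpa [x, cyclicOfRow, Matrix.algebraMap_matrix_apply] using h00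
  rw [← this, AlgHom.commutes]

end Division

section CyclotomicCyclic

open WithZero

/-- A pair of primes `ℓ`, `q` with `q` a primitive root modulo `ℓ` and `d ∣ ℓ - 1`. -/
structure IsCyclicPair (d ℓ q : ℕ) (u : (ZMod ℓ)ˣ) : Prop where
  two_le : 2 ≤ d
  prime_left : ℓ.Prime
  prime_right : q.Prime
  val_eq : (u : ZMod ℓ) = q
  mem_zpowers : ∀ x, x ∈ Subgroup.zpowers u
  dvd : d ∣ ℓ - 1

/-- The cyclic algebra of degree `d` inside the cyclotomic cyclic algebra with parameter `q`. -/
noncomputable abbrev cyclotomicCyclicAlgebra (d ℓ q : ℕ) (u : (ZMod ℓ)ˣ) [NeZero d] [NeZero ℓ] :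
    Subalgebra ℚ (Matrix (Fin d) (Fin d) (CyclotomicField ℓ ℚ)) :=
  cyclicAlgebra (cyclotomicAut ℓ u : CyclotomicField ℓ ℚ →ₐ[ℚ] CyclotomicField ℓ ℚ)
    (q : CyclotomicField ℓ ℚ) d

variable {d ℓ q : ℕ} {u : (ZMod ℓ)ˣ}

theorem IsCyclicPair.not_dvd (h : IsCyclicPair d ℓ q u) : ¬ q ∣ ℓ := by
  intro hq
  have h1 := (Nat.prime_dvd_prime_iff_eq h.prime_right h.prime_left).mp hq
  subst h1
  have := Fact.mk h.prime_left
  exact u.ne_zero (by rw [h.val_eq]; simp)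

variable [NeZero ℓ]

theorem IsCyclicPair.finrank_cyclotomicField (h : IsCyclicPair d ℓ q u) :
    Module.finrank ℚ (CyclotomicField ℓ ℚ) = ℓ - 1 := by
  rw [IsCyclotomicExtension.finrank (n := ℓ) (CyclotomicField ℓ ℚ)
    (Polynomial.cyclotomic.irreducible_rat (NeZero.pos ℓ)), Nat.totient_prime h.prime_left]

theorem isGalois_cyclotomicField_rat (ℓ : ℕ) [NeZero ℓ] : IsGalois ℚ (CyclotomicField ℓ ℚ) :=
  IsCyclotomicExtension.isGalois {ℓ} ℚ (CyclotomicField ℓ ℚ)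

theorem finiteDimensional_cyclotomicField_rat (ℓ : ℕ) [NeZero ℓ] :
    FiniteDimensional ℚ (CyclotomicField ℓ ℚ) :=
  IsCyclotomicExtension.finiteDimensional {ℓ} ℚ (CyclotomicField ℓ ℚ)

theorem IsCyclicPair.exists_pow_ne (h : IsCyclicPair d ℓ q u) {n : ℕ} (hn : 0 < n) (hnd : n < d) :
    ∃ y, ((cyclotomicAut ℓ u : CyclotomicField ℓ ℚ →ₐ[ℚ] CyclotomicField ℓ ℚ) ^ d) y = y ∧
      ((cyclotomicAut ℓ u : CyclotomicField ℓ ℚ →ₐ[ℚ] CyclotomicField ℓ ℚ) ^ n) y ≠ y := by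
  have := isGalois_cyclotomicField_rat ℓ
  have := finiteDimensional_cyclotomicField_rat ℓ
  exact exists_pow_ne_of_lt (cyclotomicAut_generator h.mem_zpowers)
    (by rw [h.finrank_cyclotomicField]; exact h.dvd) hn hnd

variable [NeZero d]

theorem IsCyclicPair.finrank_eq (h : IsCyclicPair d ℓ q u) :
    Module.finrank ℚ (cyclotomicCyclicAlgebra d ℓ q u) = d ^ 2 := by
  have := isGalois_cyclotomicField_rat ℓ
  have := finiteDimensional_cyclotomicField_rat ℓ
  rw [finrank_cyclicAlgebra (by exact_mod_cast h.prime_right.ne_zero) (map_natCast _ q),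
    finrank_equalizer_pow (cyclotomicAut_generator h.mem_zpowers)
      (by rw [h.finrank_cyclotomicField]; exact h.dvd), sq]

theorem IsCyclicPair.finiteDimensional (h : IsCyclicPair d ℓ q u) :
    FiniteDimensional ℚ (cyclotomicCyclicAlgebra d ℓ q u) :=
  Module.finite_of_finrank_pos (by rw [h.finrank_eq]; exact pow_pos (NeZero.pos d) 2)

theorem IsCyclicPair.center_le_bot (h : IsCyclicPair d ℓ q u) :
    Subalgebra.center ℚ (cyclotomicCyclicAlgebra d ℓ q u) ≤ ⊥ := by
  have := isGalois_cyclotomicField_rat ℓ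
  have := finiteDimensional_cyclotomicField_rat ℓ
  exact center_cyclicAlgebra_le_bot h.two_le (map_natCast _ q)
    (fun x hx => exists_algebraMap_eq_of_generator (cyclotomicAut_generator h.mem_zpowers) x hx)
    fun n hn hnd => h.exists_pow_ne hn hnd

theorem IsCyclicPair.mul_ne_zero (h : IsCyclicPair d ℓ q u)
    (x y : cyclotomicCyclicAlgebra d ℓ q u) (hx : x ≠ 0) (hy : y ≠ 0) : x * y ≠ 0 := by
  have := Fact.mk h.prime_right
  obtain ⟨W, _, _, φ, v, g, hvq, hvφ, hφg, hζ⟩ := exists_field_frobenius_valuation q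
  obtain ⟨ζ, hζ, hφζ⟩ := hζ ℓ h.not_dvd
  obtain ⟨ι, hι⟩ := exists_cyclotomic_embedding hζ
  have hι' := hι φ.toRatAlgHom q hφζ u h.val_eq
  have hinj : Function.Injective (ι.mapMatrix (m := Fin d)) :=
    Matrix.map_injective ι.toRingHom.injective
  have hmem : ∀ z : cyclotomicCyclicAlgebra d ℓ q u,
      ι.mapMatrix z.1 ∈ cyclicAlgebra φ.toRatAlgHom (q : W) d := fun z =>
    mapMatrix_mem_cyclicAlgebra hι' (map_natCast ι q) z.2
  have hne : ∀ z : cyclotomicCyclicAlgebra d ℓ q u, z ≠ 0 → ι.mapMatrix z.1 ≠ 0 := by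
    intro z hz h0
    exact hz (Subtype.ext (hinj (h0.trans (map_zero _).symm)))
  intro hxy
  refine mul_ne_zero_of_mem_cyclicAlgebra hvq hvφ (hmem x) (hne x hx) (hmem y) (hne y hy) ?_
  rw [← map_mul]
  have : x.1 * y.1 = 0 := congrArg Subtype.val hxy
  rw [this, map_zero]

theorem IsCyclicPair.isSimpleRing (h : IsCyclicPair d ℓ q u) :
    IsSimpleRing (cyclotomicCyclicAlgebra d ℓ q u) := by
  have := h.finiteDimensional
  exact isSimpleRing_of_forall_isUnit fun x hx => isUnit_of_forall_mul_ne_zero ℚ h.mul_ne_zero hx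

/-- A number field embedding into `ℚ_[q]` does not split the cyclotomic cyclic algebra: the base
change embeds into a division algebra over an unramified extension of `ℚ_[q]`. -/
theorem IsCyclicPair.exists_algHom_baseChange (h : IsCyclicPair d ℓ q u) [Fact q.Prime]
    {K : Type*} [Field K] [CharZero K] (κ : K →+* ℚ_[q]) :
    ∃ (W : Type) (_ : Field W) (_ : CharZero W) (φ : W →ₐ[ℚ] W)
      (Φ : K ⊗[ℚ] cyclotomicCyclicAlgebra d ℓ q u →ₐ[ℚ] Matrix (Fin d) (Fin d) W),
      Function.Injective Φ ∧ (∀ x, Φ x ∈ cyclicAlgebra φ (q : W) d) ∧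
      (∀ M ∈ cyclicAlgebra φ (q : W) d, ∀ N ∈ cyclicAlgebra φ (q : W) d,
        M ≠ 0 → N ≠ 0 → M * N ≠ 0) ∧
      ∀ n : ℕ, ¬ q ∣ n → ∃ ζ : W, IsPrimitiveRoot ζ n ∧ φ ζ = ζ ^ q := by
  obtain ⟨W, _, _, φ, v, g, hvq, hvφ, hφg, hζ⟩ := exists_field_frobenius_valuation q
  obtain ⟨ζ, hζ', hφζ⟩ := hζ ℓ h.not_dvd
  obtain ⟨ι, hι⟩ := exists_cyclotomic_embedding hζ'
  have hι' := hι φ.toRatAlgHom q hφζ u h.val_eq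
  let s : K →ₐ[ℚ] Matrix (Fin d) (Fin d) W :=
    ((Matrix.scalar (Fin d)).comp (g.comp κ)).toRatAlgHom
  let t : cyclotomicCyclicAlgebra d ℓ q u →ₐ[ℚ] Matrix (Fin d) (Fin d) W :=
    ι.mapMatrix.comp (cyclotomicCyclicAlgebra d ℓ q u).val
  have hst : ∀ x y, Commute (s x) (t y) := fun x y =>
    Matrix.scalar_commute _ (fun r' => Commute.all _ _) (t y)
  let Φ := Algebra.TensorProduct.lift s t hst
  have := h.isSimpleRing
  have : IsSimpleRing (K ⊗[ℚ] cyclotomicCyclicAlgebra d ℓ q u) :=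
    isSimpleRing_tensorProduct h.center_le_bot
  refine ⟨W, _, _, φ.toRatAlgHom, Φ, Φ.toRingHom.injective, fun x => ?_,
    fun M hM N hN hM0 hN0 => mul_ne_zero_of_mem_cyclicAlgebra hvq hvφ hM hM0 hN hN0, hζ⟩
  induction x using TensorProduct.induction_on with
  | zero => rw [map_zero]; exact zero_mem _
  | add x y hx hy => rw [map_add]; exact add_mem hx hy
  | tmul x y =>
    rw [Algebra.TensorProduct.lift_tmul]
    exact mul_mem (scalar_mem_cyclicAlgebra (hφg (κ x)))
      (mapMatrix_mem_cyclicAlgebra hι' (map_natCast ι q) y.2)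

theorem IsCyclicPair.isUnit_baseChange (h : IsCyclicPair d ℓ q u) [Fact q.Prime]
    {K : Type*} [Field K] [CharZero K] (κ : K →+* ℚ_[q])
    (x : K ⊗[ℚ] cyclotomicCyclicAlgebra d ℓ q u) (hx : x ≠ 0) : IsUnit x := by
  obtain ⟨W, _, _, φ, Φ, hΦ, hmem, hmul, -⟩ := h.exists_algHom_baseChange κ
  have := h.finiteDimensional
  refine isUnit_of_forall_mul_ne_zero K (fun a b ha hb hab => ?_) hx
  refine hmul _ (hmem a) _ (hmem b) ?_ ?_ (by rw [← map_mul, hab, map_zero])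
  · exact fun h0 => ha (hΦ (h0.trans (map_zero Φ).symm))
  · exact fun h0 => hb (hΦ (h0.trans (map_zero Φ).symm))

/-- Base changes of cyclotomic cyclic algebras to a number field are distinguished by their
behaviour at the second prime. -/
theorem IsCyclicPair.isEmpty_algEquiv (h : IsCyclicPair d ℓ q u) {ℓ' q' : ℕ} {u' : (ZMod ℓ')ˣ}
    [NeZero ℓ'] (h' : IsCyclicPair d ℓ' q' u') (hq' : (q' : ZMod ℓ) = 1) [Fact q'.Prime]
    {K : Type*} [Field K] [CharZero K] (κ : K →+* ℚ_[q']) :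
    IsEmpty ((K ⊗[ℚ] cyclotomicCyclicAlgebra d ℓ q u) ≃ₐ[K]
      (K ⊗[ℚ] cyclotomicCyclicAlgebra d ℓ' q' u')) := by
  refine ⟨fun e => ?_⟩
  obtain ⟨W, _, _, φ, Φ, hΦ, hmem, hmul, hζ⟩ := h'.exists_algHom_baseChange κ
  have hndvd : ¬ q' ∣ ℓ := by
    intro hd
    have h1 := (Nat.prime_dvd_prime_iff_eq h'.prime_right h.prime_left).mp hd
    have := Fact.mk h.prime_left
    rw [h1, ZMod.natCast_self] at hq'
    exact zero_ne_one hq'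
  obtain ⟨ζ, hζ, hφζ⟩ := hζ ℓ hndvd
  obtain ⟨ι, hι⟩ := exists_cyclotomic_embedding hζ
  have hι1 : ∀ x, φ (ι x) = ι x := by
    intro x
    have := hι φ q' hφζ 1 (by rw [hq', Units.val_one]) x
    rw [← this, cyclotomicAut, map_one]
    rfl
  have := isGalois_cyclotomicField_rat ℓ
  have := finiteDimensional_cyclotomicField_rat ℓ
  let Ψ : cyclotomicCyclicAlgebra d ℓ q u →ₐ[ℚ] Matrix (Fin d) (Fin d) W :=
    Φ.comp ((e.restrictScalars ℚ).toAlgHom.comp Algebra.TensorProduct.includeRight)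
  have := h.isSimpleRing
  obtain ⟨y, hy, hy'⟩ := h.exists_pow_ne (n := 1) one_pos h.two_le
  refine hy' ?_
  rw [pow_one]
  exact apply_eq_of_injective_cyclicAlgebra (map_natCast _ q) h.center_le_bot hmul ι hι1 Ψ
    Ψ.toRingHom.injective (fun x => hmem _) hy

end CyclotomicCyclic

section RootFields

open Polynomial

/-- The number field `K` is generated by a root of `X ^ 12 - 8 * e * X ^ 6 - 2`. -/
structure IsRootField (e : ℤ) (K : Type) [Field K] [NumberField K] : Prop where
  exists_root : ∃ θ : K, θ ^ 12 = 8 * e * θ ^ 6 + 2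
  exists_algHom : ∀ (R : Type) [CommRing R] [Algebra ℚ R] (w : R), w ^ 12 = 8 * e * w ^ 6 + 2 →
    Nonempty (K →ₐ[ℚ] R)

theorem irreducible_rootPolynomial (e : ℤ) :
    Irreducible (X ^ 12 - C (8 * e : ℚ) * X ^ 6 - C 2 : ℚ[X]) := by
  let f : ℤ[X] := X ^ 12 - C (8 * e) * X ^ 6 - C 2
  have hdeg : f.natDegree = 12 := by
    change (X ^ 12 - C (8 * e) * X ^ 6 - C 2 : ℤ[X]).natDegree = 12
    compute_degree!
  have hmonic : f.Monic := by
    change (X ^ 12 - C (8 * e) * X ^ 6 - C 2 : ℤ[X]).Monic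
    monicity!
  have hcoeff : ∀ n, f.coeff n = (if n = 12 then 1 else 0) - (if n = 6 then 8 * e else 0) -
      (if n = 0 then 2 else 0) := by
    intro n
    simp only [f, coeff_sub, coeff_C_mul, coeff_X_pow, coeff_C, mul_ite, mul_one, mul_zero]
  have heis : f.IsEisensteinAt (Ideal.span {2}) := by
    refine ⟨?_, ?_, ?_⟩
    · rw [hmonic.leadingCoeff, Ideal.mem_span_singleton]
      decide
    · intro n hn
      rw [hdeg] at hn
      rw [Ideal.mem_span_singleton, hcoeff, if_neg hn.ne]
      split_ifs <;> omega
    · rw [Ideal.span_singleton_pow, Ideal.mem_span_singleton, hcoeff]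
      norm_num
  have hirr : Irreducible f := heis.irreducible
    ((Ideal.span_singleton_prime two_ne_zero).mpr Int.prime_two) hmonic.isPrimitive
    (by rw [hdeg]; norm_num)
  have h := (hmonic.isPrimitive.irreducible_iff_irreducible_map_fraction_map (K := ℚ)).mp hirr
  have hmap : f.map (algebraMap ℤ ℚ) = X ^ 12 - C (8 * e : ℚ) * X ^ 6 - C 2 := by
    simp only [f, Polynomial.map_sub, Polynomial.map_mul, Polynomial.map_pow, map_X, map_C]
    rw [show algebraMap ℤ ℚ (8 * e) = 8 * e by simp, show algebraMap ℤ ℚ 2 = 2 by simp]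
  rwa [hmap] at h

theorem exists_isRootField (e : ℤ) :
    ∃ (K : Type) (_ : Field K) (_ : NumberField K), IsRootField e K := by
  let f : ℚ[X] := X ^ 12 - C (8 * e : ℚ) * X ^ 6 - C 2
  have hf : Irreducible f := irreducible_rootPolynomial e
  have := Fact.mk hf
  have : CharZero (AdjoinRoot f) := charZero_of_injective_algebraMap (algebraMap ℚ _).injective
  have hfin : Module.Finite ℚ (AdjoinRoot f) := (AdjoinRoot.powerBasis hf.ne_zero).finite
  have : NumberField (AdjoinRoot f) :=
    { to_charZero := this, to_finiteDimensional := by convert hfin }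
  refine ⟨AdjoinRoot f, inferInstance, this, ⟨AdjoinRoot.root f, ?_⟩, fun R _ _ w hw => ?_⟩
  · have h := AdjoinRoot.eval₂_root f
    simp only [f, eval₂_sub, eval₂_mul, eval₂_pow, eval₂_X, eval₂_C] at h
    simp only [map_mul, map_ofNat, map_intCast] at h
    linear_combination h
  · refine ⟨(AdjoinRoot.lift (algebraMap ℚ R) w ?_).toRatAlgHom⟩
    simp only [f, eval₂_sub, eval₂_mul, eval₂_pow, eval₂_X, eval₂_C]
    simp only [map_mul, map_ofNat, map_intCast]
    linear_combination hw

variable {K K' : Type} [Field K] [NumberField K] [Field K'] [NumberField K'] {e e' : ℤ}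

theorem exists_algHom_of_finrank_two (h : IsRootField e K) (h' : IsRootField e' K')
    (he : e' = -e) : ∃ (Λ : Type) (_ : CommRing Λ) (_ : Algebra ℚ Λ) (_ : Algebra K Λ),
      IsScalarTower ℚ K Λ ∧ FiniteDimensional K Λ ∧ Nonempty (K' →ₐ[ℚ] Λ) ∧
      Module.finrank K Λ = 2 := by
  let p : K[X] := X ^ 2 + 1
  have hp : p.Monic := by
    change (X ^ 2 + 1 : K[X]).Monic
    monicity!
  have hdeg : p.natDegree = 2 := by
    change (X ^ 2 + 1 : K[X]).natDegree = 2
    compute_degree!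
  obtain ⟨θ, hθ⟩ := h.exists_root
  have hi := AdjoinRoot.eval₂_root p
  simp only [p, eval₂_add, eval₂_pow, eval₂_X, eval₂_one] at hi
  have hθ' := congrArg (AdjoinRoot.of p) hθ
  simp only [map_add, map_mul, map_pow, map_ofNat, map_intCast] at hθ'
  refine ⟨AdjoinRoot p, inferInstance, inferInstance, inferInstance, inferInstance,
    hp.finite_adjoinRoot, h'.exists_algHom _ (AdjoinRoot.of p θ * AdjoinRoot.root p) ?_, ?_⟩
  · generalize AdjoinRoot.of p θ = t at hθ' ⊢
    generalize AdjoinRoot.root p = i at hi ⊢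
    have hi2 : i ^ 2 = -1 := by linear_combination hi
    have hi6 : i ^ 6 = -1 := by rw [show (6 : ℕ) = 2 * 3 from rfl, pow_mul, hi2]; ring
    have hi12 : i ^ 12 = 1 := by rw [show (12 : ℕ) = 2 * 6 from rfl, pow_mul, hi2]; ring
    rw [mul_pow, mul_pow, hi6, hi12, he]
    push_cast
    linear_combination hθ'
  · rw [(AdjoinRoot.powerBasis' hp).finrank, AdjoinRoot.powerBasis'_dim, hdeg]

theorem exists_algHom_of_finrank_three (h : IsRootField e K) (h' : IsRootField e' K')
    (he : e' = -e) (he1 : e ^ 2 = 1) :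
    ∃ (Λ : Type) (_ : CommRing Λ) (_ : Algebra ℚ Λ) (_ : Algebra K Λ),
      IsScalarTower ℚ K Λ ∧ FiniteDimensional K Λ ∧ Nonempty (K' →ₐ[ℚ] Λ) ∧
      Module.finrank K Λ = 3 := by
  obtain ⟨θ, hθ⟩ := h.exists_root
  let c : K := (17 - 2 * e * θ ^ 6) / 3
  let p : K[X] := X ^ 3 - C c
  have hp : p.Monic := by
    change (X ^ 3 - C c : K[X]).Monic
    monicity!
  have hdeg : p.natDegree = 3 := by
    change (X ^ 3 - C c : K[X]).natDegree = 3
    compute_degree!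
  have hc : c ^ 2 = 33 - 4 * e * θ ^ 6 := by
    have : (e : K) ^ 2 = 1 := by exact_mod_cast congrArg (Int.cast : ℤ → K) he1
    simp only [c]
    field_simp
    linear_combination (4 * (e : K) ^ 2) * hθ + (32 * e * θ ^ 6 + 8) * this
  have hy := AdjoinRoot.eval₂_root p
  simp only [p, eval₂_sub, eval₂_pow, eval₂_X, eval₂_C] at hy
  have hθ' := congrArg (AdjoinRoot.of p) hθ
  have hc' := congrArg (AdjoinRoot.of p) hc
  simp only [map_add, map_sub, map_mul, map_pow, map_ofNat, map_intCast] at hθ' hc'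
  refine ⟨AdjoinRoot p, inferInstance, inferInstance, inferInstance, inferInstance,
    hp.finite_adjoinRoot, h'.exists_algHom _ (AdjoinRoot.of p θ * AdjoinRoot.root p) ?_, ?_⟩
  · have he2 : (e : AdjoinRoot p) ^ 2 = 1 := by
      exact_mod_cast congrArg (Int.cast : ℤ → AdjoinRoot p) he1
    generalize AdjoinRoot.of p θ = t at *
    generalize AdjoinRoot.root p = y at *
    have hy6 : y ^ 6 = 33 - 4 * e * t ^ 6 := by
      rw [← hc', ← sub_eq_zero.mp hy]
      ring
    have hw6 : (t * y) ^ 6 = t ^ 6 - 8 * e := by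
      rw [mul_pow, hy6]
      linear_combination (-4 * (e : AdjoinRoot p)) * hθ' - 32 * t ^ 6 * he2
    rw [show (12 : ℕ) = 6 * 2 from rfl, pow_mul, hw6, he]
    push_cast
    linear_combination hθ'
  · rw [(AdjoinRoot.powerBasis' hp).finrank, AdjoinRoot.powerBasis'_dim, hdeg]

theorem exists_padic_root {q : ℕ} [Fact q.Prime] {e a : ℤ}
    (h0 : (q : ℤ) ∣ a ^ 12 - 8 * e * a ^ 6 - 2) (h1 : ¬ (q : ℤ) ∣ 12 * a ^ 11 - 48 * e * a ^ 5) :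
    ∃ w : ℚ_[q], w ^ 12 = 8 * e * w ^ 6 + 2 := by
  let f : ℤ_[q][X] := X ^ 12 - C (8 * e : ℤ_[q]) * X ^ 6 - C 2
  have hf : f.eval (a : ℤ_[q]) = ((a ^ 12 - 8 * e * a ^ 6 - 2 : ℤ) : ℤ_[q]) := by
    simp [f]
  have hf' : f.derivative.eval (a : ℤ_[q]) = ((12 * a ^ 11 - 48 * e * a ^ 5 : ℤ) : ℤ_[q]) := by
    simp [f]
    ring
  have hn0 : ‖f.eval (a : ℤ_[q])‖ < 1 := by
    rw [hf, PadicInt.norm_int_lt_one_iff_dvd]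
    exact h0
  have hn1 : ‖f.derivative.eval (a : ℤ_[q])‖ = 1 := by
    refine le_antisymm (PadicInt.norm_le_one _) (not_lt.mp ?_)
    rw [hf', PadicInt.norm_int_lt_one_iff_dvd]
    exact h1
  obtain ⟨z, hz, -⟩ := hensels_lemma (F := f) (a := (a : ℤ_[q])) (by simpa [hn1] using hn0)
  refine ⟨(z : ℚ_[q]), ?_⟩
  have hz' : z ^ 12 - 8 * e * z ^ 6 - 2 = 0 := by simpa [f] using hz
  have hz'' := congrArg (PadicInt.Coe.ringHom (p := q)) hz'
  simp only [map_sub, map_mul, map_pow, map_ofNat, map_intCast, map_zero] at hz''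
  change (z : ℚ_[q]) ^ 12 - 8 * e * (z : ℚ_[q]) ^ 6 - 2 = 0 at hz''
  linear_combination hz''

theorem exists_pow_six_eq {q : ℕ} [Fact q.Prime] (hq : q % 24 = 23) (he1 : e ^ 2 = 1) :
    ∃ x t : ZMod q, t ^ 2 = 2 ∧ x ^ 6 = 4 * e + 3 * t := by
  obtain ⟨t, ht⟩ := (ZMod.exists_sq_eq_two_iff (p := q) (by omega)).mpr (by omega)
  have h2 : ¬ IsSquare (-2 : ZMod q) := by
    rw [ZMod.exists_sq_eq_neg_two_iff (p := q) (by omega)]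
    omega
  have he2 : (e : ZMod q) ^ 2 = 1 := by exact_mod_cast congrArg (Int.cast : ℤ → ZMod q) he1
  have hprod : (4 * e + 3 * t) * (4 * e + 3 * -t) = (-2 : ZMod q) := by
    linear_combination 16 * he2 + 9 * ht
  have hsq : ∃ s : ZMod q, s ^ 2 = 2 ∧ IsSquare (4 * e + 3 * s) := by
    by_contra! hcon
    have ha := hcon t (by rw [ht, sq])
    have hb := hcon (-t) (by rw [ht, neg_sq, sq])
    refine h2 ?_
    rw [← quadraticChar_neg_one_iff_not_isSquare] at ha hb h2
    rw [← hprod, map_mul, ha, hb] at h2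
    norm_num at h2
  obtain ⟨s, hs, z, hz⟩ := hsq
  obtain ⟨m, hm⟩ : ∃ m, 2 * q - 1 = m * 3 := ⟨(2 * q - 1) / 3, by omega⟩
  refine ⟨z ^ m, s, hs, ?_⟩
  have hcube : (z ^ m) ^ 3 = z := by
    rw [← pow_mul, ← hm, show 2 * q - 1 = q + (q - 1) by omega, pow_add, ZMod.pow_card,
      ← pow_succ', Nat.sub_add_cancel (by omega), ZMod.pow_card]
  rw [show (6 : ℕ) = 3 * 2 from rfl, pow_mul, hcube, hz, sq]

theorem IsRootField.exists_ringHom_padic (h : IsRootField e K) (he1 : e ^ 2 = 1) {q : ℕ}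
    [Fact q.Prime] (hq : q % 24 = 23) : Nonempty (K →+* ℚ_[q]) := by
  obtain ⟨x, t, ht, hx⟩ := exists_pow_six_eq (q := q) hq he1
  obtain ⟨a, rfl⟩ := ZMod.intCast_surjective x
  have he2 : (e : ZMod q) ^ 2 = 1 := by exact_mod_cast congrArg (Int.cast : ℤ → ZMod q) he1
  have hne : ∀ n : ℕ, 0 < n → n < q → (n : ZMod q) ≠ 0 := by
    intro n hn hnq h0
    rw [ZMod.natCast_eq_zero_iff] at h0
    exact absurd (Nat.le_of_dvd hn h0) (by omega)
  have hn2 : (2 : ZMod q) ≠ 0 := by exact_mod_cast hne 2 (by omega) (by omega)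
  have hn3 : (3 : ZMod q) ≠ 0 := by exact_mod_cast hne 3 (by omega) (by omega)
  have ht0 : t ≠ 0 := by
    rintro rfl
    exact hn2 (by rw [← ht]; ring)
  have ha0 : (a : ZMod q) ≠ 0 := by
    intro h0
    rw [h0] at hx
    refine hn2 ?_
    linear_combination (4 * (e : ZMod q) - 3 * t) * hx + 16 * he2 - 9 * ht
  obtain ⟨w, hw⟩ := exists_padic_root (q := q) (e := e) (a := a) (by
      rw [← ZMod.intCast_zmod_eq_zero_iff_dvd]
      push_cast
      have h12 : (a : ZMod q) ^ 12 = (4 * e + 3 * t) ^ 2 := by rw [← hx]; ring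
      rw [h12, hx]
      linear_combination -16 * he2 + 9 * ht) (by
      rw [← ZMod.intCast_zmod_eq_zero_iff_dvd]
      push_cast
      have h11 : (12 * (a : ZMod q) ^ 11 - 48 * e * a ^ 5) = (2 ^ 2 * 3 ^ 2) * t * a ^ 5 := by
        linear_combination 12 * (a : ZMod q) ^ 5 * hx
      rw [h11]
      exact mul_ne_zero (mul_ne_zero (mul_ne_zero (pow_ne_zero _ hn2) (pow_ne_zero _ hn3)) ht0)
        (pow_ne_zero _ ha0))
  obtain ⟨f⟩ := h.exists_algHom ℚ_[q] w hw
  exact ⟨f.toRingHom⟩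

theorem zmod_seven_pow_ne : ∀ c : ZMod 7, c ^ 12 ≠ 8 * c ^ 6 + 2 := by
  decide

theorem isEmpty_ringEquiv_of_isRootField (h : IsRootField 1 K) (h' : IsRootField (-1) K') :
    IsEmpty (K ≃+* K') := by
  refine ⟨fun i => ?_⟩
  have h7 : Fact (Nat.Prime 7) := ⟨by norm_num⟩
  obtain ⟨w, hw⟩ := exists_padic_root (q := 7) (e := -1) (a := 1) (by norm_num) (by norm_num)
  obtain ⟨f⟩ := h'.exists_algHom ℚ_[7] w hw
  obtain ⟨θ, hθ⟩ := h.exists_root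
  have hr := congrArg (f.toRingHom.comp i.toRingHom) hθ
  simp only [map_add, map_mul, map_pow, map_ofNat, Int.cast_one, mul_one] at hr
  generalize (f.toRingHom.comp i.toRingHom) θ = r at hr
  have hint : IsIntegral ℤ_[7] r := by
    refine ⟨X ^ 12 - 8 * X ^ 6 - 2, by monicity!, ?_⟩
    simp [hr]
  obtain ⟨z, rfl⟩ := IsIntegrallyClosed.isIntegral_iff.mp hint
  have hz : z ^ 12 = 8 * z ^ 6 + 2 := by
    apply IsFractionRing.injective ℤ_[7] ℚ_[7]
    simp only [map_add, map_mul, map_pow, map_ofNat]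
    exact hr
  have hz' := congrArg (PadicInt.toZMod (p := 7)) hz
  simp only [map_add, map_mul, map_pow, map_ofNat] at hz'
  exact zmod_seven_pow_ne _ hz'

end RootFields

section PrimePairs

theorem exists_prime_modEq_of_coprime {M ℓ g : ℕ} (hM : M.Coprime 24) (hM0 : M ≠ 0)
    (hℓ : ℓ.Prime) (hℓM : ℓ.Coprime (24 * M)) (hg : g.Coprime ℓ) :
    ∃ q : ℕ, q.Prime ∧ q % 24 = 23 ∧ q ≡ 1 [MOD M] ∧ q ≡ g [MOD ℓ] := by
  obtain ⟨a, ha24, haM⟩ := Nat.chineseRemainder (hM.symm) 23 1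
  obtain ⟨b, hb, hbℓ⟩ := Nat.chineseRemainder (hℓM.symm) a g
  have hb24 : b ≡ 23 [MOD 24] := (hb.of_mul_right M).trans ha24
  have hbM : b ≡ 1 [MOD M] := (hb.of_mul_left 24).trans haM
  have hcop : b.Coprime (24 * M * ℓ) := by
    refine Nat.Coprime.mul_right (Nat.Coprime.mul_right ?_ ?_) ?_
    · rw [Nat.Coprime, hb24.gcd_eq]
      norm_num
    · rw [Nat.Coprime, hbM.gcd_eq, Nat.gcd_one_left]
    · rw [Nat.Coprime, hbℓ.gcd_eq]
      exact hg
  have hne : 24 * M * ℓ ≠ 0 := by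
    have := hℓ.ne_zero
    positivity
  obtain ⟨q, -, hq, hqb⟩ := Nat.forall_exists_prime_gt_and_modEq 0 hne hcop
  have hq1 := hqb.of_mul_right ℓ
  exact ⟨q, hq, (hq1.of_mul_right M).trans hb24, (hq1.of_mul_left 24).trans hbM,
    (hqb.of_mul_left (24 * M)).trans hbℓ⟩

theorem exists_seq_isCyclicPair {d : ℕ} (hd : 2 ≤ d) :
    ∃ p : ℕ → ℕ × ℕ, (∀ i, (∃ u, IsCyclicPair d (p i).1 (p i).2 u) ∧ (p i).2 % 24 = 23) ∧
      ∀ i j, i < j → ((p j).2 : ZMod (p i).1) = 1 := by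
  obtain ⟨p, hp, hr⟩ := exists_seq_of_forall_finset_exists
    (fun x : ℕ × ℕ => ((∃ u, IsCyclicPair d x.1 x.2 u) ∧ x.2 % 24 = 23) ∧ 3 < x.1)
    (fun x y => (y.2 : ZMod x.1) = 1) (fun s hs => by
      have hM : (∏ x ∈ s, x.1).Coprime 24 := Nat.Coprime.prod_left fun x hx => by
        obtain ⟨⟨⟨u, hu⟩, -⟩, h3⟩ := hs x hx
        rw [hu.prime_left.coprime_iff_not_dvd]
        intro hdvd
        have hmem : x.1 ∈ Nat.primeFactors 24 := by
          simp [hu.prime_left, hdvd]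
        have : Nat.primeFactors 24 = {2, 3} := by
          rw [show 24 = 2 ^ 3 * 3 by norm_num, Nat.primeFactors_mul (by norm_num) (by norm_num),
            Nat.primeFactors_prime_pow (by norm_num) Nat.prime_two, Nat.prime_three.primeFactors]
          rfl
        rw [this] at hmem
        simp at hmem
        omega
      have hM0 : (∏ x ∈ s, x.1) ≠ 0 := Finset.prod_ne_zero_iff.mpr fun x hx => by
        have := (hs x hx).2
        omega
      obtain ⟨ℓ, hℓ, hℓgt, hℓd⟩ :=
        Nat.exists_prime_gt_modEq_one (k := d) (24 * ∏ x ∈ s, x.1) (by omega)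
      have hℓM : ℓ.Coprime (24 * ∏ x ∈ s, x.1) := by
        rw [hℓ.coprime_iff_not_dvd]
        intro hdvd
        exact absurd (Nat.le_of_dvd (by positivity) hdvd) (by omega)
      have := Fact.mk hℓ
      obtain ⟨g, hg⟩ := IsCyclic.exists_generator (α := (ZMod ℓ)ˣ)
      obtain ⟨q, hq, hq24, hqM, hqg⟩ := exists_prime_modEq_of_coprime hM hM0 hℓ hℓM
        (ZMod.val_coe_unit_coprime g)
      refine ⟨(ℓ, q), ⟨⟨⟨g, hd, hℓ, hq, ?_, hg, ?_⟩, hq24⟩, ?_⟩, fun x hx => ?_⟩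
      · rw [(ZMod.natCast_eq_natCast_iff _ _ _).mpr hqg, ZMod.natCast_zmod_val]
      · exact (Nat.modEq_iff_dvd' hℓ.one_le).mp hℓd.symm
      · have : 0 < ∏ x ∈ s, x.1 := Nat.pos_of_ne_zero hM0
        change 3 < ℓ
        omega
      · have := hqM.of_dvd (Finset.dvd_prod_of_mem (fun x : ℕ × ℕ => x.1) hx)
        have := (ZMod.natCast_eq_natCast_iff _ _ _).mpr this
        simpa using this)
  exact ⟨p, fun i => (hp i).1, hr⟩

end PrimePairs

theorem isBrauerEquiv_baseChange_of_isRootField {e e' : ℤ} (he : e' = -e) (he1 : e ^ 2 = 1)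
    {K K' : Type} [Field K] [NumberField K] [Field K'] [NumberField K'] (h : IsRootField e K)
    (h' : IsRootField e' K') {B B₀ : Type} [Ring B] [Algebra ℚ B] [Ring B₀] [Algebra ℚ B₀]
    [IsSimpleRing B] [FiniteDimensional ℚ B] (hB : Subalgebra.center ℚ B ≤ ⊥)
    [FiniteDimensional ℚ B₀] [IsSimpleRing B₀] (hB₀ : Subalgebra.center ℚ B₀ ≤ ⊥)
    (hA : ∀ x : K ⊗[ℚ] B₀, x ≠ 0 → IsUnit x) (hA' : ∀ x : K' ⊗[ℚ] B₀, x ≠ 0 → IsUnit x)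
    (hBB₀ : IsBrauerEquiv K' (K' ⊗[ℚ] B) (K' ⊗[ℚ] B₀)) :
    IsBrauerEquiv K (K ⊗[ℚ] B) (K ⊗[ℚ] B₀) := by
  obtain ⟨Λ₁, _, _, _, _, _, ⟨f₁⟩, h1⟩ := exists_algHom_of_finrank_two h h' he
  obtain ⟨Λ₂, _, _, _, _, _, ⟨f₂⟩, h2⟩ := exists_algHom_of_finrank_three h h' he he1
  exact isBrauerEquiv_baseChange_of_descent hB hB₀ hA hA' f₁ f₂ (by rw [h1, h2]; norm_num) hBB₀

theorem IsBrauerEquiv.refl (k : Type) [Field k] (A : Type) [Ring A] [Algebra k A] :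
    IsBrauerEquiv k A A :=
  ⟨1, 1, one_pos, one_pos, ⟨AlgEquiv.refl⟩⟩

/-- The central simple algebra obtained by base change. -/
noncomputable def CSAlg.baseChange {k : Type} [Field k] (K : Type) [Field K] [Algebra k K]
    (B : CSAlg k) : CSAlg K where
  carrier := K ⊗[k] B.carrier
  finiteDimensional := by
    have := B.finiteDimensional
    infer_instance
  isSimpleRing := by
    have := B.isSimpleRing
    exact isSimpleRing_tensorProduct B.center_le_bot
  center_le_bot := center_baseChange_le_bot B.center_le_bot

theorem CSAlg.degreeEq_baseChange {k : Type} [Field k] (K : Type) [Field K] [Algebra k K]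
    {B : CSAlg k} {d : ℕ} (h : B.DegreeEq d) : (B.baseChange K).DegreeEq d :=
  (Module.finrank_baseChange (R := K) (M' := B.carrier)).trans h

/-- The cyclotomic cyclic algebra as a central simple algebra over `ℚ`. -/
noncomputable def IsCyclicPair.csAlg {d ℓ q : ℕ} {u : (ZMod ℓ)ˣ} [NeZero d] [NeZero ℓ]
    (h : IsCyclicPair d ℓ q u) : CSAlg ℚ where
  carrier := cyclotomicCyclicAlgebra d ℓ q u
  finiteDimensional := h.finiteDimensional
  isSimpleRing := h.isSimpleRing
  center_le_bot := h.center_le_bot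

/-- There exist non-isomorphic number fields `K, K'` such that for every
`d ≥ 2` there is an infinite family `(A i)` of pairwise non-isomorphic central division
algebras of degree `d` over `K`, and for each `i` a central division algebra `A' i` of
degree `d` over `K'`, with `(Res_{K/ℚ})⁻¹(A i) = (Res_{K'/ℚ})⁻¹(A' i)` and each of these
fibers nonempty. -/
theorem stmt_2 :
    ∃ (K K' : NumField), IsEmpty (K.carrier ≃+* K'.carrier) ∧
      ∀ d : ℕ, 2 ≤ d →
        ∃ (A : ℕ → CSAlg K.carrier) (A' : ℕ → CSAlg K'.carrier),
          (∀ i, (A i).IsDivision ∧ (A i).DegreeEq d) ∧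
          (∀ i j, i ≠ j → IsEmpty ((A i).carrier ≃ₐ[K.carrier] (A j).carrier)) ∧
          (∀ i, (A' i).IsDivision ∧ (A' i).DegreeEq d) ∧
          (∀ i, ∀ B : CSAlg ℚ,
            InFiber ℚ K.carrier (A i) B ↔ InFiber ℚ K'.carrier (A' i) B) ∧
          (∀ i, ∃ B₀ : CSAlg ℚ,
            InFiber ℚ K.carrier (A i) B₀ ∧ InFiber ℚ K'.carrier (A' i) B₀) := by
  obtain ⟨K, _, _, hK⟩ := exists_isRootField 1
  obtain ⟨K', _, _, hK'⟩ := exists_isRootField (-1)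
  refine ⟨⟨K⟩, ⟨K'⟩, isEmpty_ringEquiv_of_isRootField hK hK', fun d hd => ?_⟩
  have : NeZero d := ⟨by omega⟩
  obtain ⟨p, hp, hpr⟩ := exists_seq_isCyclicPair hd
  choose hu hq using hp
  choose u hu using hu
  have hℓ0 (i : ℕ) : NeZero (p i).1 := ⟨(hu i).prime_left.ne_zero⟩
  have hq0 (i : ℕ) : Fact (p i).2.Prime := ⟨(hu i).prime_right⟩
  have κ (i : ℕ) := hK.exists_ringHom_padic (one_pow 2) (hq i)
  have κ' (i : ℕ) := hK'.exists_ringHom_padic (by norm_num) (hq i)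
  have hdiv (i : ℕ) : ((hu i).csAlg.baseChange K).IsDivision :=
    (hu i).isUnit_baseChange (κ i).some
  have hdiv' (i : ℕ) : ((hu i).csAlg.baseChange K').IsDivision :=
    (hu i).isUnit_baseChange (κ' i).some
  have hlt (i j : ℕ) (hij : i < j) : IsEmpty (((hu i).csAlg.baseChange K).carrier ≃ₐ[K]
      ((hu j).csAlg.baseChange K).carrier) :=
    (hu i).isEmpty_algEquiv (hu j) (hpr i j hij) (κ j).some
  refine ⟨fun i => (hu i).csAlg.baseChange K, fun i => (hu i).csAlg.baseChange K',
    fun i => ⟨hdiv i, CSAlg.degreeEq_baseChange K (hu i).finrank_eq⟩, fun i j hij => ?_,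
    fun i => ⟨hdiv' i, CSAlg.degreeEq_baseChange K' (hu i).finrank_eq⟩, fun i B => ?_,
    fun i => ⟨(hu i).csAlg, IsBrauerEquiv.refl K _, IsBrauerEquiv.refl K' _⟩⟩
  · rcases lt_or_gt_of_ne hij with h | h
    · exact hlt i j h
    · exact ⟨fun e => (hlt j i h).false e.symm⟩
  · have := B.isSimpleRing
    have := B.finiteDimensional
    have := (hu i).csAlg.isSimpleRing
    have := (hu i).csAlg.finiteDimensional
    exact ⟨isBrauerEquiv_baseChange_of_isRootField (by norm_num) (by norm_num) hK' hK
        B.center_le_bot (hu i).csAlg.center_le_bot (hdiv' i) (hdiv i),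
      isBrauerEquiv_baseChange_of_isRootField rfl (one_pow 2) hK hK'
        B.center_le_bot (hu i).csAlg.center_le_bot (hdiv i) (hdiv' i)⟩
end

section
/- There exist number fields K and K' that are not isomorphic as fields, a central division algebra A of degree 2 over K (a quaternion division algebra) and a central division algebra A' of degree 2 over K', such that: (i) for every finite-dimensional central simple ℚ-algebra B, B lies in the fiber (Res_{K/ℚ})⁻¹(A) if and only if B lies in the fiber (Res_{K'/ℚ})⁻¹(A'); and (ii) there exist infinitely many pairwise non-Brauer-equivalent finite-dimensional central simple ℚ-algebras lying in the fiber (Res_{K/ℚ})⁻¹(A). -/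
open TensorProduct

namespace IsBrauerEquiv

open Matrix Algebra.TensorProduct

variable {k : Type} [Field k] {A B C : Type} [Ring A] [Algebra k A] [Ring B] [Algebra k B]
  [Ring C] [Algebra k C]

lemma of_algEquiv (e : A ≃ₐ[k] B) : IsBrauerEquiv k A B :=
  ⟨1, 1, one_pos, one_pos, ⟨e.mapMatrix⟩⟩

lemma symm (h : IsBrauerEquiv k A B) : IsBrauerEquiv k B A :=
  let ⟨n, m, hn, hm, ⟨e⟩⟩ := h
  ⟨m, n, hm, hn, ⟨e.symm⟩⟩

lemma trans (hAB : IsBrauerEquiv k A B) (hBC : IsBrauerEquiv k B C) : IsBrauerEquiv k A C := by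
  obtain ⟨n, m, hn, hm, ⟨iso1⟩⟩ := hAB
  obtain ⟨p, q, hp, hq, ⟨iso2⟩⟩ := hBC
  exact ⟨p * n, m * q, by positivity, by positivity,
    ⟨reindexAlgEquiv _ _ finProdFinEquiv |>.symm.trans <| compAlgEquiv _ _ _ _|>.symm.trans <|
    iso1.mapMatrix (m := Fin p)|>.trans <| compAlgEquiv _ _ _ _|>.trans <|
    reindexAlgEquiv k B (.prodComm (Fin p) (Fin m))|>.trans <| compAlgEquiv _ _ _ _|>.symm.trans <|
    iso2.mapMatrix.trans <| compAlgEquiv _ _ _ _|>.trans <| reindexAlgEquiv _ _ finProdFinEquiv⟩⟩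

/-- Auxiliary form of `matrixTensor`, through matrices indexed by a singleton. -/
noncomputable def matrixTensorOfUnique (ι : Type) [Unique ι] (K : Type) [Field K] [Algebra k K]
    [Algebra K A] [IsScalarTower k K A] (n : ℕ) :
    A ⊗[k] Matrix (Fin n) (Fin n) B ≃ₐ[K] Matrix (Fin n) (Fin n) (A ⊗[k] B) :=
  letI : DecidableEq ι := fun a b => decidableEq_of_subsingleton a b
  (Algebra.TensorProduct.congr (Matrix.uniqueAlgEquiv (m := ι) (R := K)).symm
    AlgEquiv.refl).trans ((kroneckerTMulAlgEquiv ι (Fin n) k K A B).trans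
      (reindexAlgEquiv K _ (Equiv.uniqueProd (Fin n) ι)))

/-- Matrices over a tensor product, with the matrices in the right factor pulled out. -/
noncomputable def matrixTensor (K : Type) [Field K] [Algebra k K] [Algebra K A]
    [IsScalarTower k K A] (n : ℕ) :
    A ⊗[k] Matrix (Fin n) (Fin n) B ≃ₐ[K] Matrix (Fin n) (Fin n) (A ⊗[k] B) :=
  matrixTensorOfUnique Unit K n

lemma tensor_left (C : Type) [Ring C] [Algebra k C] (h : IsBrauerEquiv k A B) :
    IsBrauerEquiv k (C ⊗[k] A) (C ⊗[k] B) :=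
  let ⟨n, m, hn, hm, ⟨e⟩⟩ := h
  ⟨n, m, hn, hm, ⟨(matrixTensor k n).symm.trans
    ((Algebra.TensorProduct.congr AlgEquiv.refl e).trans (matrixTensor k m))⟩⟩

lemma baseChange (K : Type) [Field K] [Algebra k K] (h : IsBrauerEquiv k A B) :
    IsBrauerEquiv K (K ⊗[k] A) (K ⊗[k] B) :=
  let ⟨n, m, hn, hm, ⟨e⟩⟩ := h
  ⟨n, m, hn, hm, ⟨(matrixTensor K n).symm.trans
    ((Algebra.TensorProduct.congr AlgEquiv.refl e).trans (matrixTensor K m))⟩⟩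

lemma tensor_right (C : Type) [Ring C] [Algebra k C] (h : IsBrauerEquiv k A B) :
    IsBrauerEquiv k (A ⊗[k] C) (B ⊗[k] C) :=
  (of_algEquiv (Algebra.TensorProduct.comm k A C)).trans <|
    (h.tensor_left C).trans <| of_algEquiv (Algebra.TensorProduct.comm k C B)

end IsBrauerEquiv

/-- Base change in stages, for noncommutative algebras. -/
noncomputable def algCancelBaseChange (F K L : Type) [Field F] [Field K] [Algebra F K]
    [Field L] [Algebra F L] [Algebra K L] [IsScalarTower F K L] (T : Type) [Ring T] [Algebra F T] :
    L ⊗[K] (K ⊗[F] T) ≃ₐ[L] L ⊗[F] T :=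
  AlgEquiv.symm <| AlgEquiv.ofLinearEquiv
    (TensorProduct.AlgebraTensorModule.cancelBaseChange F K L L T).symm
    (by simp [Algebra.TensorProduct.one_def]) <|
      LinearMap.map_mul_of_map_mul_tmul (fun _ _ _ _ ↦ by simp)

/-- Base change commutes with tensor products of algebras. -/
noncomputable def tensorBaseChange {F : Type} [Field F] (K : Type) [Field K] [Algebra F K]
    (B C : Type) [Ring B] [Algebra F B] [Ring C] [Algebra F C] :
    K ⊗[F] (B ⊗[F] C) ≃ₐ[K] (K ⊗[F] B) ⊗[K] (K ⊗[F] C) :=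
  AlgEquiv.ofLinearEquiv (TensorProduct.AlgebraTensorModule.distribBaseChange F K B C)
    (by simp [Algebra.TensorProduct.one_def])
    ((LinearMap.map_mul_iff _).mpr <| by ext; simp)

/-- Twisting by an algebra `H` whose square is split turns membership in a fiber into a
splitting condition. -/
lemma isBrauerEquiv_baseChange_iff_s3 {F K : Type} [Field F] [Field K] [Algebra F K]
    {A B H : Type} [Ring A] [Algebra K A] [Ring B] [Algebra F B] [Ring H] [Algebra F H]
    (hH : IsBrauerEquiv F (H ⊗[F] H) F) (hA : IsBrauerEquiv K (K ⊗[F] H) A) :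
    IsBrauerEquiv K (K ⊗[F] B) A ↔ IsBrauerEquiv K (K ⊗[F] (B ⊗[F] H)) K := by
  constructor
  · intro h
    refine (IsBrauerEquiv.of_algEquiv (tensorBaseChange K B H)).trans ?_
    refine ((h.trans hA.symm).tensor_right _).trans ?_
    refine (IsBrauerEquiv.of_algEquiv (tensorBaseChange (F := F) K H H).symm).trans ?_
    exact (hH.baseChange K).trans (IsBrauerEquiv.of_algEquiv (Algebra.TensorProduct.rid F K K))
  · intro h
    refine IsBrauerEquiv.trans ?_ hA
    refine (IsBrauerEquiv.of_algEquiv (Algebra.TensorProduct.congr AlgEquiv.refl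
      (Algebra.TensorProduct.rid F F B).symm)).trans ?_
    refine ((hH.symm.tensor_left B).baseChange K).trans ?_
    refine (IsBrauerEquiv.of_algEquiv (Algebra.TensorProduct.congr AlgEquiv.refl
      (Algebra.TensorProduct.assoc F F F B H H).symm)).trans ?_
    refine (IsBrauerEquiv.of_algEquiv (tensorBaseChange K (B ⊗[F] H) H)).trans ?_
    exact (h.tensor_right _).trans (IsBrauerEquiv.of_algEquiv (Algebra.TensorProduct.lid K _))

/-- Splitting passes to larger fields. -/
lemma IsBrauerEquiv.split_of_ringHom {F K L T : Type} [Field F] [Field K] [Algebra F K]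
    [Field L] [Algebra F L] [Algebra K L] [IsScalarTower F K L] [Ring T] [Algebra F T]
    (h : IsBrauerEquiv K (K ⊗[F] T) K) : IsBrauerEquiv L (L ⊗[F] T) L :=
  (of_algEquiv (algCancelBaseChange F K L T).symm).trans <|
    (h.baseChange L).trans <| of_algEquiv (Algebra.TensorProduct.rid K L L)

open Module Matrix.Module in
/-- The dimension of a module over `M_q(D)` is a multiple of `q * dim D`. -/
lemma exists_finrank_eq_of_matrix_module (k D N : Type) [Field k] [DivisionRing D] [Algebra k D]
    {q : ℕ} (hq : 0 < q) [AddCommGroup N] [Module k N] [FiniteDimensional k N]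
    [Module (Matrix (Fin q) (Fin q) D) N]
    [IsScalarTower k (Matrix (Fin q) (Fin q) D) N] :
    ∃ v, finrank k N = q * (finrank k D * v) := by
  let M : ModuleCat (Matrix (Fin q) (Fin q) D) := ModuleCat.of _ N
  let _ : Module D M := Module.compHom M (Matrix.scalar (α := D) (Fin q))
  have _ := MatrixModCat.isScalarTower_toModuleCat D M
  let _ : Module k M := inferInstanceAs (Module k N)
  have _ : IsScalarTower k (Matrix (Fin q) (Fin q) D) M := inferInstanceAs (IsScalarTower k _ N)
  have _ : IsScalarTower k D M := ⟨fun a d x => by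
    change Matrix.scalar (Fin q) (a • d) • x = a • (Matrix.scalar (Fin q) d • x)
    rw [← smul_assoc]
    congr 1
    ext i j
    simp [Matrix.diagonal_apply]⟩
  let V := MatrixModCat.toModuleCatObj D M (⟨0, hq⟩ : Fin q)
  let e := (toModuleCatFromModuleCatLinearEquiv D M (⟨0, hq⟩ : Fin q)).toAddEquiv
  have he : ∀ (c : k) (x : M), e (c • x) = c • e x := by
    intro c x
    ext i
    change Matrix.single (⟨0, hq⟩ : Fin q) i (1 : D) • (c • x) =
      c • (Matrix.single (⟨0, hq⟩ : Fin q) i (1 : D) • x)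
    rw [← algebraMap_smul (Matrix (Fin q) (Fin q) D) c x,
      ← algebraMap_smul (Matrix (Fin q) (Fin q) D) c (_ • x), smul_smul, smul_smul,
      Algebra.commutes]
  let e' : M ≃ₗ[k] (Fin q → V) := { e with map_smul' := he }
  have _ : FiniteDimensional k M := inferInstanceAs (FiniteDimensional k N)
  have _ : FiniteDimensional k V :=
    FiniteDimensional.of_injective (V.subtype.restrictScalars k) V.injective_subtype
  refine ⟨finrank D V, ?_⟩
  rw [finrank_mul_finrank]
  change finrank k M = _
  rw [e'.finrank_eq, finrank_pi_fintype]
  simp [V]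

open Module in
/-- The index of a division algebra divides the degree of any splitting field. -/
lemma exists_finrank_eq_sq_of_split (k L D : Type) [Field k] [DivisionRing D] [Algebra k D]
    [Field L] [Algebra k L] [FiniteDimensional k L] {q m : ℕ} (hq : 0 < q) (hm : 0 < m)
    (φ : Matrix (Fin q) (Fin q) D →ₐ[k] Matrix (Fin m) (Fin m) L)
    (hd : q ^ 2 * finrank k D = m ^ 2) :
    ∃ s, finrank k D = s ^ 2 ∧ s ∣ finrank k L := by
  obtain ⟨s, rfl⟩ : q ∣ m := (Nat.pow_dvd_pow_iff two_ne_zero).1 ⟨_, hd.symm⟩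
  have hs : finrank k D = s ^ 2 := by
    rw [mul_pow] at hd
    exact Nat.eq_of_mul_eq_mul_left (by positivity) hd
  let _ : Module (Matrix (Fin (q * s)) (Fin (q * s)) L) (Fin (q * s) → L) :=
    Module.compHom _ (Matrix.toLinAlgEquiv' (R := L) (n := Fin (q * s))).toRingHom
  let _ : Module (Matrix (Fin q) (Fin q) D) (Fin (q * s) → L) := Module.compHom _ φ.toRingHom
  have _ : IsScalarTower k (Matrix (Fin q) (Fin q) D) (Fin (q * s) → L) := ⟨fun a x y => by
    change Matrix.toLinAlgEquiv' (φ (a • x)) y = a • Matrix.toLinAlgEquiv' (φ x) y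
    rw [map_smul]
    simp [Matrix.toLinAlgEquiv'_apply, Matrix.smul_mulVec]⟩
  obtain ⟨v, hv⟩ := exists_finrank_eq_of_matrix_module k D (Fin (q * s) → L) hq
  refine ⟨s, hs, v, ?_⟩
  have hs0 : 0 < s := Nat.pos_of_mul_pos_left hm
  rw [finrank_pi_fintype, hs] at hv
  simp only [Finset.sum_const, Finset.card_univ, Fintype.card_fin, smul_eq_mul] at hv
  apply Nat.eq_of_mul_eq_mul_left (Nat.mul_pos hq hs0)
  rw [hv]
  ring

open Module in
/-- An algebra split by a field extension is simple. -/
lemma isSimpleRing_of_split {k L A : Type} [Field k] [Field L] [Algebra k L]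
    [Ring A] [Algebra k A] (h : IsBrauerEquiv L (L ⊗[k] A) L) : IsSimpleRing A := by
  obtain ⟨n, m, hn, hm, ⟨e⟩⟩ := h
  have _ : NeZero n := ⟨hn.ne'⟩
  have _ : NeZero m := ⟨hm.ne'⟩
  have hA : Nontrivial A := by
    by_contra hA
    rw [not_nontrivial_iff_subsingleton] at hA
    have : Subsingleton (L ⊗[k] A) := inferInstance
    exact not_subsingleton (Matrix (Fin m) (Fin m) L) e.symm.injective.subsingleton
  refine ⟨⟨fun I => ?_⟩⟩
  rw [or_iff_not_imp_right]
  intro hI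
  let π : A →ₐ[k] I.ringCon.Quotient := I.ringCon.mkₐ k
  have hπ (a : A) : π a = 0 ↔ a ∈ I := by
    have h := TwoSidedIdeal.mem_ker (f := I.ringCon.mk') (x := a)
    rw [TwoSidedIdeal.ker_ringCon_mk'] at h
    exact h.symm
  have _ : Nontrivial I.ringCon.Quotient := by
    refine ⟨π 1, 0, fun h => hI ?_⟩
    exact (TwoSidedIdeal.one_mem_iff I).1 ((hπ 1).1 h)
  have _ : Nontrivial (L ⊗[k] I.ringCon.Quotient) :=
    Module.FaithfullyFlat.lTensor_nontrivial k L I.ringCon.Quotient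
  let f : L ⊗[k] A →ₐ[L] L ⊗[k] I.ringCon.Quotient := Algebra.TensorProduct.map (AlgHom.id L L) π
  let g := (f.mapMatrix (m := Fin n)).comp e.symm.toAlgHom
  have hg : Function.Injective g := RingHom.injective g.toRingHom
  refine eq_bot_iff.2 fun a ha => ?_
  rw [TwoSidedIdeal.mem_bot]
  have h1 : Matrix.scalar (Fin n) ((1 : L) ⊗ₜ[k] a) = 0 := by
    apply e.injective
    rw [map_zero]
    apply hg
    ext i j
    rcases eq_or_ne i j with rfl | hij
    · simp [g, f, (hπ a).2 ha]
    · simp [g, f, hij]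
  have h2 : (1 : L) ⊗ₜ[k] a = 0 := by
    simpa using congrFun (congrFun h1 0) 0
  have h3 := Algebra.TensorProduct.includeRight_injective (R := k) (A := L) (B := A)
    (algebraMap k L).injective
  exact h3 (by simpa using h2)

open Module in
/-- An algebra split by two extensions of coprime degrees is a matrix algebra. -/
lemma exists_algEquiv_matrix_of_coprime {k A L₁ L₂ : Type} [Field k] [Ring A] [Algebra k A]
    [FiniteDimensional k A] [Field L₁] [Algebra k L₁] [FiniteDimensional k L₁]
    [Field L₂] [Algebra k L₂] [FiniteDimensional k L₂]
    (hc : (finrank k L₁).Coprime (finrank k L₂)) (h₁ : IsBrauerEquiv L₁ (L₁ ⊗[k] A) L₁)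
    (h₂ : IsBrauerEquiv L₂ (L₂ ⊗[k] A) L₂) :
    ∃ r, 0 < r ∧ Nonempty (A ≃ₐ[k] Matrix (Fin r) (Fin r) k) := by
  have _ := isSimpleRing_of_split h₁
  have _ : IsArtinianRing A := IsArtinianRing.of_finite k A
  obtain ⟨r, hr, D, _, _, _, ⟨e⟩⟩ := IsSimpleRing.exists_algEquiv_matrix_divisionRing_finite k A
  have key : ∀ (L : Type) [Field L] [Algebra k L] [FiniteDimensional k L],
      IsBrauerEquiv L (L ⊗[k] A) L → ∃ s, finrank k D = s ^ 2 ∧ s ∣ finrank k L := by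
    intro L _ _ _ h
    obtain ⟨n, m, hn, hm, ⟨f⟩⟩ := h
    have hn0 : 0 < n * r := Nat.mul_pos hn (NeZero.pos r)
    let g : Matrix (Fin n) (Fin n) A →ₐ[k] Matrix (Fin n) (Fin n) (L ⊗[k] A) :=
      (Algebra.TensorProduct.includeRight (R := k) (A := L) (B := A)).mapMatrix
    let e' : Matrix (Fin (n * r)) (Fin (n * r)) D ≃ₐ[k] Matrix (Fin n) (Fin n) A :=
      ((e.mapMatrix (m := Fin n)).trans ((Matrix.compAlgEquiv _ _ _ _).trans
        (Matrix.reindexAlgEquiv k D finProdFinEquiv))).symm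
    refine exists_finrank_eq_sq_of_split k L D hn0 hm
      ((f.toAlgHom.restrictScalars k).comp (g.comp e'.toAlgHom)) ?_
    have hA := e.toLinearEquiv.finrank_eq
    have hf := f.toLinearEquiv.finrank_eq
    rw [finrank_matrix, finrank_matrix, finrank_baseChange, hA, finrank_matrix] at hf
    simp only [Fintype.card_fin, finrank_self, mul_one] at hf
    linear_combination hf
  obtain ⟨s, hs, hs₁⟩ := key L₁ h₁
  obtain ⟨t, ht, ht₂⟩ := key L₂ h₂
  obtain rfl : s = t := Nat.pow_left_injective two_ne_zero (hs.symm.trans ht)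
  have hs1 : s = 1 := Nat.eq_one_of_dvd_coprimes hc hs₁ ht₂
  rw [hs1, one_pow] at hs
  have hb : Function.Bijective (Algebra.ofId k D) := by
    refine ⟨(algebraMap k D).injective, ?_⟩
    have := (LinearMap.injective_iff_surjective_of_finrank_eq_finrank
      (f := (Algebra.ofId k D).toLinearMap) (by rw [hs, finrank_self])).1
      (algebraMap k D).injective
    exact this
  exact ⟨r, NeZero.pos r, ⟨e.trans (AlgEquiv.ofBijective _ hb).symm.mapMatrix⟩⟩

lemma IsBrauerEquiv.of_matrix {k A : Type} [Field k] [Ring A] [Algebra k A] {r : ℕ} (hr : 0 < r)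
    (e : A ≃ₐ[k] Matrix (Fin r) (Fin r) k) : IsBrauerEquiv k A k :=
  ⟨1, r, one_pos, hr, ⟨(e.mapMatrix (m := Fin 1)).trans ((Matrix.compAlgEquiv _ _ _ _).trans
    (Matrix.reindexAlgEquiv k k (Equiv.uniqueProd (Fin r) (Fin 1))))⟩⟩

section Quaternion

open Quaternion Module

lemma QuaternionAlgebra.isUnit_of_ringHom_real {F : Type} [Field F] (ψ : F →+* ℝ) {c : F}
    (hc : ψ c < 0) (x : ℍ[F,-1,c]) (hx : x ≠ 0) : IsUnit x := by
  obtain ⟨n, hn⟩ : ∃ n, n = x.re ^ 2 + x.imI ^ 2 - c * (x.imJ ^ 2 + x.imK ^ 2) := ⟨_, rfl⟩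
  have h1 : x * star x = (n : ℍ[F,-1,c]) := by ext <;> simp <;> grind
  have h2 : star x * x = (n : ℍ[F,-1,c]) := by ext <;> simp <;> grind
  have hn0 : n ≠ 0 := by
    intro h0
    apply hx
    have h3 : ψ x.re ^ 2 + ψ x.imI ^ 2 - ψ c * (ψ x.imJ ^ 2 + ψ x.imK ^ 2) = 0 := by
      have := congrArg ψ (hn.symm.trans h0)
      simpa using this
    have hz : ∀ a : F, ψ a ^ 2 ≤ 0 → a = 0 := fun a ha =>
      (map_eq_zero ψ).1 (pow_eq_zero_iff two_ne_zero |>.1 (le_antisymm ha (sq_nonneg _)))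
    have hr := sq_nonneg (ψ x.re)
    have hi := sq_nonneg (ψ x.imI)
    have hj := sq_nonneg (ψ x.imJ)
    have hk := sq_nonneg (ψ x.imK)
    ext
    · exact hz _ (by nlinarith)
    · exact hz _ (by nlinarith)
    · exact hz _ (by nlinarith)
    · exact hz _ (by nlinarith)
  refine ⟨⟨x, n⁻¹ • star x, ?_, ?_⟩, rfl⟩
  · rw [mul_smul_comm, h1, QuaternionAlgebra.smul_coe, inv_mul_cancel₀ hn0]
    rfl
  · rw [smul_mul_assoc, h2, QuaternionAlgebra.smul_coe, inv_mul_cancel₀ hn0]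
    rfl

/-- The quaternion algebra `(-1, c)` over a field with a real embedding at which `c` is negative,
as a central simple algebra. -/
noncomputable def quaternionCSAlg {F : Type} [Field F] (ψ : F →+* ℝ) (c : F) (hc : ψ c < 0) :
    CSAlg F where
  carrier := ℍ[F,-1,c]
  finiteDimensional := Module.Finite.of_basis (QuaternionAlgebra.basisOneIJK _ _ _)
  isSimpleRing := by
    classical
    let _ : DivisionRing ℍ[F,-1,c] := DivisionRing.ofIsUnitOrEqZero fun x =>
      or_iff_not_imp_right.2 (QuaternionAlgebra.isUnit_of_ringHom_real ψ hc x)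
    exact inferInstance
  center_le_bot := by
    have hF : CharZero F := (ψ.charZero_iff ψ.injective).2 inferInstance
    have hc0 : c ≠ 0 := by
      rintro rfl
      simp at hc
    intro x hx
    rw [Subalgebra.mem_center_iff] at hx
    have hi := hx ⟨0, 1, 0, 0⟩
    have hj := hx ⟨0, 0, 1, 0⟩
    simp only [QuaternionAlgebra.ext_iff, QuaternionAlgebra.re_mul, QuaternionAlgebra.imI_mul,
      QuaternionAlgebra.imJ_mul, QuaternionAlgebra.imK_mul] at hi hj
    refine Algebra.mem_bot.2 ⟨x.re, ?_⟩
    ext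
    · rfl
    · change 0 = x.imI
      grind
    · change 0 = x.imJ
      grind
    · change 0 = x.imK
      grind

lemma quaternionCSAlg_isDivision {F : Type} [Field F] (ψ : F →+* ℝ) (c : F) (hc : ψ c < 0) :
    (quaternionCSAlg ψ c hc).IsDivision :=
  QuaternionAlgebra.isUnit_of_ringHom_real ψ hc

lemma quaternionCSAlg_degreeEq {F : Type} [Field F] (ψ : F →+* ℝ) (c : F) (hc : ψ c < 0) :
    (quaternionCSAlg ψ c hc).DegreeEq 2 :=
  QuaternionAlgebra.finrank_eq_four _ _ _

/-- Multiplying the second parameter by a norm from `F(√-1)` does not change the base change of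
a quaternion algebra. -/
lemma nonempty_baseChange_quaternion {k F : Type} [Field k] [Field F] [Algebra k F] {n : k}
    (hn : n ≠ 0) (x y : F) (hxy : algebraMap k F n = x ^ 2 + y ^ 2) :
    Nonempty (F ⊗[k] ℍ[k,-1,-n] ≃ₐ[F] ℍ[F,-1,-1]) := by
  let b : QuaternionAlgebra.Basis ℍ[F,-1,-1] (-1 : k) 0 (-n) :=
    { i := ⟨0, 1, 0, 0⟩
      j := ⟨0, 0, x, y⟩
      k := ⟨0, 0, -y, x⟩
      i_mul_i := by ext <;> simp
      j_mul_j := by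
        rw [← algebraMap_smul F (-n), map_neg, hxy]
        ext <;> simp <;> ring
      i_mul_j := by ext <;> simp
      j_mul_i := by ext <;> simp }
  let f : F ⊗[k] ℍ[k,-1,-n] →ₐ[F] ℍ[F,-1,-1] :=
    Algebra.TensorProduct.lift (Algebra.ofId F _) b.liftHom
      fun a z => Algebra.commutes a (b.liftHom z)
  have hf (a : F) (z) : f (a ⊗ₜ z) = a • b.lift z := by
    rw [Algebra.smul_def]
    exact Algebra.TensorProduct.lift_tmul _ _ _ _ _
  have _ : FiniteDimensional k ℍ[k,-1,-n] :=
    Module.Finite.of_basis (QuaternionAlgebra.basisOneIJK _ _ _)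
  have _ : FiniteDimensional F ℍ[F,-1,-1] :=
    Module.Finite.of_basis (QuaternionAlgebra.basisOneIJK _ _ _)
  have hn' : x ^ 2 + y ^ 2 ≠ 0 := by
    rw [← hxy]
    exact (map_ne_zero _).2 hn
  have hsurj : Function.Surjective f := by
    intro w
    refine ⟨w.re ⊗ₜ 1 + w.imI ⊗ₜ ⟨0, 1, 0, 0⟩ +
      ((w.imJ * x + w.imK * y) / (x ^ 2 + y ^ 2)) ⊗ₜ ⟨0, 0, 1, 0⟩ +
      ((w.imK * x - w.imJ * y) / (x ^ 2 + y ^ 2)) ⊗ₜ ⟨0, 0, 0, 1⟩, ?_⟩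
    simp only [map_add, hf, QuaternionAlgebra.Basis.lift, b]
    ext <;> simp <;> field_simp <;> ring
  have hdim : finrank F (F ⊗[k] ℍ[k,-1,-n]) = finrank F ℍ[F,-1,-1] := by
    rw [finrank_baseChange, QuaternionAlgebra.finrank_eq_four, QuaternionAlgebra.finrank_eq_four]
  exact ⟨AlgEquiv.ofBijective f
    ⟨(LinearMap.injective_iff_surjective_of_finrank_eq_finrank (f := f.toLinearMap) hdim).2 hsurj,
      hsurj⟩⟩

end Quaternion

section QuaternionSquare

open Quaternion Module MulOpposite

lemma QuaternionAlgebra.mulLeftRight_surjective {k : Type} [Field k] [CharZero k] {c : k}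
    (hc : c ≠ 0) : Function.Surjective (AlgHom.mulLeftRight k ℍ[k,-1,c]) := by
  have key (a b : ℍ[k,-1,c]) : ∃ t, ∀ x, AlgHom.mulLeftRight k ℍ[k,-1,c] t x = (b * x).re • a := by
    refine ⟨(4⁻¹ : k) • ((a * b) ⊗ₜ op 1 - (a * ⟨0, 1, 0, 0⟩ * b) ⊗ₜ op ⟨0, 1, 0, 0⟩ +
      (c⁻¹ : k) • (a * ⟨0, 0, 1, 0⟩ * b) ⊗ₜ op ⟨0, 0, 1, 0⟩ +
      (c⁻¹ : k) • (a * ⟨0, 0, 0, 1⟩ * b) ⊗ₜ op ⟨0, 0, 0, 1⟩), fun x => ?_⟩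
    have h (y : ℍ[k,-1,c]) : (4⁻¹ : k) • (y - ⟨0, 1, 0, 0⟩ * y * ⟨0, 1, 0, 0⟩ +
        (c⁻¹ : k) • (⟨0, 0, 1, 0⟩ * y * ⟨0, 0, 1, 0⟩) +
        (c⁻¹ : k) • (⟨0, 0, 0, 1⟩ * y * ⟨0, 0, 0, 1⟩)) = (y.re : ℍ[k,-1,c]) := by
      ext <;> simp <;> field_simp <;> ring
    rw [← QuaternionAlgebra.mul_coe_eq_smul, ← h]
    simp only [map_smul, map_add, map_sub, LinearMap.smul_apply, LinearMap.add_apply,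
      LinearMap.sub_apply, AlgHom.mulLeftRight_apply, unop_op, mul_one, mul_smul_comm, mul_add,
      mul_sub, mul_assoc]
  intro f
  choose t ht using key
  refine ⟨t (f 1) 1 + t (f ⟨0, 1, 0, 0⟩) ⟨0, -1, 0, 0⟩ + t (f ⟨0, 0, 1, 0⟩) ⟨0, 0, c⁻¹, 0⟩ +
    t (f ⟨0, 0, 0, 1⟩) ⟨0, 0, 0, c⁻¹⟩, LinearMap.ext fun x => ?_⟩
  have hx : x = x.re • 1 + x.imI • ⟨0, 1, 0, 0⟩ + x.imJ • ⟨0, 0, 1, 0⟩ +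
      x.imK • ⟨0, 0, 0, 1⟩ := by ext <;> simp
  conv_rhs => rw [hx]
  simp only [map_add, LinearMap.add_apply, ht, map_smul]
  congr 4 <;> simp [hc]

lemma QuaternionAlgebra.isBrauerEquiv_tensor_self {k : Type} [Field k] [CharZero k] {c : k}
    (hc : c ≠ 0) : IsBrauerEquiv k (ℍ[k,-1,c] ⊗[k] ℍ[k,-1,c]) k := by
  have _ : FiniteDimensional k ℍ[k,-1,c] :=
    Module.Finite.of_basis (QuaternionAlgebra.basisOneIJK _ _ _)
  have hs := mulLeftRight_surjective hc
  have hdim : finrank k (ℍ[k,-1,c] ⊗[k] ℍ[k,-1,c]ᵐᵒᵖ) = finrank k (Module.End k ℍ[k,-1,c]) := by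
    rw [finrank_tensorProduct, finrank_linearMap,
      ← (opLinearEquiv k : ℍ[k,-1,c] ≃ₗ[k] ℍ[k,-1,c]ᵐᵒᵖ).finrank_eq]
  have hb : Function.Bijective (AlgHom.mulLeftRight k ℍ[k,-1,c]) :=
    ⟨(LinearMap.injective_iff_surjective_of_finrank_eq_finrank
      (f := (AlgHom.mulLeftRight k ℍ[k,-1,c]).toLinearMap) hdim).2 hs, hs⟩
  exact IsBrauerEquiv.of_matrix (r := 4) (by norm_num)
    ((Algebra.TensorProduct.congr AlgEquiv.refl QuaternionAlgebra.starAe).trans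
      ((AlgEquiv.ofBijective _ hb).trans (algEquivMatrix (QuaternionAlgebra.basisOneIJK _ _ _))))

end QuaternionSquare

section NonEquivalence

open Quaternion Module Matrix

lemma QuaternionAlgebra.re_eq_zero_of_mul_self {p a : ℚ} (ha : a < 0) {x : ℍ[ℚ,-1,-p]}
    (hx : x * x = (a : ℍ[ℚ,-1,-p])) :
    x.re = 0 ∧ x.imI ^ 2 + p * (x.imJ ^ 2 + x.imK ^ 2) = -a := by
  simp only [QuaternionAlgebra.ext_iff, QuaternionAlgebra.re_mul, QuaternionAlgebra.imI_mul,
    QuaternionAlgebra.imJ_mul, QuaternionAlgebra.imK_mul, QuaternionAlgebra.re_coe,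
    QuaternionAlgebra.imI_coe, QuaternionAlgebra.imJ_coe, QuaternionAlgebra.imK_coe] at hx
  obtain ⟨h0, h1, h2, h3⟩ := hx
  have hr : x.re = 0 := by
    by_contra hr
    have hi : x.imI = 0 := by grind
    have hj : x.imJ = 0 := by grind
    have hk : x.imK = 0 := by grind
    rw [hi, hj, hk] at h0
    nlinarith [sq_nonneg x.re]
  refine ⟨hr, ?_⟩
  rw [hr] at h0
  linear_combination -h0

lemma QuaternionAlgebra.exists_mul_eq_of_anticommute {p q : ℚ} (hp : 0 < p) (hq : 0 < q)
    {x y : ℍ[ℚ,-1,-p]} (hx : x * x = ((-1 : ℚ) : ℍ[ℚ,-1,-p]))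
    (hy : y * y = ((-q : ℚ) : ℍ[ℚ,-1,-p]))
    (hxy : x * y = -(y * x)) : ∃ u v : ℚ, p * (u ^ 2 + v ^ 2) = q := by
  obtain ⟨hx0, hx1⟩ := re_eq_zero_of_mul_self (by norm_num) hx
  obtain ⟨hy0, hy1⟩ := re_eq_zero_of_mul_self (by linarith) hy
  have h := congrArg QuaternionAlgebra.re hxy
  simp only [QuaternionAlgebra.re_mul, QuaternionAlgebra.re_neg, hx0, hy0] at h
  by_cases ha : 1 + x.imI = 0
  · have ha' : x.imI = -1 := by linarith
    rw [ha'] at hx1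
    have hs : x.imJ ^ 2 + x.imK ^ 2 = 0 := by
      have : p * (x.imJ ^ 2 + x.imK ^ 2) = 0 := by linarith
      exact (mul_eq_zero.1 this).resolve_left hp.ne'
    have hj : x.imJ = 0 := by nlinarith [sq_nonneg x.imJ, sq_nonneg x.imK]
    have hk : x.imK = 0 := by nlinarith [sq_nonneg x.imJ, sq_nonneg x.imK]
    have hd : y.imI = 0 := by
      rw [ha', hj, hk] at h
      linarith
    refine ⟨y.imJ, y.imK, ?_⟩
    rw [hd] at hy1
    linarith
  · refine ⟨y.imJ - y.imI * x.imJ / (1 + x.imI), y.imK - y.imI * x.imK / (1 + x.imI), ?_⟩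
    field_simp
    grind

lemma QuaternionAlgebra.exists_mul_eq_of_isBrauerEquiv {p q : ℚ} (hp : 0 < p) (hq : 0 < q)
    (h : IsBrauerEquiv ℚ ℍ[ℚ,-1,-p] ℍ[ℚ,-1,-q]) : ∃ u v : ℚ, p * (u ^ 2 + v ^ 2) = q := by
  have hT : IsBrauerEquiv ℚ (ℍ[ℚ,-1,-p] ⊗[ℚ] ℍ[ℚ,-1,-q]) ℚ :=
    (h.tensor_right _).trans (isBrauerEquiv_tensor_self (neg_ne_zero.2 hq.ne'))
  have hT' := (IsBrauerEquiv.of_algEquiv (Algebra.TensorProduct.lid ℚ _)).trans hT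
  have _ : FiniteDimensional ℚ ℍ[ℚ,-1,-p] :=
    Module.Finite.of_basis (QuaternionAlgebra.basisOneIJK _ _ _)
  have _ : FiniteDimensional ℚ ℍ[ℚ,-1,-q] :=
    Module.Finite.of_basis (QuaternionAlgebra.basisOneIJK _ _ _)
  obtain ⟨r, hr, ⟨e⟩⟩ := exists_algEquiv_matrix_of_coprime (by simp) hT' hT'
  have hr4 : r = 4 := by
    have := e.toLinearEquiv.finrank_eq
    rw [finrank_tensorProduct, finrank_matrix, finrank_eq_four, finrank_eq_four] at this
    simp only [Fintype.card_fin, finrank_self, mul_one] at this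
    nlinarith
  subst hr4
  let α : ℍ[ℚ,-1,-p] →ₐ[ℚ] Matrix (Fin 4) (Fin 4) ℚ :=
    e.toAlgHom.comp Algebra.TensorProduct.includeLeft
  let β : ℍ[ℚ,-1,-q] →ₐ[ℚ] Matrix (Fin 4) (Fin 4) ℚ :=
    e.toAlgHom.comp Algebra.TensorProduct.includeRight
  have hαβ (a b) : β b * α a = α a * β b := by
    simp [α, β, ← map_mul]
  let v : Fin 4 → ℚ := Pi.single 0 1
  have hv : v ≠ 0 := by simp [v]
  let l : ℍ[ℚ,-1,-p] →ₗ[ℚ] (Fin 4 → ℚ) :=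
    { toFun a := α a *ᵥ v
      map_add' a b := by rw [map_add, Matrix.add_mulVec]
      map_smul' a b := by rw [map_smul, Matrix.smul_mulVec, RingHom.id_apply] }
  have hl : Function.Injective l := by
    rw [← LinearMap.ker_eq_bot, LinearMap.ker_eq_bot']
    intro a ha
    by_contra ha0
    obtain ⟨b, hb⟩ := (QuaternionAlgebra.isUnit_of_ringHom_real (algebraMap ℚ ℝ)
      (by simpa using hp) a ha0).exists_left_inv
    apply hv
    rw [← Matrix.one_mulVec v, ← map_one α, ← hb, map_mul, ← Matrix.mulVec_mulVec]
    change α b *ᵥ l a = 0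
    rw [ha, Matrix.mulVec_zero]
  have hls : Function.Surjective l :=
    (LinearMap.injective_iff_surjective_of_finrank_eq_finrank
      (by rw [finrank_eq_four, finrank_fin_fun])).1 hl
  have hcomp (a b : ℍ[ℚ,-1,-p]) (c d : ℍ[ℚ,-1,-q]) (hac : α a *ᵥ v = β c *ᵥ v)
      (hbd : α b *ᵥ v = β d *ᵥ v) : α (a * b) *ᵥ v = β (d * c) *ᵥ v := by
    rw [map_mul, map_mul, ← Matrix.mulVec_mulVec, hbd, Matrix.mulVec_mulVec, ← hαβ,
      ← Matrix.mulVec_mulVec, hac, Matrix.mulVec_mulVec]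
  have hcoe (a : ℚ) : α (a : ℍ[ℚ,-1,-p]) = β (a : ℍ[ℚ,-1,-q]) := by
    rw [← coe_algebraMap, ← coe_algebraMap, AlgHom.commutes, AlgHom.commutes]
  obtain ⟨x, hx⟩ := hls (β ⟨0, 1, 0, 0⟩ *ᵥ v)
  obtain ⟨y, hy⟩ := hls (β ⟨0, 0, 1, 0⟩ *ᵥ v)
  refine exists_mul_eq_of_anticommute hp hq (x := x) (y := y) (hl ?_) (hl ?_) (hl ?_)
  · refine (hcomp _ _ _ _ hx hx).trans ?_
    change _ = α _ *ᵥ v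
    rw [hcoe]
    congr 2
    ext <;> simp
  · refine (hcomp _ _ _ _ hy hy).trans ?_
    change _ = α _ *ᵥ v
    rw [hcoe]
    congr 2
    ext <;> simp
  · rw [map_neg]
    refine (hcomp _ _ _ _ hx hy).trans ?_
    refine Eq.trans ?_ (congrArg Neg.neg (hcomp _ _ _ _ hy hx).symm)
    rw [← Matrix.neg_mulVec, ← map_neg]
    congr 2
    ext <;> simp

lemma mul_sq_add_sq_ne_of_coprime {p q : ℕ} (hp : p % 4 = 3) (hq : q ≠ 0) (hpq : p.Coprime q)
    (u v : ℚ) : (p : ℚ) * (u ^ 2 + v ^ 2) ≠ q := by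
  intro h
  have hp0 : p ≠ 0 := by
    rintro rfl
    simp at hp
  have hnot : ¬ ∃ x y, p = x ^ 2 + y ^ 2 := by
    rintro ⟨x, y, rfl⟩
    have hx : x ^ 2 % 4 = 0 ∨ x ^ 2 % 4 = 1 := by
      rcases Nat.even_or_odd' x with ⟨a, rfl | rfl⟩ <;> ring_nf <;> omega
    have hy : y ^ 2 % 4 = 0 ∨ y ^ 2 % 4 = 1 := by
      rcases Nat.even_or_odd' y with ⟨a, rfl | rfl⟩ <;> ring_nf <;> omega
    omega
  rw [Nat.eq_sq_add_sq_iff] at hnot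
  push Not at hnot
  obtain ⟨l, hl, hl4, hodd⟩ := hnot
  have hlp := Nat.prime_of_mem_primeFactors hl
  have hld := Nat.dvd_of_mem_primeFactors hl
  have _ : Fact l.Prime := ⟨hlp⟩
  have hlq : ¬ l ∣ q := fun hd => hlp.one_lt.ne' (Nat.eq_one_of_dvd_coprimes hpq hld hd)
  let w := u.den * v.den
  have hw : w ≠ 0 := mul_ne_zero u.den_nz v.den_nz
  have hsum : p * q * w ^ 2 =
      (p * u.num.natAbs * v.den) ^ 2 + (p * v.num.natAbs * u.den) ^ 2 := by
    have hu : (u.den : ℚ) ≠ 0 := by exact_mod_cast u.den_nz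
    have hv : (v.den : ℚ) ≠ 0 := by exact_mod_cast v.den_nz
    zify
    simp only [mul_pow, sq_abs]
    have : ((p * q * w ^ 2 : ℤ) : ℚ) =
        (p ^ 2 * u.num ^ 2 * v.den ^ 2 + p ^ 2 * v.num ^ 2 * u.den ^ 2 : ℤ) := by
      push_cast [w]
      rw [← h]
      have h1 : (u.num : ℚ) = u * u.den := (Rat.mul_den_eq_num u).symm
      have h2 : (v.num : ℚ) = v * v.den := (Rat.mul_den_eq_num v).symm
      rw [h1, h2]
      ring
    exact_mod_cast this
  have hev := Nat.eq_sq_add_sq_iff.1 ⟨_, _, hsum⟩ l (Nat.mem_primeFactors.2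
    ⟨hlp, Dvd.dvd.mul_right (Dvd.dvd.mul_right hld _) _,
      mul_ne_zero (mul_ne_zero hp0 hq) (pow_ne_zero 2 hw)⟩) hl4
  rw [padicValNat.mul (mul_ne_zero hp0 hq) (pow_ne_zero 2 hw), padicValNat.mul hp0 hq,
    padicValNat.pow, padicValNat.eq_zero_of_not_dvd hlq, add_zero,
    Nat.even_add] at hev
  exact hodd (hev.2 (even_two_mul _))

/-- A sequence of odd numbers `P` such that the numbers `P ^ 2 + 2` are pairwise coprime. -/
def oddSeq : ℕ → ℕ
  | 0 => 1
  | k + 1 => oddSeq k * (oddSeq k ^ 2 + 2)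

lemma odd_oddSeq (k : ℕ) : Odd (oddSeq k) := by
  induction k with
  | zero => exact odd_one
  | succ k ih => exact ih.mul (ih.pow.add_even even_two)

lemma oddSeq_sq_add_two_mod_four (k : ℕ) : (oddSeq k ^ 2 + 2) % 4 = 3 := by
  obtain ⟨a, ha⟩ := odd_oddSeq k
  rw [ha]
  ring_nf
  omega

lemma oddSeq_dvd_of_le {j k : ℕ} (h : j ≤ k) : oddSeq j ∣ oddSeq k := by
  induction k, h using Nat.le_induction with
  | base => exact dvd_rfl
  | succ k _ ih => exact ih.mul_right _

lemma coprime_oddSeq_sq_add_two {j k : ℕ} (h : j ≠ k) :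
    (oddSeq j ^ 2 + 2).Coprime (oddSeq k ^ 2 + 2) := by
  wlog hjk : j < k generalizing j k
  · exact (this h.symm (lt_of_le_of_ne (not_lt.1 hjk) h.symm)).symm
  have hd : oddSeq j ^ 2 + 2 ∣ oddSeq k ^ 2 :=
    dvd_pow ((dvd_mul_left _ (oddSeq j)).trans (oddSeq_dvd_of_le hjk)) two_ne_zero
  obtain ⟨a, ha⟩ := hd
  have hodd : Odd (oddSeq j ^ 2 + 2) := (odd_oddSeq j).pow.add_even even_two
  rw [ha]
  simpa using Nat.coprime_two_right.2 hodd

end NonEquivalence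

section Splitting

open Module Polynomial

lemma split_of_coprime_extensions {K k T : Type} [Field K] [Algebra ℚ K] [Field k] [Algebra ℚ k]
    [Ring T] [Algebra ℚ T] [FiniteDimensional ℚ T] {L₁ L₂ : Type}
    [Field L₁] [Algebra k L₁] [FiniteDimensional k L₁]
    [Field L₂] [Algebra k L₂] [FiniteDimensional k L₂]
    (hc : (finrank k L₁).Coprime (finrank k L₂)) (g₁ : K →+* L₁) (g₂ : K →+* L₂)
    (h : IsBrauerEquiv K (K ⊗[ℚ] T) K) : IsBrauerEquiv k (k ⊗[ℚ] T) k := by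
  have key (L : Type) [Field L] [Algebra k L] (g : K →+* L) :
      IsBrauerEquiv L (L ⊗[k] (k ⊗[ℚ] T)) L := by
    let _ : Algebra ℚ L := ((algebraMap k L).comp (algebraMap ℚ k)).toAlgebra
    have _ : IsScalarTower ℚ k L := .of_algebraMap_eq' rfl
    let _ : Algebra K L := g.toAlgebra
    have _ : IsScalarTower ℚ K L := .of_algebraMap_eq' (Subsingleton.elim _ _)
    exact (IsBrauerEquiv.of_algEquiv (algCancelBaseChange ℚ k L T)).trans h.split_of_ringHom
  obtain ⟨r, hr, ⟨e⟩⟩ := exists_algEquiv_matrix_of_coprime hc (key L₁ g₁) (key L₂ g₂)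
  exact IsBrauerEquiv.of_matrix hr e

lemma exists_extension_root {k : Type} [Field k] {p : k[X]} (hp : p.Monic)
    (h2 : 2 ≤ p.natDegree) (h3 : p.natDegree ≤ 3) :
    ∃ (L : Type) (_ : Field L) (_ : Algebra k L), FiniteDimensional k L ∧
      (finrank k L = 1 ∨ finrank k L = p.natDegree) ∧ ∃ x : L, aeval x p = 0 := by
  by_cases hr : p.roots = 0
  · have _ : Fact (Irreducible p) :=
      ⟨(hp.irreducible_iff_roots_eq_zero_of_degree_le_three h2 h3).2 hr⟩
    refine ⟨AdjoinRoot p, inferInstance, inferInstance, hp.finite_adjoinRoot, Or.inr ?_,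
      AdjoinRoot.root p, ?_⟩
    · rw [PowerBasis.finrank (AdjoinRoot.powerBasis hp.ne_zero), AdjoinRoot.powerBasis_dim]
    · rw [AdjoinRoot.aeval_eq, AdjoinRoot.mk_self]
  · obtain ⟨x, hx⟩ := Multiset.exists_mem_of_ne_zero hr
    exact ⟨k, inferInstance, inferInstance, inferInstance, Or.inl (finrank_self k), x,
      by simpa using (mem_roots hp.ne_zero).1 hx⟩

end Splitting

section Fields

open Polynomial

/-- The Eisenstein polynomial `X ^ 6 - 2 * (3 * X + 1) ^ 2`, the norm of
`X ^ 3 - √2 * (3 * X + 1)`. -/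
noncomputable def sexticInt : ℤ[X] := X ^ 6 - 2 * (3 * X + 1) ^ 2

lemma natDegree_sexticInt : sexticInt.natDegree = 6 := by
  rw [sexticInt]
  compute_degree!

lemma monic_sexticInt : sexticInt.Monic := by
  rw [sexticInt]
  monicity!

lemma irreducible_sexticInt : Irreducible sexticInt := by
  have hc : sexticInt = X ^ 6 + C (-18) * X ^ 2 + C (-12) * X + C (-2) := by
    simp only [sexticInt, C_neg, C_ofNat]
    ring
  refine Polynomial.IsEisensteinAt.irreducible (𝓟 := Ideal.span {2}) ⟨?_, ?_, ?_⟩ ?_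
    monic_sexticInt.isPrimitive (by rw [natDegree_sexticInt]; norm_num)
  · rw [monic_sexticInt, Ideal.mem_span_singleton]
    norm_num
  · intro n hn
    rw [natDegree_sexticInt] at hn
    rw [Ideal.mem_span_singleton, hc]
    interval_cases n <;> simp [coeff_X, coeff_X_pow]
  · rw [Ideal.span_singleton_pow, Ideal.mem_span_singleton, hc]
    simp [coeff_X, coeff_X_pow]
  · exact (Ideal.span_singleton_prime (by norm_num)).2 Int.prime_two

/-- The polynomial `X ^ 6 - 2 * (3 * X + 1) ^ 2` over `ℚ`. -/
noncomputable def sextic : ℚ[X] := sexticInt.map (Int.castRingHom ℚ)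

lemma monic_sextic : sextic.Monic := monic_sexticInt.map _

instance irreducible_sextic : Fact (Irreducible sextic) :=
  ⟨(monic_sexticInt.irreducible_iff_irreducible_map_fraction_map (K := ℚ)).1 irreducible_sexticInt⟩

lemma eval₂_sextic {L : Type} [Field L] (i : ℚ →+* L) (x : L) :
    sextic.eval₂ i x = x ^ 6 - 2 * (3 * x + 1) ^ 2 := by
  rw [sextic, eval₂_map, sexticInt]
  simp only [eval₂_sub, eval₂_pow, eval₂_mul, eval₂_add, eval₂_X, eval₂_one, eval₂_ofNat]

/-- The sextic field, containing `√2`, over which both number fields are quadratic. -/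
abbrev SexticField : Type := AdjoinRoot sextic

namespace SexticField

/-- The generator of the sextic field. -/
noncomputable abbrev θ : SexticField := AdjoinRoot.root sextic

/-- The square root of `2` in the sextic field. -/
noncomputable def sqrtTwo : SexticField := θ ^ 3 / (3 * θ + 1)

lemma three_mul_add_one_ne_zero {L : Type} [Field L] {x : L}
    (hx : x ^ 6 = 2 * (3 * x + 1) ^ 2) : 3 * x + 1 ≠ 0 := by
  intro h
  rw [h, zero_pow two_ne_zero, mul_zero, pow_eq_zero_iff (by norm_num)] at hx
  simp [hx] at h

lemma θ_pow_six : θ ^ 6 = 2 * (3 * θ + 1) ^ 2 := by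
  have h := AdjoinRoot.eval₂_root sextic
  rwa [eval₂_sextic, sub_eq_zero] at h

/-- The ring homomorphism out of the sextic field determined by the image of `θ`. -/
noncomputable def lift {L : Type} [Field L] [CharZero L] (x : L)
    (hx : x ^ 6 = 2 * (3 * x + 1) ^ 2) : SexticField →+* L :=
  AdjoinRoot.lift (Rat.castHom L) x (by rw [eval₂_sextic, hx, sub_self])

lemma lift_θ {L : Type} [Field L] [CharZero L] (x : L) (hx : x ^ 6 = 2 * (3 * x + 1) ^ 2) :
    lift x hx θ = x := AdjoinRoot.lift_root _

lemma lift_sqrtTwo {L : Type} [Field L] [CharZero L] (x : L)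
    (hx : x ^ 6 = 2 * (3 * x + 1) ^ 2) : lift x hx sqrtTwo = x ^ 3 / (3 * x + 1) := by
  rw [sqrtTwo, map_div₀, map_add, map_mul, map_pow, lift_θ, map_one, map_ofNat]

lemma exists_real_root (ε : ℤˣ) : ∃ x : ℝ, x ^ 3 = (ε : ℤ) * √2 * (3 * x + 1) := by
  have hs : (1 : ℝ) < √2 := Real.lt_sqrt_of_sq_lt (by norm_num)
  have hs2 : √2 < (2 : ℝ) := by
    rw [Real.sqrt_lt' (by norm_num)]
    norm_num
  have hc : Continuous fun x : ℝ => x ^ 3 - (ε : ℤ) * √2 * (3 * x + 1) := by fun_prop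
  rcases Int.units_eq_one_or ε with rfl | rfl
  · obtain ⟨x, -, hx⟩ := intermediate_value_Icc (a := (0 : ℝ)) (b := 3) (by norm_num)
      hc.continuousOn (show (0 : ℝ) ∈ _ by simp; linarith)
    exact ⟨x, sub_eq_zero.1 hx⟩
  · obtain ⟨x, -, hx⟩ := intermediate_value_Icc (a := (-1 : ℝ)) (b := 0) (by norm_num)
      hc.continuousOn (show (0 : ℝ) ∈ _ by norm_num; linarith)
    exact ⟨x, sub_eq_zero.1 hx⟩

lemma pow_six_eq {L : Type} [Field L] {x s : L} (hs : s ^ 2 = 2) (hx : x ^ 3 = s * (3 * x + 1)) :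
    x ^ 6 = 2 * (3 * x + 1) ^ 2 := by
  rw [← hs]
  linear_combination (x ^ 3 + s * (3 * x + 1)) * hx

lemma exists_ringHom_real (ε : ℤˣ) : ∃ f : SexticField →+* ℝ, f sqrtTwo = (ε : ℤ) * √2 := by
  obtain ⟨x, hx⟩ := exists_real_root ε
  have hs : (((ε : ℤ) : ℝ) * √2) ^ 2 = 2 := by
    rw [mul_pow, Real.sq_sqrt zero_le_two]
    rcases Int.units_eq_one_or ε with rfl | rfl <;> simp
  have h6 := pow_six_eq hs hx
  refine ⟨lift x h6, ?_⟩
  rw [lift_sqrtTwo, div_eq_iff (three_mul_add_one_ne_zero h6), hx]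

end SexticField

open SexticField

lemma units_mul_self (ε : ℤˣ) {L : Type} [Field L] : ((ε : ℤ) : L) * (ε : ℤ) = 1 := by
  rcases Int.units_eq_one_or ε with rfl | rfl <;> simp

/-- The defining polynomial `X ^ 2 - ε * √2` of the quadratic extensions of the sextic field. -/
noncomputable def twistPoly (ε : ℤˣ) : SexticField[X] := X ^ 2 - C ((ε : ℤ) * sqrtTwo)

lemma monic_twistPoly (ε : ℤˣ) : (twistPoly ε).Monic := monic_X_pow_sub_C _ two_ne_zero

instance irreducible_twistPoly (ε : ℤˣ) : Fact (Irreducible (twistPoly ε)) := by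
  refine ⟨X_pow_sub_C_irreducible_of_prime Nat.prime_two fun b hb => ?_⟩
  obtain ⟨f, hf⟩ := exists_ringHom_real (-ε)
  have h := congrArg f hb
  rw [map_pow, map_mul, hf, map_intCast, ← mul_assoc, Units.val_neg, Int.cast_neg, mul_neg,
    units_mul_self, neg_mul, one_mul] at h
  have : 0 < √(2 : ℝ) := by positivity
  nlinarith [sq_nonneg (f b)]

/-- The field obtained from the sextic field by adjoining a square root of `ε * √2`. -/
def TwistField (ε : ℤˣ) : Type := AdjoinRoot (twistPoly ε)

namespace TwistField

noncomputable instance (ε : ℤˣ) : Field (TwistField ε) :=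
  inferInstanceAs (Field (AdjoinRoot (twistPoly ε)))

instance (ε : ℤˣ) : CharZero (TwistField ε) :=
  ((AdjoinRoot.of (twistPoly ε)).charZero_iff (AdjoinRoot.of (twistPoly ε)).injective).1
    inferInstance

instance (ε : ℤˣ) : NumberField (TwistField ε) where
  to_finiteDimensional := by
    have _ := monic_sextic.finite_adjoinRoot
    have _ := (monic_twistPoly ε).finite_adjoinRoot
    have _ : FiniteDimensional ℚ (AdjoinRoot (twistPoly ε)) :=
      Module.Finite.trans SexticField _
    exact Module.Finite.equiv (M := AdjoinRoot (twistPoly ε))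
      { AddEquiv.refl (AdjoinRoot (twistPoly ε)) with
        map_smul' := fun c x => map_rat_smul (AddMonoidHom.id (AdjoinRoot (twistPoly ε))) c x }

variable {ε : ℤˣ}

/-- The embedding of the sextic field. -/
noncomputable def ofSextic : SexticField →+* TwistField ε := AdjoinRoot.of (twistPoly ε)

/-- The image of the generator of the sextic field. -/
noncomputable def θ : TwistField ε := ofSextic SexticField.θ

/-- The square root of `ε * √2`. -/
noncomputable def t : TwistField ε := AdjoinRoot.root (twistPoly ε)

lemma θ_pow_six : (θ : TwistField ε) ^ 6 = 2 * (3 * θ + 1) ^ 2 := by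
  have h := congrArg (ofSextic (ε := ε)) SexticField.θ_pow_six
  rwa [map_pow, map_mul, map_pow, map_add, map_mul, map_one, map_ofNat, map_ofNat] at h

lemma t_sq_mul : (t : TwistField ε) ^ 2 * (3 * θ + 1) = ((ε : ℤ) : TwistField ε) * θ ^ 3 := by
  have h : (t : TwistField ε) ^ 2 = ofSextic ((ε : ℤ) * sqrtTwo) := by
    have h := AdjoinRoot.eval₂_root (twistPoly ε)
    rwa [twistPoly, eval₂_sub, eval₂_pow, eval₂_X, eval₂_C, sub_eq_zero] at h
  have h3 : (ofSextic sqrtTwo : TwistField ε) * (3 * θ + 1) = θ ^ 3 := by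
    have h1 : sqrtTwo * (3 * SexticField.θ + 1) = SexticField.θ ^ 3 :=
      div_mul_cancel₀ _ (three_mul_add_one_ne_zero SexticField.θ_pow_six)
    have h2 := congrArg (ofSextic (ε := ε)) h1
    rwa [map_mul, map_add, map_mul, map_pow, map_one, map_ofNat] at h2
  rw [h, map_mul, map_intCast, mul_assoc, h3]

lemma exists_ringHom {L : Type} [Field L] [CharZero L] {x y : L}
    (hx : x ^ 6 = 2 * (3 * x + 1) ^ 2) (hy : y ^ 2 * (3 * x + 1) = (ε : ℤ) * x ^ 3) :
    ∃ f : TwistField ε →+* L, f θ = x ∧ f t = y := by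
  refine ⟨AdjoinRoot.lift (SexticField.lift x hx) y ?_, ?_, AdjoinRoot.lift_root _⟩
  · rw [twistPoly, eval₂_sub, eval₂_pow, eval₂_X, eval₂_C, map_mul, lift_sqrtTwo, map_intCast,
      sub_eq_zero, ← mul_div_assoc, eq_div_iff (three_mul_add_one_ne_zero hx), hy]
  · exact (AdjoinRoot.lift_of _).trans (SexticField.lift_θ x hx)

lemma ringHom_ext {L : Type} [Field L] {f g : TwistField ε →+* L} (hθ : f θ = g θ)
    (ht : f t = g t) : f = g :=
  AdjoinRoot.ringHom_ext (AdjoinRoot.ringHom_ext (Subsingleton.elim _ _) hθ) ht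

end TwistField

end Fields

namespace TwistField

open Polynomial SexticField

variable {ε : ℤˣ}

lemma t_pow_four : (t : TwistField ε) ^ 4 = 2 := by
  have h0 := three_mul_add_one_ne_zero (θ_pow_six (ε := ε))
  apply mul_right_cancel₀ (pow_ne_zero 2 h0)
  rw [← θ_pow_six]
  linear_combination ((t : TwistField ε) ^ 2 * (3 * θ + 1) + ((ε : ℤ) : TwistField ε) * θ ^ 3) *
    t_sq_mul (ε := ε) + (θ : TwistField ε) ^ 6 * units_mul_self ε (L := TwistField ε)

lemma exists_ringHom_of_cubic {L : Type} [Field L] [CharZero L] {x y : L} (hy : y ^ 4 = 2)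
    (hx : x ^ 3 = (ε : ℤ) * y ^ 2 * (3 * x + 1)) :
    ∃ f : TwistField ε →+* L, f θ = x ∧ f t = y := by
  refine exists_ringHom (pow_six_eq ?_ hx) ?_
  · linear_combination y ^ 4 * units_mul_self ε (L := L) + hy
  · rw [hx]
    linear_combination (-y ^ 2 * (3 * x + 1)) * units_mul_self ε (L := L)

lemma split_of_split_of_eq_neg {ε η : ℤˣ} (hη : η = -ε) {T : Type} [Ring T] [Algebra ℚ T]
    [FiniteDimensional ℚ T]
    (h : IsBrauerEquiv (TwistField ε) (TwistField ε ⊗[ℚ] T) (TwistField ε)) :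
    IsBrauerEquiv (TwistField η) (TwistField η ⊗[ℚ] T) (TwistField η) := by
  subst hη
  have d₁ : (X ^ 3 - C (((ε : ℤ) : TwistField (-ε)) * t ^ 2) * (3 * X + 1)).natDegree = 3 := by
    compute_degree!
  have m₁ : (X ^ 3 - C (((ε : ℤ) : TwistField (-ε)) * t ^ 2) * (3 * X + 1)).Monic := by
    monicity!
  obtain ⟨L₁, _, _, _, f₁, x, hx⟩ := exists_extension_root m₁ (by rw [d₁]; norm_num) d₁.le
  obtain ⟨L₂, _, _, _, f₂, y, hy⟩ := exists_extension_root
    (monic_X_pow_sub_C (-(t : TwistField (-ε)) ^ 2) two_ne_zero)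
    (natDegree_X_pow_sub_C).ge (natDegree_X_pow_sub_C.trans_le (by norm_num))
  have _ : CharZero L₁ := charZero_of_injective_algebraMap
    (algebraMap (TwistField (-ε)) L₁).injective
  have _ : CharZero L₂ := charZero_of_injective_algebraMap
    (algebraMap (TwistField (-ε)) L₂).injective
  have ht₁ : algebraMap (TwistField (-ε)) L₁ t ^ 4 = 2 := by
    rw [← map_pow, t_pow_four, map_ofNat]
  obtain ⟨g₁, -⟩ := exists_ringHom_of_cubic (ε := ε) ht₁ (x := x) (by
    simpa only [map_sub, map_mul, map_add, map_pow, aeval_X, aeval_C, map_one, map_intCast,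
      map_ofNat, sub_eq_zero] using hx)
  have hθ := congrArg (algebraMap (TwistField (-ε)) L₂) (θ_pow_six (ε := -ε))
  have ht := congrArg (algebraMap (TwistField (-ε)) L₂) (t_sq_mul (ε := -ε))
  simp only [map_mul, map_add, map_pow, map_one, map_neg, map_intCast, map_ofNat,
    Units.val_neg, Int.cast_neg] at hθ ht
  obtain ⟨g₂, -⟩ := exists_ringHom (ε := ε) hθ (y := y) (by
    simp only [map_sub, map_pow, aeval_X, aeval_C, map_neg] at hy
    linear_combination (3 * algebraMap (TwistField (-ε)) L₂ θ + 1) * hy - ht)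
  refine split_of_coprime_extensions ?_ g₁ g₂ h
  rw [d₁] at f₁
  rw [natDegree_X_pow_sub_C] at f₂
  rcases f₁ with f₁ | f₁ <;> rcases f₂ with f₂ | f₂ <;> rw [f₁, f₂] <;> norm_num

lemma exists_ringHom_real (ε : ℤˣ) : ∃ f : TwistField ε →+* ℝ, f t ^ 2 = √2 := by
  obtain ⟨x, hx⟩ := exists_real_root ε
  have h : √(√2) ^ 2 = √2 := Real.sq_sqrt (Real.sqrt_nonneg 2)
  have h4 : √(√2) ^ 4 = 2 := by
    rw [show 4 = 2 * 2 from rfl, pow_mul, h, Real.sq_sqrt zero_le_two]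
  rw [← h] at hx
  obtain ⟨f, -, hf⟩ := exists_ringHom_of_cubic h4 hx
  exact ⟨f, by rw [hf, h]⟩

lemma im_eq_zero_of_cubic {w : ℂ} (hw : w ^ 3 = (√2 : ℝ) * (3 * w + 1)) : w.im = 0 := by
  have h2 : √(2 : ℝ) ^ 2 = 2 := Real.sq_sqrt zero_le_two
  have hs : (0 : ℝ) < √2 := by positivity
  have hre := congrArg Complex.re hw
  have him := congrArg Complex.im hw
  simp [pow_succ] at hre him
  set s := √(2 : ℝ)
  set u := w.re
  set v := w.im
  by_contra hv
  have h1 : v ^ 2 = 3 * u ^ 2 - 3 * s := by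
    apply mul_left_cancel₀ hv
    linear_combination -him
  have h3 : 8 * u ^ 3 - 6 * s * u + s = 0 := by
    linear_combination -hre - 3 * u * h1
  have h4 : s < u ^ 2 := by nlinarith [sq_pos_of_ne_zero hv]
  have h5 : u ^ 2 * (8 * u ^ 2 - 6 * s) ^ 2 = 2 := by
    linear_combination (8 * u ^ 3 - 6 * s * u - s) * h3 + h2
  have h6 : 0 < s - 1 := by nlinarith
  nlinarith [mul_pos hs hs, mul_lt_mul h4 h4.le hs (sq_nonneg u), sq_nonneg (u^2-s)]

lemma exists_ringHom_complex : ∃ f : TwistField (-1) →+* ℂ,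
    (f θ).im ≠ 0 ∧ (f t).im = 0 ∧ f t ^ 2 = (√2 : ℝ) := by
  obtain ⟨x, hx⟩ := exists_real_root (-1)
  have h : √(√2) ^ 2 = √2 := Real.sq_sqrt (Real.sqrt_nonneg 2)
  have hr : √(3 * x ^ 2 + 12 * √2) ^ 2 = 3 * x ^ 2 + 12 * √2 := Real.sq_sqrt (by positivity)
  have hrpos : 0 < √(3 * x ^ 2 + 12 * √2) := by positivity
  have h4 : ((√(√2) : ℝ) : ℂ) ^ 4 = 2 := by
    rw [show 4 = 2 * 2 from rfl, pow_mul, ← Complex.ofReal_pow, h, ← Complex.ofReal_pow,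
      Real.sq_sqrt zero_le_two, Complex.ofReal_ofNat]
  obtain ⟨f, hθ, ht⟩ := exists_ringHom_of_cubic (ε := -1) h4
    (x := ⟨-x / 2, √(3 * x ^ 2 + 12 * √2) / 2⟩) (by
      rw [← Complex.ofReal_pow, h]
      set s := √(2 : ℝ)
      set r := √(3 * x ^ 2 + 12 * s)
      simp at hx
      apply Complex.ext <;> simp [pow_succ]
      · linear_combination hx + 3 * x / 8 * hr
      · linear_combination -r / 8 * hr)
  refine ⟨f, ?_, ?_, ?_⟩
  · rw [hθ]
    exact (half_pos hrpos).ne'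
  · rw [ht, Complex.ofReal_im]
  · rw [ht, ← Complex.ofReal_pow, h]

lemma isEmpty_ringEquiv : IsEmpty (TwistField 1 ≃+* TwistField (-1)) := by
  refine ⟨fun φ => ?_⟩
  have h4 : φ t ^ 4 = 2 := by rw [← map_pow, t_pow_four, map_ofNat]
  have h : φ t ^ 2 = t ^ 2 ∨ φ t ^ 2 = -t ^ 2 := by
    rw [← sq_eq_sq_iff_eq_or_eq_neg]
    linear_combination h4 - t_pow_four (ε := -1)
  rcases h with h | h
  · obtain ⟨f, hθ, ht, ht2⟩ := exists_ringHom_complex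
    have h1 : f (φ t) ^ 2 = f t ^ 2 := by rw [← map_pow, h, map_pow]
    have h2 : (f (φ θ)).im = 0 := by
      refine im_eq_zero_of_cubic ?_
      have h3 := congrArg (f.comp (φ : TwistField 1 →+* TwistField (-1))) (t_sq_mul (ε := 1))
      simp only [RingHom.comp_apply, RingHom.coe_coe, map_mul, map_add, map_pow, map_one,
        map_ofNat, Units.val_one, Int.cast_one, one_mul, h1, ht2] at h3
      exact h3.symm
    have h3 : (f (φ t)).im = 0 := by
      rcases sq_eq_sq_iff_eq_or_eq_neg.1 h1 with h1 | h1 <;> simp [h1, ht]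
    have h5 : (starRingEnd ℂ).comp (f.comp (φ : TwistField 1 →+* TwistField (-1))) =
        f.comp (φ : TwistField 1 →+* TwistField (-1)) :=
      ringHom_ext (Complex.conj_eq_iff_im.2 h2) (Complex.conj_eq_iff_im.2 h3)
    have h6 := RingHom.congr_fun h5 (φ.symm θ)
    simp only [RingHom.comp_apply, RingHom.coe_coe, φ.apply_symm_apply] at h6
    exact hθ (Complex.conj_eq_iff_im.1 h6)
  · obtain ⟨f, hf⟩ := exists_ringHom_real (-1)
    have h1 := congrArg f h
    rw [map_neg, map_pow, map_pow, hf] at h1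
    have h2 : 0 < √(2 : ℝ) := by positivity
    nlinarith [sq_nonneg (f (φ t))]

open scoped Quaternion

lemma split_iff_split_neg {T : Type} [Ring T] [Algebra ℚ T] [FiniteDimensional ℚ T] :
    IsBrauerEquiv (TwistField 1) (TwistField 1 ⊗[ℚ] T) (TwistField 1) ↔
      IsBrauerEquiv (TwistField (-1)) (TwistField (-1) ⊗[ℚ] T) (TwistField (-1)) :=
  ⟨split_of_split_of_eq_neg rfl, split_of_split_of_eq_neg (neg_neg 1).symm⟩

/-- A real embedding of `TwistField ε`. -/
noncomputable def toReal (ε : ℤˣ) : TwistField ε →+* ℝ := (exists_ringHom_real ε).choose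

/-- Hamilton's quaternion algebra over `TwistField ε`. -/
noncomputable def hamilton (ε : ℤˣ) : CSAlg (TwistField ε) :=
  quaternionCSAlg (toReal ε) (-1) (by simp)

lemma isBrauerEquiv_baseChange_hamilton (ε : ℤˣ) {n : ℚ} (hn : n ≠ 0) (x y : TwistField ε)
    (hxy : algebraMap ℚ (TwistField ε) n = x ^ 2 + y ^ 2) :
    IsBrauerEquiv (TwistField ε) (TwistField ε ⊗[ℚ] ℍ[ℚ,-1,-n]) (hamilton ε).carrier :=
  .of_algEquiv (nonempty_baseChange_quaternion hn x y hxy).some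

lemma inFiber_hamilton_iff (ε : ℤˣ) (B : CSAlg ℚ) :
    InFiber ℚ (TwistField ε) (hamilton ε) B ↔
      IsBrauerEquiv (TwistField ε) (TwistField ε ⊗[ℚ] (B.carrier ⊗[ℚ] ℍ[ℚ,-1,-1]))
        (TwistField ε) :=
  isBrauerEquiv_baseChange_iff_s3 (QuaternionAlgebra.isBrauerEquiv_tensor_self (by norm_num))
    (isBrauerEquiv_baseChange_hamilton ε one_ne_zero 1 0 (by simp))

end TwistField

/-- The rational quaternion algebra `(-1, -(r ^ 2 + 2))` with `r = oddSeq i`. -/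
noncomputable def rationalQuaternion (i : ℕ) : CSAlg ℚ :=
  quaternionCSAlg (algebraMap ℚ ℝ) (-((oddSeq i ^ 2 + 2 : ℕ) : ℚ)) (by
    rw [map_neg, map_natCast]
    exact neg_neg_of_pos (by positivity))

lemma not_isBrauerEquiv_rationalQuaternion {i j : ℕ} (h : i ≠ j) :
    ¬ IsBrauerEquiv ℚ (rationalQuaternion i).carrier (rationalQuaternion j).carrier := by
  intro hB
  obtain ⟨u, v, huv⟩ := QuaternionAlgebra.exists_mul_eq_of_isBrauerEquiv
    (p := (oddSeq i ^ 2 + 2 : ℕ)) (q := (oddSeq j ^ 2 + 2 : ℕ)) (by positivity) (by positivity) hB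
  exact mul_sq_add_sq_ne_of_coprime (oddSeq_sq_add_two_mod_four i) (by positivity)
    (coprime_oddSeq_sq_add_two h) u v huv

lemma inFiber_rationalQuaternion (i : ℕ) :
    InFiber ℚ (TwistField 1) (TwistField.hamilton 1) (rationalQuaternion i) :=
  TwistField.isBrauerEquiv_baseChange_hamilton 1 (n := (oddSeq i ^ 2 + 2 : ℕ)) (by positivity)
    (oddSeq i) (TwistField.t ^ 2) (by
      rw [← pow_mul, TwistField.t_pow_four]
      simp)

/-- There exist non-isomorphic number fields `K, K'` and quaternion
division algebras `A/K`, `A'/K'` (central division algebras of degree `2`) with equal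
fibers of the restriction map over `ℚ`, such that the fiber `(Res_{K/ℚ})⁻¹(A)` contains
infinitely many pairwise non-Brauer-equivalent central simple `ℚ`-algebras. -/
theorem stmt_3 :
    ∃ (K K' : NumField), IsEmpty (K.carrier ≃+* K'.carrier) ∧
      ∃ (A : CSAlg K.carrier) (A' : CSAlg K'.carrier),
        A.IsDivision ∧ A.DegreeEq 2 ∧ A'.IsDivision ∧ A'.DegreeEq 2 ∧
        (∀ B : CSAlg ℚ, InFiber ℚ K.carrier A B ↔ InFiber ℚ K'.carrier A' B) ∧
        ∃ B : ℕ → CSAlg ℚ,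
          (∀ i, InFiber ℚ K.carrier A (B i)) ∧
          (∀ i j, i ≠ j → ¬ IsBrauerEquiv ℚ (B i).carrier (B j).carrier) := by
  refine ⟨⟨TwistField 1⟩, ⟨TwistField (-1)⟩, TwistField.isEmpty_ringEquiv,
    TwistField.hamilton 1, TwistField.hamilton (-1), quaternionCSAlg_isDivision _ _ _,
    quaternionCSAlg_degreeEq _ _ _, quaternionCSAlg_isDivision _ _ _,
    quaternionCSAlg_degreeEq _ _ _, fun B => ?_, rationalQuaternion,
    inFiber_rationalQuaternion, fun i j h => not_isBrauerEquiv_rationalQuaternion h⟩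
  have _ := B.finiteDimensional
  exact (TwistField.inFiber_hamilton_iff 1 B).trans
    ((TwistField.split_iff_split_neg (T := B.carrier ⊗[ℚ] QuaternionAlgebra ℚ (-1) 0 (-1))).trans
      (TwistField.inFiber_hamilton_iff (-1) B).symm)
end
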